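/- Let ℚ̄ be an algebraic closure of ℚ and n ≥ 1. Let γ₁, …, γ_r ∈ GL_n(ℚ̄) be matrices such that for some index s ∈ {1, …, r}, the matrix γ_s is unipotent (i.e., (γ_s − I_n)^n = 0) and γ_s ≠ I_n, while every γ_i with i ≠ s is semi-simple. Let γ ∈ GL_n(ℚ̄) be a semi-simple matrix having an eigenvalue λ ∈ ℚ̄ˣ that is not a root of unity and such that the cyclic subgroup ⟨λ⟩ of ℚ̄ˣ intersects the product of subgroups Λ(γ₁)⋯Λ(γ_r) trivially. Then the set J = { m ∈ ℤ : γ^m = γ₁^{k₁}⋯γ_r^{k_r} for some k₁,…,k_r ∈ ℤ } is finite. -/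

import Mathlib

open Matrix

/-- An element of `GL n ℚ̄` is semi-simple if the corresponding linear endomorphism
of `ℚ̄^n` is a semisimple endomorphism. -/
def IsSemisimpleElt {n : ℕ} (g : GL (Fin n) (AlgebraicClosure ℚ)) : Prop :=
  Module.End.IsSemisimple ((g : Matrix (Fin n) (Fin n) (AlgebraicClosure ℚ)).mulVecLin)

/-- `Λ(g)`: the subgroup of `ℚ̄ˣ` generated by the eigenvalues of `g`
(the roots of its characteristic polynomial). -/
noncomputable def eigGroup {n : ℕ} (g : GL (Fin n) (AlgebraicClosure ℚ)) :
    Subgroup (AlgebraicClosure ℚ)ˣ :=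
  Subgroup.closure {u : (AlgebraicClosure ℚ)ˣ |
    ((g : Matrix (Fin n) (Fin n) (AlgebraicClosure ℚ)).charpoly).IsRoot
      (u : AlgebraicClosure ℚ)}

open MvPolynomial

namespace SU

/-- weight of a monomial -/
noncomputable def mon {σ : Type*} (w : σ → ℝ) (e : σ →₀ ℕ) : ℝ := e.prod fun i k => w i ^ k

/-- weighted `L1` norm -/
noncomputable def nrm {σ R : Type*} [CommRing R] (a : AbsoluteValue R ℝ) (w : σ → ℝ)
    (f : MvPolynomial σ R) : ℝ := ∑ e ∈ f.support, a (coeff e f) * mon w e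

section norm
variable {σ τ R : Type*} [CommRing R] {a : AbsoluteValue R ℝ} {w : σ → ℝ}

lemma mon_nonneg (hw : ∀ i, 0 ≤ w i) (e : σ →₀ ℕ) : 0 ≤ mon w e :=
  Finset.prod_nonneg fun i _ => pow_nonneg (hw i) _

lemma mon_add (e e' : σ →₀ ℕ) : mon w (e + e') = mon w e * mon w e' :=
  Finsupp.prod_add_index' (by simp) (by intros; rw [pow_add])

lemma mon_zero : mon w 0 = 1 := by simp [mon]

lemma mon_one (e : σ →₀ ℕ) : mon (fun _ : σ => (1:ℝ)) e = 1 := by simp [mon]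

lemma nrm_nonneg (hw : ∀ i, 0 ≤ w i) (f : MvPolynomial σ R) : 0 ≤ nrm a w f :=
  Finset.sum_nonneg fun e _ => mul_nonneg (a.nonneg _) (mon_nonneg hw e)

lemma nrm_eq_sum (f : MvPolynomial σ R) (s : Finset (σ →₀ ℕ)) (h : f.support ⊆ s) :
    nrm a w f = ∑ e ∈ s, a (coeff e f) * mon w e := by
  refine Finset.sum_subset h fun e _ he => ?_
  simp [notMem_support_iff.1 he]

lemma nrm_monomial (e : σ →₀ ℕ) (c : R) : nrm a w (monomial e c) = a c * mon w e := by
  classical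
  rw [nrm_eq_sum _ {e} support_monomial_subset]; simp

lemma nrm_zero : nrm a w (0 : MvPolynomial σ R) = 0 := by simp [nrm]

lemma nrm_C (c : R) : nrm a w (C c) = a c := by
  rw [C_apply, nrm_monomial, mon_zero, mul_one]

lemma nrm_X (i : σ) [Nontrivial R] (ha : a 1 = 1) : nrm a w (X i : MvPolynomial σ R) = w i := by
  rw [X, nrm_monomial, ha]; simp [mon]

lemma nrm_add_le (hw : ∀ i, 0 ≤ w i) (f g : MvPolynomial σ R) :
    nrm a w (f + g) ≤ nrm a w f + nrm a w g := by
  classical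
  rw [nrm_eq_sum (f + g) _ support_add, nrm_eq_sum f _ Finset.subset_union_left,
    nrm_eq_sum g _ Finset.subset_union_right, ← Finset.sum_add_distrib]
  refine Finset.sum_le_sum fun e _ => ?_
  rw [← add_mul, coeff_add]
  exact mul_le_mul_of_nonneg_right (a.add_le _ _) (mon_nonneg hw e)

lemma nrm_sum_le {κ : Type*} (hw : ∀ i, 0 ≤ w i) (s : Finset κ) (f : κ → MvPolynomial σ R) :
    nrm a w (∑ k ∈ s, f k) ≤ ∑ k ∈ s, nrm a w (f k) := by
  classical
  induction s using Finset.induction_on with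
  | empty => simp [nrm_zero]
  | insert k s hk ih =>
    rw [Finset.sum_insert hk, Finset.sum_insert hk]
    exact (nrm_add_le hw _ _).trans (by gcongr)

lemma nrm_mul_le (hw : ∀ i, 0 ≤ w i) (f g : MvPolynomial σ R) :
    nrm a w (f * g) ≤ nrm a w f * nrm a w g := by
  classical
  have h1 : f * g = ∑ e ∈ f.support, ∑ e' ∈ g.support,
      monomial (e + e') (coeff e f * coeff e' g) := by
    rw [mul_def]; rfl
  rw [h1]
  refine (nrm_sum_le hw _ _).trans ?_
  rw [nrm, nrm, Finset.sum_mul]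
  refine Finset.sum_le_sum fun e _ => (nrm_sum_le hw _ _).trans ?_
  rw [Finset.mul_sum]
  refine Finset.sum_le_sum fun e' _ => ?_
  rw [nrm_monomial, mon_add, a.map_mul]
  apply le_of_eq; ring

lemma nrm_prod_le [Nontrivial R] (ha : a 1 = 1) {κ : Type*} (hw : ∀ i, 0 ≤ w i) (s : Finset κ)
    (f : κ → MvPolynomial σ R) :
    nrm a w (∏ k ∈ s, f k) ≤ ∏ k ∈ s, nrm a w (f k) := by
  classical
  induction s using Finset.induction_on with
  | empty => simp only [Finset.prod_empty]; rw [← C_1, nrm_C, ha]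
  | insert k s hk ih =>
    rw [Finset.prod_insert hk, Finset.prod_insert hk]
    exact (nrm_mul_le hw _ _).trans (by gcongr; exact nrm_nonneg hw _)

lemma nrm_pow_le [Nontrivial R] (ha : a 1 = 1) (hw : ∀ i, 0 ≤ w i) (f : MvPolynomial σ R) (n : ℕ) :
    nrm a w (f ^ n) ≤ nrm a w f ^ n := by
  simpa using nrm_prod_le ha hw (Finset.range n) (fun _ => f)

lemma coeff_le_nrm (hw : ∀ i, 0 ≤ w i) (f : MvPolynomial σ R) (e : σ →₀ ℕ) :
    a (coeff e f) * mon w e ≤ nrm a w f := by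
  classical
  rw [nrm_eq_sum f (insert e f.support) (Finset.subset_insert _ _)]
  exact Finset.single_le_sum (f := fun e => a (coeff e f) * mon w e)
    (fun e _ => mul_nonneg (a.nonneg _) (mon_nonneg hw e)) (Finset.mem_insert_self _ _)

lemma av_nat_le [Nontrivial R] (ha : a 1 = 1) (n : ℕ) : a (n : R) ≤ n := by
  induction n with
  | zero => simp
  | succ n ih =>
    push_cast
    exact (a.add_le _ _).trans (by rw [ha]; gcongr)

lemma av_int_le [Nontrivial R] (ha : a 1 = 1) (n : ℤ) : a (n : R) ≤ |(n : ℝ)| := by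
  have hneg : ∀ x : R, a (-x) = a x := fun x => by
    have h1 : a (-1) = 1 := by
      have : a (-1) * a (-1) = 1 := by rw [← a.map_mul]; simp [ha]
      nlinarith [a.nonneg (-1 : R)]
    rw [neg_eq_neg_one_mul, a.map_mul, h1, one_mul]
  rcases Int.natAbs_eq n with h | h
  · rw [h]; simpa using av_nat_le ha n.natAbs
  · rw [h]; push_cast; rw [hneg]; simpa using av_nat_le ha n.natAbs

/-- the standard absolute value on `ℤ` with real values -/
noncomputable def iabs : AbsoluteValue ℤ ℝ where
  toFun z := |(z : ℝ)|
  map_mul' x y := by push_cast; exact abs_mul _ _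
  nonneg' x := abs_nonneg _
  eq_zero' x := by simp
  add_le' x y := by push_cast; exact abs_add_le _ _

lemma iabs_apply (z : ℤ) : iabs z = |(z : ℝ)| := rfl

lemma iabs_one : iabs 1 = 1 := by simp

lemma nrm_aeval_le [Nontrivial R] (ha : a 1 = 1) {w' : τ → ℝ} (hw' : ∀ i, 0 ≤ w' i)
    (g : σ → MvPolynomial τ R) (hg : ∀ i, nrm a w' (g i) ≤ w i) (f : MvPolynomial σ ℤ) :
    nrm a w' (aeval g f) ≤ nrm iabs w f := by
  classical
  have h1 : aeval g f = ∑ e ∈ f.support, C ((coeff e f : ℤ) : R) * e.prod fun i k => g i ^ k := by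
    rw [aeval_eq_eval₂Hom, coe_eval₂Hom, eval₂_eq]
    refine Finset.sum_congr rfl fun e _ => ?_
    congr 1
  rw [h1]
  refine (nrm_sum_le hw' _ _).trans ?_
  refine Finset.sum_le_sum fun e _ => (nrm_mul_le hw' _ _).trans ?_
  rw [nrm_C]
  have h2 : nrm a w' (e.prod fun i k => g i ^ k) ≤ mon w e := by
    refine (nrm_prod_le ha hw' _ _).trans ?_
    refine Finset.prod_le_prod (fun i _ => nrm_nonneg hw' _) fun i _ => ?_
    exact (nrm_pow_le ha hw' _ _).trans (pow_le_pow_left₀ (nrm_nonneg hw' _) (hg i) _)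
  exact mul_le_mul (av_int_le ha _) h2 (nrm_nonneg hw' _) (abs_nonneg _)

end norm
end SU

open Matrix
lemma der_prod {R ι : Type*} [CommRing R] [DecidableEq ι] (dd : Derivation ℤ R R) (s : Finset ι) (f : ι → R) :
    dd (∏ i ∈ s, f i) = ∑ i ∈ s, ∏ j ∈ s, Function.update f i (dd (f i)) j := by
  induction s using Finset.induction_on with
  | empty => simp
  | insert k s hk ih =>
    rw [Finset.prod_insert hk, Derivation.leibniz, ih, Finset.sum_insert hk, Finset.prod_insert hk,
      add_comm]
    simp only [smul_eq_mul]
    congr 1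
    · rw [mul_comm, Function.update_self]; congr 1
      refine Finset.prod_congr rfl fun j hj => ?_
      rw [Function.update_of_ne (by rintro rfl; exact hk hj)]
    · rw [Finset.mul_sum]
      refine Finset.sum_congr rfl fun i hi => ?_
      rw [Finset.prod_insert hk, Function.update_of_ne (by rintro rfl; exact hk hi)]

lemma der_det {R ι : Type*} [CommRing R] [DecidableEq ι] [Fintype ι] (dd : Derivation ℤ R R)
    (M : Matrix ι ι R) :
    dd M.det = ∑ i, (M.updateRow i fun j => dd (M i j)).det := by
  simp only [det_apply']
  rw [map_sum, Finset.sum_comm]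
  refine Finset.sum_congr rfl fun p _ => ?_
  rw [← Finset.mul_sum, Derivation.leibniz]
  simp only [smul_eq_mul]
  rw [der_prod]
  have hz : (∏ i, M (p i) i) * dd (((Equiv.Perm.sign p : ℤ)) : R) = 0 := by
    rw [Derivation.map_intCast, mul_zero]
  rw [hz, add_zero]
  congr 1
  refine Fintype.sum_equiv p (fun i => ∏ j, Function.update (fun i => M (p i) i) i (dd (M (p i) i)) j)
    (fun i => ∏ j, (M.updateRow i fun j => dd (M i j)) (p j) j) fun i => Finset.prod_congr rfl fun j _ => ?_
  rw [updateRow_apply, Function.update_apply]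
  by_cases h : j = i
  · subst h; simp
  · simp [h]

/-- rows `0..k-1, k+1`. -/
def skp (k : ℕ) (i : Fin (k+1)) : ℕ := if i = Fin.last k then k + 1 else i

lemma der_wr {R : Type*} [CommRing R] (dd : Derivation ℤ R R) (k : ℕ) (E : ℕ → Fin (k+1) → R)
    (hE : ∀ n j, dd (E n j) = ((n:ℤ)+1) * E (n+1) j) :
    dd (Matrix.of fun i j : Fin (k+1) => E i j).det
      = ((k:ℤ)+1) * (Matrix.of fun i j : Fin (k+1) => E (skp k i) j).det := by
  rw [der_det, Finset.sum_eq_single (Fin.last k)]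
  · have : (fun j => dd ((Matrix.of fun i j : Fin (k+1) => E i j) (Fin.last k) j)) =
        (((k:ℤ)+1 : R)) • (fun j => E (k+1) j) := by
      ext j; simp [hE]
    rw [this, det_updateRow_smul]
    congr 2
    ext i j
    rw [updateRow_apply]; simp only [of_apply, skp]; split_ifs <;> rfl
  · intro i _ hi
    have hlt : (i : ℕ) < k := by
      have := Fin.lt_last_iff_ne_last.2 hi; exact this
    have : (fun j => dd ((Matrix.of fun i j : Fin (k+1) => E i j) i j)) =
        ((((i:ℕ):ℤ)+1 : R)) • (fun j => E (i+1) j) := by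
      ext j; simp [hE]
    rw [this, det_updateRow_smul]
    rw [det_zero_of_row_eq (i := i) (j := ⟨i+1, by omega⟩), mul_zero]
    · intro h; have := congrArg Fin.val h; simp at this
    · rw [updateRow_self, updateRow_ne]
      · rfl
      · intro h; have := congrArg Fin.val h; simp at this
  · simp

lemma toda {R : Type*} [CommRing R] [IsDomain R] (d0 d1 : Derivation ℤ R R) (D : ℕ → ℕ → R)
    (h0 : ∀ i j, d0 (D i j) = ((i:ℤ)+1) * D (i+1) j) (h1 : ∀ i j, d1 (D i j) = ((j:ℤ)+1) * D i (j+1))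
    (k : ℕ) (hk : (Matrix.of fun i j : Fin (k+1) => D i j).det ≠ 0)
    (hk' : (Matrix.of fun i j : Fin (k+2) => D i j).det = 0) :
    let W := (Matrix.of fun i j : Fin (k+1) => D i j).det
    W * d1 (d0 W) = d0 W * d1 W := by
  intro W
  set M : Matrix (Fin (k+2)) (Fin (k+2)) R := Matrix.of fun i j : Fin (k+2) => D i j with hM
  set p : Fin (k+2) := (Fin.last k).castSucc
  set q : Fin (k+2) := Fin.last (k+1)
  have hp : ∀ i : Fin (k+1), ((p.succAbove i : Fin (k+2)) : ℕ) = skp k i := by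
    intro i
    unfold skp
    by_cases h : i = Fin.last k
    · subst h; simp [p]
    · have hlt : (i : ℕ) < k := Fin.lt_last_iff_ne_last.2 h
      rw [if_neg h, Fin.succAbove_of_castSucc_lt]
      · rfl
      · simpa [p, Fin.lt_def] using hlt
  have hq : ∀ i : Fin (k+1), ((q.succAbove i : Fin (k+2)) : ℕ) = i := by
    intro i; simp [q]
  have e0 : d0 W = ((k:ℤ)+1) * (M.submatrix p.succAbove q.succAbove).det := by
    refine (der_wr d0 k (fun n j => D n j) (fun n j => h0 n j)).trans ?_
    congr 2; ext i j; simp only [hM, of_apply, submatrix_apply, hp, hq]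
  have e1 : d1 W = ((k:ℤ)+1) * (M.submatrix q.succAbove p.succAbove).det := by
    have := der_wr d1 k (fun n j => D j n) (fun n j => h1 j n)
    rw [← det_transpose, ← det_transpose (Matrix.of _)] at this
    refine this.trans ?_
    congr 2; ext i j; simp only [hM, of_apply, submatrix_apply, hp, hq, transpose_apply]
  have e2 : d1 (d0 W) = ((k:ℤ)+1) * (((k:ℤ)+1) * (M.submatrix p.succAbove p.succAbove).det) := by
    rw [e0, Derivation.leibniz]
    have hz : d1 (((k:ℤ):R)+1) = 0 := by simp
    rw [hz, smul_zero, add_zero, smul_eq_mul]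
    congr 1
    have := der_wr d1 k (fun n j => D (skp k j) n) (fun n j => h1 _ n)
    rw [← det_transpose, ← det_transpose (Matrix.of _)] at this
    have hh : (M.submatrix p.succAbove q.succAbove) =
      (Matrix.of fun i j : Fin (k+1) => D (skp k j) i)ᵀ := by
      ext i j; simp only [hM, of_apply, submatrix_apply, hp, hq, transpose_apply]
    rw [hh, this]
    congr 2; ext i j; simp only [hM, of_apply, submatrix_apply, hp, transpose_apply]
  have e3 : W = (M.submatrix q.succAbove q.succAbove).det := by
    simp only [W]; congr 1; ext i j; simp only [hM, of_apply, submatrix_apply, hq]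
  -- columns of adjugate
  have hker : ∀ x : Fin (k+2) → R, M *ᵥ x = 0 → x q = 0 → x = 0 := by
    intro x hx hxq
    have : (M.submatrix q.succAbove q.succAbove) *ᵥ (fun i => x (q.succAbove i)) = 0 := by
      ext i
      have := congrFun hx (q.succAbove i)
      simp only [mulVec, dotProduct] at this ⊢
      rw [Fin.sum_univ_succAbove _ q, hxq, mul_zero, zero_add] at this
      simpa using this
    have h2 := Matrix.eq_zero_of_mulVec_eq_zero (e3 ▸ hk) this
    ext i
    rcases Fin.eq_self_or_eq_succAbove q i with h | ⟨j, h⟩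
    · rw [h, hxq]; rfl
    · rw [h]; exact congrFun h2 j
  have hadj : ∀ j, M *ᵥ (fun i => M.adjugate i j) = 0 := by
    intro j
    have := mul_adjugate M
    rw [hk', zero_smul] at this
    ext i; exact congrFun (congrFun this i) j
  have key := congrFun (hker (fun i => M.adjugate q q * M.adjugate i p - M.adjugate q p * M.adjugate i q)
    (by
      have : (fun i => M.adjugate q q * M.adjugate i p - M.adjugate q p * M.adjugate i q)
        = M.adjugate q q • (fun i => M.adjugate i p) - M.adjugate q p • (fun i => M.adjugate i q) := by
        ext i; simp
      rw [this, mulVec_sub, mulVec_smul, mulVec_smul, hadj, hadj]; simp)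
    (by ring)) p
  simp only [adjugate_fin_succ_eq_det_submatrix, Pi.zero_apply] at key
  rw [← e3] at key
  have hpq : ((p:ℕ)) = k := rfl
  have hqq : ((q:ℕ)) = k+1 := rfl
  rw [hpq, hqq] at key
  have s1 : ((-1:R))^(k+k) = 1 := by rw [← two_mul]; simp
  have s2 : ((-1:R))^(k+1+(k+1)) = 1 := by rw [← two_mul]; simp
  have s3 : ((-1:R))^(k+(k+1)) = -1 := by rw [← add_assoc, pow_succ, s1]; simp
  have s4 : ((-1:R))^(k+1+k) = -1 := by rw [add_assoc, add_comm 1, s3]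
  rw [s1, s2, s3, s4] at key
  rw [e2, e0, e1]
  linear_combination (((k:ℤ):R)+1)^2 * key

open MvPolynomial
namespace SU
section cf
variable {σ : Type*} [DecidableEq σ]

/-- view as polynomial in the variable `j` -/
noncomputable def tu (j : σ) : MvPolynomial σ ℤ →ₐ[ℤ] Polynomial (MvPolynomial σ ℤ) :=
  aeval fun i => if i = j then Polynomial.X else Polynomial.C (X i)

noncomputable def cf (j : σ) (b : ℕ) (W : MvPolynomial σ ℤ) : MvPolynomial σ ℤ := (tu j W).coeff b

lemma tu_monomial (j : σ) (e : σ →₀ ℕ) (c : ℤ) :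
    tu j (monomial e c) = Polynomial.C (monomial (e.erase j) c) * Polynomial.X ^ (e j) := by
  rw [tu, aeval_monomial]
  have h1 : e = e.erase j + Finsupp.single j (e j) := (Finsupp.erase_add_single j e).symm
  conv_lhs => rw [h1]
  rw [Finsupp.prod_add_index' (by simp) (by intros; rw [pow_add]),
    Finsupp.prod_single_index (by simp), if_pos rfl, ← mul_assoc]
  congr 1
  rw [monomial_eq, Polynomial.C_mul, Finsupp.prod, Finsupp.prod, map_prod]
  congr 1
  refine Finset.prod_congr rfl fun i hi => ?_
  have : i ≠ j := by
    rintro rfl; simp at hi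
  simp [this]

lemma coeff_cf (j : σ) (b : ℕ) (W : MvPolynomial σ ℤ) (e : σ →₀ ℕ) :
    coeff e (cf j b W) = if e j = 0 then coeff (e + Finsupp.single j b) W else 0 := by
  induction W using MvPolynomial.induction_on' with
  | monomial u a =>
    rw [cf, tu_monomial, Polynomial.coeff_C_mul, Polynomial.coeff_X_pow]
    by_cases hb : b = u j
    · rw [if_pos hb, mul_one, coeff_monomial, coeff_monomial]
      by_cases h0 : e j = 0
      · rw [if_pos h0]
        have : (u.erase j = e) ↔ (u = e + Finsupp.single j b) := by
          constructor
          · rintro rfl; rw [hb, Finsupp.erase_add_single]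
          · intro h; ext i
            by_cases hi : i = j
            · subst hi; simp [h0]
            · rw [Finsupp.erase_ne hi, h]; simp [Finsupp.single_apply, Ne.symm hi]
        simp only [this]
      · rw [if_neg h0, if_neg]; rintro rfl; simp at h0
    · rw [if_neg hb, mul_zero, coeff_zero]
      split_ifs with h0
      · rw [coeff_monomial, if_neg]
        rintro rfl; simp [h0] at hb
      · rfl
  | add p q hp hq =>
    have : cf j b (p + q) = cf j b p + cf j b q := by simp [cf]
    rw [this, coeff_add, hp, hq, coeff_add]; split_ifs <;> simp

lemma cf_pderiv {i j : σ} (hij : i ≠ j) (b : ℕ) (W : MvPolynomial σ ℤ) :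
    cf j b (pderiv i W) = pderiv i (cf j b W) := by
  ext e
  rw [coeff_cf, coeff_pderiv, coeff_pderiv, coeff_cf]
  simp only [Finsupp.add_apply, Finsupp.single_apply, if_neg hij, if_neg hij.symm, add_zero]
  rw [add_right_comm]; split_ifs <;> simp

lemma pderiv_cf (j : σ) (b : ℕ) (W : MvPolynomial σ ℤ) : pderiv j (cf j b W) = 0 := by
  ext e
  rw [coeff_pderiv, coeff_cf]
  simp

lemma tu_of_pderiv_eq_zero (j : σ) (f : MvPolynomial σ ℤ) (h : pderiv j f = 0) :
    tu j f = Polynomial.C f := by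
  have h2 : ∀ e, e j ≠ 0 → coeff e f = 0 := by
    intro e he
    have := congrArg (coeff (e - Finsupp.single j 1)) h
    rw [coeff_pderiv, coeff_zero] at this
    have h3 : e - Finsupp.single j 1 + Finsupp.single j 1 = e := by
      apply tsub_add_cancel_of_le
      rw [Finsupp.single_le_iff]; omega
    rw [h3] at this
    rcases mul_eq_zero.1 this with h | h
    · exact h
    · exfalso
      have : (0:ℤ) ≤ (((e - Finsupp.single j 1 : σ →₀ ℕ) j : ℕ) : ℤ) := by positivity
      omega
  ext b : 1
  change cf j b f = _
  rw [Polynomial.coeff_C]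
  ext e
  rw [coeff_cf]
  split_ifs with h0 hb hb
  · subst hb; simp
  · rw [h2 _ (by simp [h0, hb])]; simp
  · subst hb; rw [h2 _ h0]
  · simp

lemma tu_pderiv (j : σ) (f : MvPolynomial σ ℤ) :
    tu j (pderiv j f) = Polynomial.derivative (tu j f) := by
  ext b : 1
  rw [Polynomial.coeff_derivative]
  change cf j b _ = cf j (b+1) f * _
  ext e
  have : ((b : MvPolynomial σ ℤ) + 1) = C ((b : ℤ) + 1) := by simp
  rw [this, mul_comm, coeff_C_mul, coeff_cf, coeff_cf, coeff_pderiv]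
  split_ifs with h0
  · rw [add_assoc, ← Finsupp.single_add]; simp [h0]; ring
  · simp

lemma tu_injective (j : σ) : Function.Injective (tu j) := by
  have : ∀ f, (tu j f).eval (X j) = f := by
    intro f
    have : ((Polynomial.evalRingHom (X j)).comp (tu j).toRingHom) = RingHom.id _ := by
      apply MvPolynomial.ringHom_ext
      · intro z; simp [tu]
      · intro i; simp only [tu, AlgHom.toRingHom_eq_coe, RingHom.coe_comp, Function.comp, RingHom.coe_coe, aeval_X]
        split_ifs with h <;> simp [h]
    exact congrArg (fun g => g f) this
  exact Function.LeftInverse.injective this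

lemma wr_zero {B : Type*} [CommRing B] [IsDomain B] [CharZero B] (f g : Polynomial B)
    (h : f * g.derivative = g * f.derivative) (hf : f ≠ 0) (hg : g.coeff f.natDegree = 0) : g = 0 := by
  by_contra hg0
  have h1 : f * (Polynomial.X * g.derivative) = g * (Polynomial.X * f.derivative) := by
    linear_combination Polynomial.X * h
  have hc : ∀ p : Polynomial B, ∀ n, (Polynomial.X * p.derivative).coeff n = p.coeff n * n := by
    intro p n
    cases n with
    | zero => simp
    | succ n => rw [Polynomial.coeff_X_mul, Polynomial.coeff_derivative]; simp
  have hd : ∀ p : Polynomial B, (Polynomial.X * p.derivative).natDegree ≤ p.natDegree := by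
    intro p
    rw [Polynomial.natDegree_le_iff_coeff_eq_zero]
    intro n hn
    rw [hc, Polynomial.coeff_eq_zero_of_natDegree_lt hn, zero_mul]
  have h2 := congrArg (fun p => p.coeff (f.natDegree + g.natDegree)) h1
  beta_reduce at h2
  rw [Polynomial.coeff_mul_add_eq_of_natDegree_le le_rfl (hd g), add_comm,
    Polynomial.coeff_mul_add_eq_of_natDegree_le le_rfl (hd f), hc, hc] at h2
  have hfl : f.coeff f.natDegree ≠ 0 := by simpa using hf
  have hgl : g.coeff g.natDegree ≠ 0 := by simpa using hg0
  have h3 : (g.natDegree : B) = f.natDegree := by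
    apply mul_left_cancel₀ (mul_ne_zero hfl hgl); linear_combination h2
  have h4 : g.natDegree = f.natDegree := by exact_mod_cast h3
  exact hgl (h4 ▸ hg)

/-- separation of variables -/
lemma separate {i j : σ} (hij : i ≠ j) (W : MvPolynomial σ ℤ) (hW : W ≠ 0)
    (h : W * pderiv j (pderiv i W) = pderiv i W * pderiv j W) :
    ∃ a b, cf i a (cf j b W) ≠ 0 ∧ W * cf i a (cf j b W) = cf j b W * cf i a W := by
  set b := (tu j W).natDegree with hb
  set U := cf j b W with hU
  have hU0 : U ≠ 0 := by
    rw [hU, cf, hb, Polynomial.coeff_natDegree, Polynomial.leadingCoeff_ne_zero]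
    exact (map_ne_zero_iff _ (tu_injective j)).2 hW
  have hjU : pderiv j U = 0 := pderiv_cf _ _ _
  have hjiU : pderiv j (pderiv i U) = 0 := by
    rw [hU, ← cf_pderiv hij, pderiv_cf]
  have h1 : W * pderiv i U - U * pderiv i W = 0 := by
    apply tu_injective j
    rw [map_zero]
    refine wr_zero (tu j W) _ ?_ ((map_ne_zero_iff _ (tu_injective j)).2 hW) ?_
    · rw [← tu_pderiv, ← tu_pderiv, ← map_mul, ← map_mul]
      congr 1
      simp only [map_sub, pderiv_mul, hjU, hjiU]
      linear_combination (-U) * h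
    · rw [map_sub, map_mul, map_mul, tu_of_pderiv_eq_zero j U hjU,
        tu_of_pderiv_eq_zero j _ hjiU, Polynomial.coeff_sub, Polynomial.coeff_mul_C,
        Polynomial.coeff_C_mul, ← hb]
      change U * _ - U * cf j b _ = 0
      rw [cf_pderiv hij]; ring
  set a := (tu i U).natDegree with ha
  refine ⟨a, b, ?_, ?_⟩
  · rw [← hU, cf, ha, Polynomial.coeff_natDegree, Polynomial.leadingCoeff_ne_zero]
    exact (map_ne_zero_iff _ (tu_injective i)).2 hU0
  · rw [← hU]
    have hG : pderiv i (cf i a U) = 0 := pderiv_cf _ _ _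
    have hV : pderiv i (cf i a W) = 0 := pderiv_cf _ _ _
    have : W * cf i a U - U * cf i a W = 0 := by
      apply tu_injective i
      rw [map_zero]
      refine wr_zero (tu i U) _ ?_ ((map_ne_zero_iff _ (tu_injective i)).2 hU0) ?_
      · rw [← tu_pderiv, ← tu_pderiv, ← map_mul, ← map_mul]
        congr 1
        simp only [map_sub, pderiv_mul, hG, hV]
        linear_combination (-(cf i a U)) * h1
      · rw [map_sub, map_mul, map_mul, tu_of_pderiv_eq_zero i _ hG,
        tu_of_pderiv_eq_zero i _ hV, Polynomial.coeff_sub, Polynomial.coeff_mul_C,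
        Polynomial.coeff_mul_C, ← ha]
        change cf i a W * _ - cf i a U * _ = 0
        ring
    linear_combination this

lemma degreeOf_cf_le (i j : σ) (b : ℕ) (W : MvPolynomial σ ℤ) :
    degreeOf i (cf j b W) ≤ degreeOf i W := by
  rw [degreeOf_le_iff]
  intro e he
  rw [mem_support_iff, coeff_cf] at he
  split_ifs at he with h
  · have := (degreeOf_le_iff (n := i) (f := W) (d := degreeOf i W)).1 le_rfl _ (mem_support_iff.2 he)
    rw [Finsupp.add_apply] at this; omega
  · exact absurd rfl he

lemma degreeOf_cf_self (j : σ) (b : ℕ) (W : MvPolynomial σ ℤ) :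
    degreeOf j (cf j b W) = 0 := by
  rw [← Nat.le_zero, degreeOf_le_iff]
  intro e he
  rw [mem_support_iff, coeff_cf] at he
  split_ifs at he with h
  · exact h.le
  · exact absurd rfl he

lemma nrm_cf_le (j : σ) (b : ℕ) (W : MvPolynomial σ ℤ) :
    nrm iabs (fun _ => 1) (cf j b W) ≤ nrm iabs (fun _ => 1) W := by
  simp only [nrm, mon_one, mul_one]
  have h : ∀ e ∈ (cf j b W).support, coeff e (cf j b W) = coeff (e + Finsupp.single j b) W := by
    intro e he
    rw [mem_support_iff, coeff_cf] at he
    rw [coeff_cf]; split_ifs at he ⊢ with h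
    · rfl
    · exact absurd rfl he
  rw [Finset.sum_congr rfl fun e he => by rw [h e he],
    ← Finset.sum_image (f := fun e => iabs (coeff e W)) (g := fun e => e + Finsupp.single j b)
      (fun x _ y _ hxy => add_right_cancel hxy)]
  refine Finset.sum_le_sum_of_subset_of_nonneg ?_ fun _ _ _ => iabs.nonneg _
  intro e' he'
  obtain ⟨e, he, rfl⟩ := Finset.mem_image.1 he'
  rw [mem_support_iff, ← h e he]; exact mem_support_iff.1 he

/-- Hasse derivative -/
noncomputable def hs (j : σ) (i : ℕ) (P : MvPolynomial σ ℤ) : MvPolynomial σ ℤ :=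
  ∑ e ∈ P.support, monomial (e - Finsupp.single j i) (coeff e P * (e j).choose i)

lemma coeff_hs (j : σ) (i : ℕ) (P : MvPolynomial σ ℤ) (e : σ →₀ ℕ) :
    coeff e (hs j i P) = coeff (e + Finsupp.single j i) P * (e j + i).choose i := by
  rw [hs, coeff_sum]
  simp only [coeff_monomial]
  rw [Finset.sum_eq_single (e + Finsupp.single j i)]
  · simp
  · intro e' _ hne
    split_ifs with h
    · have : e' j < i := by
        by_contra hc
        apply hne
        rw [← h, tsub_add_cancel_of_le]
        rw [Finsupp.single_le_iff]; omega
      rw [Nat.choose_eq_zero_of_lt this]; simp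
    · rfl
  · intro h; rw [notMem_support_iff.1 h]; simp

lemma hs_zero (j : σ) (P : MvPolynomial σ ℤ) : hs j 0 P = P := by
  ext e; rw [coeff_hs]; simp

lemma pderiv_hs (j : σ) (i : ℕ) (P : MvPolynomial σ ℤ) :
    pderiv j (hs j i P) = ((i : ℤ) + 1 : MvPolynomial σ ℤ) * hs j (i+1) P := by
  have h0 : ((i : ℤ) + 1 : MvPolynomial σ ℤ) = C ((i : ℤ) + 1) := by simp
  ext e
  rw [h0, coeff_C_mul, coeff_pderiv, coeff_hs, coeff_hs, add_assoc, ← Finsupp.single_add, add_comm 1 i]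
  simp only [Finsupp.add_apply, Finsupp.single_eq_same]
  have h1 := Nat.choose_succ_right_eq (e j + (i+1)) i
  have h2 : e j + (i+1) - i = e j + 1 := by omega
  rw [h2] at h1
  have h3 : (((e j + (i+1)).choose (i+1) : ℕ) : ℤ) * (i+1) = (e j + (i+1)).choose i * (e j + 1) := by
    exact_mod_cast h1
  have h4 : e j + 1 + i = e j + (i+1) := by ring
  rw [h4]
  push_cast
  linear_combination -coeff (e + Finsupp.single j (i + 1)) P * h3

lemma pderiv_hs_ne {j l : σ} (h : l ≠ j) (i : ℕ) (P : MvPolynomial σ ℤ) :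
    pderiv l (hs j i P) = hs j i (pderiv l P) := by
  ext e
  rw [coeff_pderiv, coeff_hs, coeff_hs, coeff_pderiv, add_right_comm]
  simp only [Finsupp.add_apply, Finsupp.single_apply, if_neg h, if_neg h.symm, add_zero]
  ring

lemma hs_smul (j : σ) (i : ℕ) (c : ℤ) (P : MvPolynomial σ ℤ) : hs j i (C c * P) = C c * hs j i P := by
  ext e; simp only [coeff_hs, coeff_C_mul]; ring

lemma degreeOf_hs_le (l j : σ) (i : ℕ) (P : MvPolynomial σ ℤ) :
    degreeOf l (hs j i P) ≤ degreeOf l P := by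
  rw [degreeOf_le_iff]
  intro e he
  rw [mem_support_iff, coeff_hs] at he
  have := (degreeOf_le_iff (n := l) (f := P) (d := degreeOf l P)).1 le_rfl _
    (mem_support_iff.2 (left_ne_zero_of_mul he))
  rw [Finsupp.add_apply] at this; omega

lemma hs_eq_zero (j : σ) (i : ℕ) (P : MvPolynomial σ ℤ) (h : degreeOf j P < i) : hs j i P = 0 := by
  ext e
  rw [coeff_hs, coeff_zero]
  by_contra he
  have := (degreeOf_le_iff (n := j) (f := P) (d := degreeOf j P)).1 le_rfl _
    (mem_support_iff.2 (left_ne_zero_of_mul he))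
  rw [Finsupp.add_apply, Finsupp.single_eq_same] at this; omega

lemma nrm_hs_le (j : σ) (i : ℕ) (P : MvPolynomial σ ℤ) :
    nrm iabs (fun _ => 1) (hs j i P) ≤ 2 ^ degreeOf j P * nrm iabs (fun _ => 1) P := by
  refine (nrm_sum_le (by simp) _ _).trans ?_
  rw [nrm, Finset.mul_sum]
  refine Finset.sum_le_sum fun e he => ?_
  rw [nrm_monomial, mon_one, mon_one, mul_one, mul_one, iabs.map_mul, mul_comm]
  refine mul_le_mul_of_nonneg_right ?_ (iabs.nonneg _)
  rw [iabs_apply]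
  have h1 := (degreeOf_le_iff (n := j) (f := P) (d := degreeOf j P)).1 le_rfl _ he
  have h2 : (e j).choose i ≤ 2 ^ degreeOf j P :=
    (Nat.choose_le_two_pow _ _).trans (Nat.pow_le_pow_right (by norm_num) h1)
  rw [Int.cast_natCast, Nat.abs_cast]
  exact_mod_cast h2
end cf
end SU

open MvPolynomial
namespace SU
section ind
variable {σ : Type*} {K : Type*} [Field K]

/-- shift by the point `α` -/
noncomputable def shf (α : σ → K) : MvPolynomial σ ℤ →ₐ[ℤ] MvPolynomial σ K :=
  aeval fun i => X i + C (α i)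

/-- index at least `t` -/
def Ind (ω : σ → ℕ) (α : σ → K) (t : ℕ) (P : MvPolynomial σ ℤ) : Prop :=
  ∀ e, Finsupp.weight ω e < t → coeff e (shf α P) = 0

noncomputable def zet (ω : σ → ℕ) : MvPolynomial σ K →ₐ[K] Polynomial (MvPolynomial σ K) :=
  aeval fun i => Polynomial.C (X i) * Polynomial.X ^ ω i

lemma zet_monomial (ω : σ → ℕ) (e : σ →₀ ℕ) (c : K) :
    zet ω (monomial e c) = Polynomial.C (monomial e c) * Polynomial.X ^ (Finsupp.weight ω e) := by
  rw [zet, aeval_monomial, Finsupp.weight_apply, monomial_eq (s := e), Polynomial.C_mul]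
  simp only [Finsupp.prod, Finsupp.sum, mul_pow, Finset.prod_mul_distrib, ← pow_mul,
    Finset.prod_pow_eq_pow_sum, smul_eq_mul, map_prod, map_pow]
  rw [mul_assoc, Finset.sum_congr rfl fun i _ => mul_comm (ω i) (e i)]
  rfl

lemma coeff_zet (ω : σ → ℕ) (f : MvPolynomial σ K) (s : ℕ) (e : σ →₀ ℕ) :
    coeff e ((zet ω f).coeff s) = if Finsupp.weight ω e = s then coeff e f else 0 := by
  classical
  induction f using MvPolynomial.induction_on' with
  | monomial u a =>
    rw [zet_monomial, Polynomial.coeff_C_mul, Polynomial.coeff_X_pow, coeff_monomial]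
    by_cases h : s = Finsupp.weight ω u
    · rw [if_pos h, mul_one, coeff_monomial]
      by_cases hu : u = e
      · subst hu; simp [h]
      · simp [hu]
    · rw [if_neg h, mul_zero, coeff_zero]
      by_cases hu : u = e
      · subst hu; rw [if_neg (Ne.symm h)]
      · simp [hu]
  | add p q hp hq =>
    rw [map_add, Polynomial.coeff_add, coeff_add, hp, hq, coeff_add]; split_ifs <;> simp

lemma ind_iff (ω : σ → ℕ) (α : σ → K) (t : ℕ) (P : MvPolynomial σ ℤ) :
    Ind ω α t P ↔ Polynomial.X ^ t ∣ zet ω (shf α P) := by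
  rw [Polynomial.X_pow_dvd_iff]
  constructor
  · intro h d hd
    ext e
    rw [coeff_zet, coeff_zero]
    split_ifs with h1
    · exact h e (h1 ▸ hd)
    · rfl
  · intro h e he
    have := congrArg (coeff e) (h _ he)
    rwa [coeff_zet, if_pos rfl, coeff_zero] at this

lemma Ind.mono {ω : σ → ℕ} {α : σ → K} {s t : ℕ} (h : s ≤ t) {P : MvPolynomial σ ℤ}
    (hP : Ind ω α t P) : Ind ω α s P := fun e he => hP e (he.trans_le h)

lemma Ind.mul {ω : σ → ℕ} {α : σ → K} {s t : ℕ} {P Q : MvPolynomial σ ℤ}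
    (hP : Ind ω α s P) (hQ : Ind ω α t Q) : Ind ω α (s + t) (P * Q) := by
  rw [ind_iff] at *
  rw [map_mul, map_mul, pow_add]
  exact mul_dvd_mul hP hQ

lemma ind_zero (ω : σ → ℕ) (α : σ → K) (P : MvPolynomial σ ℤ) : Ind ω α 0 P := by
  intro e he; omega

lemma Ind.sum {ω : σ → ℕ} {α : σ → K} {t : ℕ} {κ : Type*} (s : Finset κ)
    {f : κ → MvPolynomial σ ℤ} (h : ∀ i ∈ s, Ind ω α t (f i)) : Ind ω α t (∑ i ∈ s, f i) := by
  intro e he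
  rw [map_sum, coeff_sum]
  exact Finset.sum_eq_zero fun i hi => h i hi e he

lemma Ind.prod {ω : σ → ℕ} {α : σ → K} {κ : Type*} (s : Finset κ) {t : κ → ℕ}
    {f : κ → MvPolynomial σ ℤ} (h : ∀ i ∈ s, Ind ω α (t i) (f i)) :
    Ind ω α (∑ i ∈ s, t i) (∏ i ∈ s, f i) := by
  classical
  induction s using Finset.induction_on with
  | empty => exact ind_zero _ _ _
  | insert a s ha ih =>
    rw [Finset.sum_insert ha, Finset.prod_insert ha]
    exact (h a (by simp)).mul (ih fun i hi => h i (by simp [hi]))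

lemma ind_or {ω : σ → ℕ} {α : σ → K} {u v : ℕ} {P Q : MvPolynomial σ ℤ}
    (h : Ind ω α (u + v) (P * Q)) : Ind ω α (u + 1) P ∨ Ind ω α v Q := by
  simp only [ind_iff] at *
  by_contra hc
  push Not at hc
  obtain ⟨h1, h2⟩ := hc
  set f := zet ω (shf α P)
  set g := zet ω (shf α Q)
  rw [map_mul, map_mul] at h
  have hp : Prime (Polynomial.X : Polynomial (MvPolynomial σ K)) := Polynomial.prime_X
  rw [pow_dvd_iff_le_emultiplicity, not_le] at h1 h2
  rw [pow_dvd_iff_le_emultiplicity, emultiplicity_mul hp] at h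
  change ((u + v : ℕ) : ℕ∞) ≤ emultiplicity _ f + emultiplicity _ g at h
  have e1 : emultiplicity Polynomial.X f ≤ u := by
    apply Order.le_of_lt_add_one; exact_mod_cast h1
  have : emultiplicity Polynomial.X f + emultiplicity Polynomial.X g < u + v :=
    lt_of_le_of_lt (add_le_add_left e1 _) ((ENat.add_lt_add_iff_left (by simp)).2 h2)
  rw [Nat.cast_add] at h
  exact absurd h (not_le.2 this)

lemma pderiv_shf [DecidableEq σ] (α : σ → K) (j : σ) (P : MvPolynomial σ ℤ) :
    pderiv j (shf α P) = shf α (pderiv j P) := by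
  induction P using MvPolynomial.induction_on with
  | C a =>
    rw [pderiv_C, map_zero]
    have : shf α (C a) = C (a : K) := by simp [shf]
    rw [this, pderiv_C]
  | add p q hp hq => simp only [map_add, hp, hq]
  | mul_X p i hp =>
    have h1 : shf α (X i) = X i + C (α i) := by simp [shf]
    have h2 : pderiv j (shf α (X i)) = shf α (pderiv j (X i)) := by
      rw [h1, map_add, pderiv_C, add_zero, pderiv_X, pderiv_X, Pi.single_apply, Pi.single_apply]
      split_ifs <;> simp
    rw [map_mul, pderiv_mul, hp, h2, pderiv_mul, map_add, map_mul, map_mul]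

lemma Ind.pderiv [DecidableEq σ] {ω : σ → ℕ} {α : σ → K} {t : ℕ} {P : MvPolynomial σ ℤ}
    (h : Ind ω α t P) (j : σ) : Ind ω α (t - ω j) (pderiv j P) := by
  intro e he
  rw [← pderiv_shf, coeff_pderiv, h _ (by rw [map_add, Finsupp.weight_single]; simp; omega), zero_mul]

lemma Ind.of_mul_nat [CharZero K] {ω : σ → ℕ} {α : σ → K} {t : ℕ} {P : MvPolynomial σ ℤ}
    (i : ℕ) (h : Ind ω α t (((i : ℤ) + 1 : MvPolynomial σ ℤ) * P)) : Ind ω α t P := by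
  intro e he
  have h1 := h e he
  have h2 : shf α (((i : ℤ) + 1 : MvPolynomial σ ℤ) * P) = C ((i : K) + 1) * shf α P := by
    simp
  rw [h2, coeff_C_mul] at h1
  exact (mul_eq_zero.1 h1).resolve_left (by exact_mod_cast Nat.succ_ne_zero i)

lemma Ind.hs [DecidableEq σ] [CharZero K] {ω : σ → ℕ} {α : σ → K} {t : ℕ} {P : MvPolynomial σ ℤ}
    (h : Ind ω α t P) (j : σ) (i : ℕ) : Ind ω α (t - i * ω j) (hs j i P) := by
  induction i with
  | zero => rw [hs_zero]; simpa using h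
  | succ i ih =>
    have := ih.pderiv j
    rw [pderiv_hs] at this
    refine (Ind.of_mul_nat i this).mono ?_
    rw [add_mul]; omega
end ind

section pn
variable {K : Type*} [Field K]
/-- weighted norm on one-variable polynomials -/
noncomputable def pn (a : AbsoluteValue K ℝ) (p : Polynomial K) : ℝ :=
  p.sum fun i c => a c * (1/2) ^ i

lemma pn_eq (a : AbsoluteValue K ℝ) (p : Polynomial K) (n : ℕ) (h : p.natDegree < n) :
    pn a p = ∑ i ∈ Finset.range n, a (p.coeff i) * (1/2)^i := by
  rw [pn, Polynomial.sum_over_range' _ (by simp) n h]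

lemma pn_nonneg (a : AbsoluteValue K ℝ) (p : Polynomial K) : 0 ≤ pn a p :=
  Finset.sum_nonneg fun _ _ => mul_nonneg (a.nonneg _) (by positivity)

lemma pn_X_sub (a : AbsoluteValue K ℝ) (α : K) (q : Polynomial K) :
    (a α - 1/2) * pn a q ≤ pn a ((Polynomial.X - Polynomial.C α) * q) := by
  have hd : ((Polynomial.X - Polynomial.C α) * q).natDegree < q.natDegree + 2 := by
    refine lt_of_le_of_lt Polynomial.natDegree_mul_le ?_
    rw [Polynomial.natDegree_X_sub_C]; omega
  rw [pn_eq a _ _ hd]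
  have h1 : ∀ i, a α * (a (q.coeff i) * (1/2)^i) ≤
      a (((Polynomial.X - Polynomial.C α) * q).coeff i) * (1/2)^i
      + a ((Polynomial.X * q).coeff i) * (1/2)^i := by
    intro i
    rw [← mul_assoc, ← add_mul]
    refine mul_le_mul_of_nonneg_right ?_ (by positivity)
    rw [← a.map_mul, sub_mul, Polynomial.coeff_sub, Polynomial.coeff_C_mul]
    have := a.add_le (-((Polynomial.X * q).coeff i - α * q.coeff i)) ((Polynomial.X * q).coeff i)
    rw [a.map_neg] at this
    convert! this using 2; ring
  have h2 := Finset.sum_le_sum fun i (_ : i ∈ Finset.range (q.natDegree + 2)) => h1 i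
  rw [← Finset.mul_sum, Finset.sum_add_distrib, ← pn_eq a q _ (by omega)] at h2
  have h3 : ∑ i ∈ Finset.range (q.natDegree + 2), a ((Polynomial.X * q).coeff i) * (1/2)^i
      = 1/2 * pn a q := by
    rw [Finset.sum_range_succ', pn_eq a q (q.natDegree+1) (by omega), Finset.mul_sum]
    simp only [Polynomial.coeff_X_mul, Polynomial.coeff_X_mul_zero, map_zero, zero_mul, add_zero]
    exact Finset.sum_congr rfl fun i _ => by ring
  rw [h3] at h2
  linarith

lemma lc_le (a : AbsoluteValue K ℝ) (α : K) (k : ℕ) (q : Polynomial K) :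
    a q.leadingCoeff * max 1 (a α) ^ k ≤ 4 ^ (k + q.natDegree) *
      ∑ i ∈ Finset.range (k + q.natDegree + 1), a (((Polynomial.X - Polynomial.C α)^k * q).coeff i) := by
  set p := (Polynomial.X - Polynomial.C α)^k * q with hp
  have hm : ((Polynomial.X - Polynomial.C α)^k).Monic := (Polynomial.monic_X_sub_C α).pow k
  have hl : p.leadingCoeff = q.leadingCoeff := Polynomial.leadingCoeff_monic_mul hm
  have hS : ∀ i ∈ Finset.range (k + q.natDegree + 1), 0 ≤ a (p.coeff i) := fun i _ => a.nonneg _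
  have hdle : p.natDegree ≤ k + q.natDegree := by
    refine Polynomial.natDegree_mul_le.trans ?_
    rw [Polynomial.natDegree_pow, Polynomial.natDegree_X_sub_C]; omega
  rcases le_total (a α) 1 with h | h
  · rw [max_eq_left h, one_pow, mul_one, ← hl]
    refine (Finset.single_le_sum hS (Finset.mem_range.2 (Nat.lt_succ_of_le hdle))).trans ?_
    exact le_mul_of_one_le_left (Finset.sum_nonneg hS) (one_le_pow₀ (by norm_num))
  · rw [max_eq_right h]
    have h1 : ∀ j, (a α / 2)^j * pn a q ≤ pn a ((Polynomial.X - Polynomial.C α)^j * q) := by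
      intro j
      induction j with
      | zero => simp
      | succ j ih =>
        rw [pow_succ' (Polynomial.X - Polynomial.C α), mul_assoc]
        refine le_trans ?_ (pn_X_sub a α _)
        rw [pow_succ', mul_assoc]
        exact mul_le_mul (by linarith) ih (mul_nonneg (by positivity) (pn_nonneg _ _)) (by linarith)
    have h2 : a q.leadingCoeff * (1/2)^q.natDegree ≤ pn a q := by
      rw [pn_eq a q (q.natDegree+1) (by omega)]
      exact Finset.single_le_sum (f := fun i => a (q.coeff i) * (1/2)^i) (fun i _ => mul_nonneg (a.nonneg _) (by positivity))
        (Finset.mem_range.2 (Nat.lt_succ_self _))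
    have h3 : pn a p ≤ ∑ i ∈ Finset.range (k + q.natDegree + 1), a (p.coeff i) := by
      rw [pn_eq a p _ (Nat.lt_succ_of_le hdle)]
      refine Finset.sum_le_sum fun i _ => mul_le_of_le_one_right (a.nonneg _) ?_
      exact pow_le_one₀ (by norm_num) (by norm_num)
    have h4 : (a α / 2)^k * (a q.leadingCoeff * (1/2)^q.natDegree) ≤ ∑ i ∈ Finset.range (k + q.natDegree + 1), a (p.coeff i) :=
      (mul_le_mul_of_nonneg_left h2 (by positivity)).trans ((h1 k).trans h3)
    have h5 : a q.leadingCoeff * a α ^ k = 2^(k+q.natDegree) * ((a α / 2)^k * (a q.leadingCoeff * (1/2)^q.natDegree)) := by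
      rw [div_pow, pow_add, one_div, inv_pow]; field_simp
    rw [h5]
    refine mul_le_mul (pow_le_pow_left₀ (by norm_num) (by norm_num) _) h4 ?_ (by positivity)
    exact mul_nonneg (by positivity) (mul_nonneg (a.nonneg _) (by positivity))
end pn
end SU

open MvPolynomial
namespace SU

/-- pointwise data: finitely many absolute values, the ring of `S`-integers -/
structure PD (K ι : Type*) [Field K] [Fintype ι] where
  a : ι → AbsoluteValue K ℝ
  m : ι → ℕ
  O : Subring K
  pf : ∀ x ∈ O, x ≠ 0 → 1 ≤ ∏ v, a v x ^ m v

noncomputable def PD.H {K ι : Type*} [Field K] [Fintype ι] (D : PD K ι) (x : K) : ℝ :=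
  ∏ v, max 1 (D.a v x) ^ D.m v

section
variable {σ : Type*} [DecidableEq σ]

/-- restrict to the variable h -/
lemma coeff_toUni {R : Type*} [CommRing R] (h : σ) (f : MvPolynomial σ R) (i : ℕ) :
    (aeval (fun l => if l = h then (Polynomial.X : Polynomial R) else 0) f).coeff i
      = coeff (Finsupp.single h i) f := by
  induction f using MvPolynomial.induction_on' with
  | monomial u a =>
    rw [aeval_monomial, coeff_monomial, ← Polynomial.C_eq_algebraMap, Polynomial.coeff_C_mul]
    by_cases hu : u = Finsupp.single h (u h)
    · rw [hu, Finsupp.prod_single_index (by simp), if_pos rfl, Polynomial.coeff_X_pow]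
      by_cases hi : i = u h
      · simp [hi]
      · rw [if_neg hi, if_neg, mul_zero]
        intro hc; exact hi ((Finsupp.single_injective h) (by simpa using hc.symm))
    · rw [if_neg (fun hc => hu (by rw [hc]; simp))]
      have : ∃ l ∈ u.support, l ≠ h := by
        by_contra hc
        push Not at hc
        apply hu
        ext l
        by_cases hl : l = h
        · subst hl; simp
        · rw [Finsupp.single_eq_of_ne hl]
          by_contra h0
          exact hl (hc l (Finsupp.mem_support_iff.2 h0))
      obtain ⟨l, hl, hlh⟩ := this
      rw [Finsupp.prod, Finset.prod_eq_zero hl]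
      · simp
      · rw [if_neg hlh, zero_pow (Finsupp.mem_support_iff.1 hl)]
  | add p q hp hq => rw [map_add, Polynomial.coeff_add, hp, hq, coeff_add]

lemma eq_single_of_degreeOf {R : Type*} [CommRing R] (h : σ) (p : MvPolynomial σ R)
    (hp : ∀ l ≠ h, degreeOf l p = 0) (e : σ →₀ ℕ) (he : e ∈ p.support) :
    e = Finsupp.single h (e h) := by
  ext l
  by_cases hl : l = h
  · subst hl; simp
  · rw [Finsupp.single_eq_of_ne hl]
    exact Nat.le_zero.1 ((degreeOf_le_iff.1 (hp l hl).le) e he)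

lemma roth_one_aux {K ι : Type*} [Field K] [CharZero K] [Fintype ι] (D : PD K ι) (h : σ)
    (ω : σ → ℕ) (α : σ → K) (p : MvPolynomial σ ℤ) (hp : p ≠ 0)
    (hd : ∀ l ≠ h, degreeOf l p = 0) (t k : ℕ) (hk : ∀ i < k, i * ω h < t) (hI : Ind ω α t p) :
    D.H (α h) ^ k ≤ (4 ^ degreeOf h p * nrm iabs (fun _ => 1) p) ^ (∑ v, D.m v) := by
  set p0 : Polynomial ℤ := aeval (fun l => if l = h then (Polynomial.X : Polynomial ℤ) else 0) p with hp0
  have hc0 : ∀ i, p0.coeff i = coeff (Finsupp.single h i) p := coeff_toUni h p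
  have hp0' : p0 ≠ 0 := by
    obtain ⟨e, he⟩ := support_nonempty.2 hp
    have h1 := eq_single_of_degreeOf h p hd e he
    intro hc
    have h2 := hc0 (e h)
    rw [hc, ← h1] at h2
    exact (mem_support_iff.1 he) h2.symm
  set P : Polynomial K := p0.map (Int.castRingHom K) with hP
  have hP0 : P ≠ 0 := (Polynomial.map_ne_zero_iff (RingHom.injective_int _)).2 hp0'
  have hPc : ∀ i, P.coeff i = ((coeff (Finsupp.single h i) p : ℤ) : K) := by
    intro i; rw [hP, Polynomial.coeff_map, hc0]; rfl
  -- translate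
  have key : P.comp (Polynomial.X + Polynomial.C (α h)) =
      aeval (fun l => if l = h then (Polynomial.X : Polynomial K) else 0) (shf α p) := by
    let f1 : MvPolynomial σ ℤ →+* Polynomial K :=
      ((Polynomial.compRingHom (Polynomial.X + Polynomial.C (α h))).comp
        (Polynomial.mapRingHom (Int.castRingHom K))).comp
        (aeval (fun l => if l = h then (Polynomial.X : Polynomial ℤ) else 0)).toRingHom
    let f2 : MvPolynomial σ ℤ →+* Polynomial K :=
      (aeval (fun l => if l = h then (Polynomial.X : Polynomial K) else 0)).toRingHom.comp
        (shf α).toRingHom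
    change f1 p = f2 p
    refine hom_congr_vars (Subsingleton.elim _ _) ?_ rfl
    intro i hi _
    have : i = h := by
      by_contra hih
      obtain ⟨e, he, hie⟩ := (mem_vars i).1 hi
      exact (Finsupp.mem_support_iff.1 hie) (Nat.le_zero.1 ((degreeOf_le_iff.1 (hd i hih).le) e he))
    subst this
    simp [f1, f2, shf, Polynomial.compRingHom]
  have hdvd : (Polynomial.X - Polynomial.C (α h)) ^ k ∣ P := by
    have h1 : Polynomial.X ^ k ∣ P.comp (Polynomial.X + Polynomial.C (α h)) := by
      rw [Polynomial.X_pow_dvd_iff, key]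
      intro d hd
      rw [coeff_toUni]
      apply hI
      rw [Finsupp.weight_single]; exact hk d hd
    obtain ⟨q, hq⟩ := h1
    refine ⟨q.comp (Polynomial.X - Polynomial.C (α h)), ?_⟩
    have := congrArg (fun f => Polynomial.comp f (Polynomial.X - Polynomial.C (α h))) hq
    simpa [Polynomial.comp_assoc] using this
  obtain ⟨q, hq⟩ := hdvd
  have hq0 : q ≠ 0 := by rintro rfl; exact hP0 (by rw [hq, mul_zero])
  have hdeg : k + q.natDegree = P.natDegree := by
    rw [hq, Polynomial.natDegree_mul (pow_ne_zero _ (Polynomial.X_sub_C_ne_zero _)) hq0,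
      Polynomial.natDegree_pow, Polynomial.natDegree_X_sub_C, mul_one]
  have hdegle : P.natDegree ≤ degreeOf h p := by
    rw [Polynomial.natDegree_le_iff_coeff_eq_zero]
    intro N hN
    rw [hPc]
    by_contra hc
    have := (degreeOf_le_iff (n := h) (f := p) (d := degreeOf h p)).1 le_rfl (Finsupp.single h N)
      (mem_support_iff.2 (by rintro h0; rw [h0] at hc; simp at hc))
    simp at this; omega
  have hlc : q.leadingCoeff = P.leadingCoeff := by
    rw [hq, Polynomial.leadingCoeff_monic_mul ((Polynomial.monic_X_sub_C _).pow k)]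
  have hnn : (0:ℝ) ≤ nrm iabs (fun _ => 1) p := nrm_nonneg (by simp) _
  have hv : ∀ v, D.a v P.leadingCoeff * max 1 (D.a v (α h)) ^ k
      ≤ 4 ^ degreeOf h p * nrm iabs (fun _ => 1) p := by
    intro v
    rw [← hlc]
    refine (lc_le (D.a v) (α h) k q).trans ?_
    rw [hdeg, ← hq]
    refine mul_le_mul (pow_le_pow_right₀ (by norm_num) hdegle) ?_ (Finset.sum_nonneg fun _ _ => (D.a v).nonneg _) (by positivity)
    have : ∀ i, D.a v (P.coeff i) ≤ iabs (coeff (Finsupp.single h i) p) := by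
      intro i; rw [hPc, iabs_apply]; exact av_int_le (D.a v).map_one _
    refine (Finset.sum_le_sum fun i _ => this i).trans ?_
    rw [← Finset.sum_image (f := fun e => iabs (coeff e p)) (g := fun i => Finsupp.single h i)
      (fun x _ y _ hxy => Finsupp.single_injective h hxy)]
    rw [nrm_eq_sum p (p.support ∪ _) Finset.subset_union_left]
    simp only [mon_one, mul_one]
    exact Finset.sum_le_sum_of_subset_of_nonneg Finset.subset_union_right fun _ _ _ => iabs.nonneg _
  have hlO : P.leadingCoeff ∈ D.O := by
    rw [Polynomial.leadingCoeff, hPc]; exact intCast_mem D.O _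
  have h1 := D.pf _ hlO (by simpa using hP0)
  have h2 : (∏ v, D.a v P.leadingCoeff ^ D.m v) * D.H (α h) ^ k
      ≤ (4 ^ degreeOf h p * nrm iabs (fun _ => 1) p) ^ (∑ v, D.m v) := by
    rw [PD.H, ← Finset.prod_pow, ← Finset.prod_mul_distrib, ← Finset.prod_pow_eq_pow_sum]
    refine Finset.prod_le_prod (fun v _ => ?_) fun v _ => ?_
    · have := (D.a v).nonneg P.leadingCoeff; positivity
    · rw [← pow_mul, mul_comm (D.m v) k, pow_mul, ← mul_pow]
      refine pow_le_pow_left₀ ?_ (hv v) _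
      have := (D.a v).nonneg P.leadingCoeff; positivity
  refine le_trans (le_mul_of_one_le_left ?_ h1) h2
  rw [PD.H]; positivity

lemma one_le_nrm (p : MvPolynomial σ ℤ) (hp : p ≠ 0) : 1 ≤ nrm iabs (fun _ => 1) p := by
  obtain ⟨e, he⟩ := support_nonempty.2 hp
  refine le_trans ?_ (coeff_le_nrm (by simp) p e)
  rw [mon_one, mul_one, iabs_apply]
  have := Int.one_le_abs (mem_support_iff.1 he)
  exact_mod_cast this

section det
variable (k : ℕ) (A : Matrix (Fin k) (Fin k) (MvPolynomial σ ℤ))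

lemma nrm_det_le (B : ℝ) (hB : 0 ≤ B) (h : ∀ i j, nrm iabs (fun _ => 1) (A i j) ≤ B) :
    nrm iabs (fun _ => 1) A.det ≤ (k * B) ^ k := by
  rw [Matrix.det_apply]
  refine (nrm_sum_le (by simp) _ _).trans ?_
  have : ∀ s : Equiv.Perm (Fin k), nrm iabs (fun _ => (1:ℝ)) (Equiv.Perm.sign s • ∏ i, A (s i) i) ≤ B ^ k := by
    intro s
    have h1 : nrm iabs (fun _ => (1:ℝ)) (Equiv.Perm.sign s • ∏ i, A (s i) i)
        ≤ nrm iabs (fun _ => (1:ℝ)) (∏ i, A (s i) i) := by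
      rcases Int.units_eq_one_or (Equiv.Perm.sign s) with h | h <;> rw [h]
      · simp
      · rw [Units.neg_smul, one_smul]; simp [nrm]
    refine h1.trans ((nrm_prod_le iabs_one (by simp) _ _).trans ?_)
    refine (Finset.prod_le_prod (fun _ _ => nrm_nonneg (by simp) _) fun i _ => h (s i) i).trans ?_
    simp
  refine (Finset.sum_le_sum fun s _ => this s).trans ?_
  rw [Finset.sum_const, Finset.card_univ, Fintype.card_perm, Fintype.card_fin, nsmul_eq_mul, mul_pow]
  refine mul_le_mul_of_nonneg_right ?_ (by positivity)
  exact_mod_cast Nat.factorial_le_pow k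

lemma degreeOf_det_le (l : σ) (d : ℕ) (h : ∀ i j, degreeOf l (A i j) ≤ d) :
    degreeOf l A.det ≤ k * d := by
  rw [Matrix.det_apply]
  refine (degreeOf_sum_le l _ _).trans ?_
  refine Finset.sup_le fun s _ => ?_
  have h1 : degreeOf l (Equiv.Perm.sign s • ∏ i, A (s i) i) ≤ degreeOf l (∏ i, A (s i) i) := by
    rcases Int.units_eq_one_or (Equiv.Perm.sign s) with h | h <;> rw [h]
    · simp
    · rw [Units.neg_smul, one_smul, degreeOf_neg]
  refine h1.trans ((degreeOf_prod_le l _ _).trans ?_)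
  refine (Finset.sum_le_sum fun i _ => h (s i) i).trans ?_
  simp

lemma ind_det {K : Type*} [Field K] (ω : σ → ℕ) (α : σ → K) (t : Fin k → ℕ)
    (h : ∀ i j, Ind ω α (t i) (A i j)) : Ind ω α (∑ i, t i) A.det := by
  rw [Matrix.det_apply]
  refine Ind.sum _ fun s _ => ?_
  have h1 : Ind ω α (∑ i, t i) (∏ i, A (s i) i) := by
    rw [← Equiv.sum_comp s]
    exact Ind.prod _ fun i _ => h (s i) i
  rcases Int.units_eq_one_or (Equiv.Perm.sign s) with h | h <;> rw [h]
  · simpa using h1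
  · intro e he
    have := h1 e he
    rw [Units.neg_smul, one_smul, map_neg, coeff_neg, this, neg_zero]
end det
end
end SU

open MvPolynomial
namespace SU
section
variable {σ : Type*} [DecidableEq σ] {K ι : Type*} [Field K] [CharZero K] [Fintype ι]

lemma count_sum (k ω T : ℕ) (M θ : ℝ) (hθ : 0 < θ) (hθ1 : θ ≤ 1) (hM : 0 < M) (hk : 1 ≤ k)
    (h1 : ((k - 1 : ℕ) : ℝ) * ω ≤ M) (hT : θ * M ≤ T) :
    k * M * θ^2 / 8 ≤ ((∑ i : Fin k, (T - (i:ℕ) * ω) : ℕ) : ℝ) := by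
  obtain ⟨k, rfl⟩ : ∃ k', k = k' + 1 := ⟨k - 1, by omega⟩
  simp only [Nat.add_sub_cancel] at h1
  set c := ⌊θ * k / 2⌋₊ + 1 with hc
  have hck : c ≤ k + 1 := by
    have : ⌊θ * k / 2⌋₊ ≤ k := by
      apply Nat.floor_le_of_le
      have : (0:ℝ) ≤ k := by positivity
      nlinarith
    omega
  rw [Fin.sum_univ_eq_sum_range (fun i => T - i * ω) (k+1)]
  have hcr : θ * k / 2 ≤ c := by
    rw [hc]; push_cast; exact (Nat.lt_floor_add_one _).le
  have hc1 : (1:ℝ) ≤ c := by rw [hc]; push_cast; linarith [Nat.cast_nonneg (α := ℝ) ⌊θ * k / 2⌋₊]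
  have hterm : ∀ i ∈ Finset.range c, θ * M / 2 ≤ ((T - i * ω : ℕ) : ℝ) := by
    intro i hi
    have hi' : i ≤ ⌊θ * k / 2⌋₊ := by have := Finset.mem_range.1 hi; omega
    have hi2 : (i:ℝ) ≤ θ * k / 2 := (Nat.le_floor_iff (by positivity)).1 hi'
    have h3 : (i:ℝ) * ω ≤ θ * M / 2 := by
      calc (i:ℝ) * ω ≤ θ * k / 2 * ω := mul_le_mul_of_nonneg_right hi2 (by positivity)
        _ = θ / 2 * (k * ω) := by ring
        _ ≤ θ / 2 * M := mul_le_mul_of_nonneg_left h1 (by positivity)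
        _ = _ := by ring
    have h4 : (T : ℝ) - i * ω ≤ ((T - i * ω : ℕ) : ℝ) := by
      have : T ≤ (T - i * ω) + i * ω := by omega
      have : (T:ℝ) ≤ ((T - i * ω : ℕ) : ℝ) + i * ω := by exact_mod_cast this
      linarith
    linarith
  have h5 : (c:ℝ) * (θ * M / 2) ≤ ((∑ i ∈ Finset.range c, (T - i * ω) : ℕ) : ℝ) := by
    push_cast only [Nat.cast_sum]
    have := Finset.card_nsmul_le_sum (Finset.range c) (fun i => ((T - i * ω : ℕ) : ℝ)) _ hterm
    rwa [Finset.card_range, nsmul_eq_mul] at this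
  have h6 : (∑ i ∈ Finset.range c, (T - i * ω)) ≤ ∑ i ∈ Finset.range (k+1), (T - i * ω) :=
    Finset.sum_le_sum_of_subset (Finset.range_subset_range.2 hck)
  have h6' : ((∑ i ∈ Finset.range c, (T - i * ω) : ℕ) : ℝ) ≤ ((∑ i ∈ Finset.range (k+1), (T - i * ω) : ℕ) : ℝ) := by
    exact_mod_cast h6
  refine le_trans ?_ (h5.trans h6')
  have h7 : ((k:ℝ) + 1) * θ / 4 ≤ c := by
    rcases Nat.eq_zero_or_pos k with h0 | h0
    · subst h0; simp; linarith
    · have : (1:ℝ) ≤ k := by exact_mod_cast h0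
      nlinarith
  push_cast
  nlinarith [mul_pos hθ hM]

variable (D : PD K ι)

/-- the statement of Roth's lemma in `m` variables -/
def RothS (D : PD K ι) (σ : Type*) [DecidableEq σ] (m : ℕ) : Prop :=
  ∀ θ > (0:ℝ), ∀ ε > (0:ℝ), ∃ ρ > (0:ℝ), ∃ η > (0:ℝ), ∃ Ω : ℝ, 1 ≤ Ω ∧
    ∀ (s : Finset σ), s.card = m → ∀ (ω : σ → ℕ) (α : σ → K) (p : MvPolynomial σ ℤ) (M : ℝ) (t : ℕ),
      (∀ h ∈ s, Ω ≤ ω h) → (∀ h ∈ s, ∀ h' ∈ s, h ≠ h' → (ω h : ℝ) ≤ ρ * ω h' ∨ (ω h' : ℝ) ≤ ρ * ω h) →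
      (∀ h ∈ s, ε * ω h ≤ Real.log (D.H (α h))) → p ≠ 0 → (∀ h ∉ s, degreeOf h p = 0) →
      (∀ h ∈ s, (degreeOf h p : ℝ) * ω h ≤ M) → 0 < M → Real.log (nrm iabs (fun _ => 1) p) ≤ η * M →
      θ * M ≤ t → ¬ Ind ω α t p

lemma roth_zero : RothS D σ 0 := by
  intro θ hθ ε hε
  refine ⟨1, one_pos, 1, one_pos, 1, le_rfl, ?_⟩
  intro s hs ω α p M t _ _ _ hp hd _ hM _ ht hI
  have hs : s = ∅ := Finset.card_eq_zero.1 hs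
  subst hs
  have hp' : p = C (coeff 0 p) := by
    ext e
    rw [coeff_C]
    split_ifs with h
    · rw [h]
    · by_contra hc
      apply h
      ext l
      exact (Nat.le_zero.1 ((degreeOf_le_iff.1 (hd l (by simp)).le) e (mem_support_iff.2 hc))).symm
  have ht0 : 0 < t := by
    have : (0:ℝ) < t := lt_of_lt_of_le (mul_pos hθ hM) ht
    exact_mod_cast this
  have h1 := hI 0 (by simpa using ht0)
  rw [hp', shf, algHom_C] at h1
  have h2 : coeff 0 p = 0 := by
    have h3 : (algebraMap ℤ (MvPolynomial σ K)) (coeff 0 p) = C ((coeff 0 p : ℤ) : K) := by simp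
    rw [h3, coeff_C, if_pos rfl] at h1
    exact_mod_cast h1
  rw [h2] at hp'
  exact hp (by simpa using hp')

lemma roth_one : RothS D σ 1 := by
  intro θ hθ ε hε
  set S : ℝ := ∑ v, (D.m v : ℝ) with hS
  have hS0 : 0 ≤ S := Finset.sum_nonneg fun _ _ => by positivity
  set η := ε * θ / (4 * (S + 1)) with hη
  have hη0 : 0 < η := by positivity
  refine ⟨1, one_pos, η, hη0, max 1 (2 / η), le_max_left _ _, ?_⟩
  intro s hs ω α p M t hΩ _ hα hp hd hdM hM hn ht hI
  obtain ⟨h, rfl⟩ := Finset.card_eq_one.1 hs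
  have hω := hΩ h (by simp)
  have hω1 : (1:ℝ) ≤ ω h := (le_max_left _ _).trans hω
  have hω2 : 2 / η ≤ ω h := (le_max_right _ _).trans hω
  have hω0 : 0 < ω h := by exact_mod_cast (by linarith : (0:ℝ) < ω h)
  set k := (t + ω h - 1) / ω h with hk
  have hk1 : ∀ i < k, i * ω h < t := by
    intro i hi
    have := (Nat.le_div_iff_mul_le hω0).1 (Nat.succ_le_of_lt hi)
    rw [Nat.succ_mul] at this; omega
  have hk2 : t ≤ k * ω h := by
    have := Nat.lt_div_mul_add (a := t + ω h - 1) hω0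
    rw [← hk] at this; omega
  have key := roth_one_aux D h ω α p hp (fun l hl => hd l (by simpa using hl)) t k hk1 hI
  have hH1 : 1 ≤ D.H (α h) := by
    rw [PD.H]
    refine Finset.prod_induction _ (fun x : ℝ => 1 ≤ x) (fun a b ha hb => one_le_mul_of_one_le_of_one_le ha hb) le_rfl
      fun v _ => one_le_pow₀ (le_max_left _ _)
  have hn1 := one_le_nrm p hp
  have hlog := Real.log_le_log (by positivity) key
  rw [Real.log_pow, Real.log_pow, Real.log_mul (by positivity) (by positivity), Real.log_pow] at hlog
  push_cast at hlog
  rw [← hS] at hlog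
  have e1 : ε * θ * M ≤ k * Real.log (D.H (α h)) := by
    have h1 := hα h (by simp)
    have h2 : (t:ℝ) ≤ k * ω h := by exact_mod_cast hk2
    calc ε * θ * M = ε * (θ * M) := by ring
      _ ≤ ε * (k * ω h) := mul_le_mul_of_nonneg_left (ht.trans h2) hε.le
      _ = k * (ε * ω h) := by ring
      _ ≤ _ := mul_le_mul_of_nonneg_left h1 (by positivity)
  have e2 : (degreeOf h p : ℝ) * Real.log 4 ≤ η * M := by
    have h1 := hdM h (by simp)
    have h4 : Real.log 4 < 2 := by
      have : (4:ℝ) = 2^2 := by norm_num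
      rw [this, Real.log_pow]; have := Real.log_two_lt_d9; push_cast; linarith
    have h3 : (degreeOf h p : ℝ) * (2 / η) ≤ M := (mul_le_mul_of_nonneg_left hω2 (by positivity)).trans h1
    have h5 : (degreeOf h p : ℝ) * 2 ≤ η * M := by
      rw [mul_div_assoc', div_le_iff₀ hη0] at h3; linarith
    have : (0:ℝ) ≤ degreeOf h p := by positivity
    nlinarith
  have e3 : ε * θ * M ≤ S * (η * M + η * M) := e1.trans (hlog.trans (mul_le_mul_of_nonneg_left (add_le_add e2 hn) hS0))
  have e4 : S * (η * M + η * M) = (S / (S+1)) * (ε * θ * M) / 2 := by rw [hη]; field_simp; ring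
  have e5 : S / (S + 1) ≤ 1 := by rw [div_le_one (by linarith)]; linarith
  have e6 : 0 < ε * θ * M := by positivity
  nlinarith

def mkDer {R : Type*} [CommRing R] (f : R →+ R) (hf : ∀ a b, f (a * b) = a * f b + b * f a) :
    Derivation ℤ R R :=
  Derivation.mk' (AddMonoidHom.toIntLinearMap f) (by intro a b; simpa using hf a b)

lemma toda' {R : Type*} [CommRing R] [IsDomain R] (d0 d1 : R →+ R)
    (l0 : ∀ a b, d0 (a * b) = a * d0 b + b * d0 a) (l1 : ∀ a b, d1 (a * b) = a * d1 b + b * d1 a)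
    (D : ℕ → ℕ → R)
    (h0 : ∀ i j, d0 (D i j) = ((i:ℤ)+1) * D (i+1) j) (h1 : ∀ i j, d1 (D i j) = ((j:ℤ)+1) * D i (j+1))
    (k : ℕ) (hk : (Matrix.of fun i j : Fin (k+1) => D i j).det ≠ 0)
    (hk' : (Matrix.of fun i j : Fin (k+2) => D i j).det = 0) :
    let W := (Matrix.of fun i j : Fin (k+1) => D i j).det
    W * d1 (d0 W) = d0 W * d1 W :=
  toda (mkDer d0 l0) (mkDer d1 l1) D h0 h1 k hk hk'

set_option maxHeartbeats 1000000 in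
lemma roth_step (m : ℕ) (ih : RothS D σ (m+1)) : RothS D σ (m+2) := by
  intro θ0 hθ0 ε hε
  set θ := min θ0 1 with hθd
  have hθ : 0 < θ := lt_min hθ0 one_pos
  have hθ1 : θ ≤ 1 := min_le_right _ _
  obtain ⟨ρ1, hρ1, η1, hη1, Ω1, hΩ1, H⟩ := ih (θ^2/64) (by positivity) ε hε
  refine ⟨min (min ρ1 (θ/2)) 1, by positivity, η1/2, by positivity, max Ω1 (6/η1), le_max_of_le_left hΩ1, ?_⟩
  intro s hcard ω α p M t hΩ hρ hα hp hd hdM hM hn ht hI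
  have ht : θ * M ≤ t := (mul_le_mul_of_nonneg_right (min_le_left _ _) hM.le).trans ht
  -- choose variables
  obtain ⟨x, hx, hxmax⟩ := s.exists_max_image ω (Finset.card_pos.1 (by omega))
  obtain ⟨y, hy⟩ : (s.erase x).Nonempty := Finset.card_pos.1 (by rw [Finset.card_erase_of_mem hx]; omega)
  have hyx : y ≠ x := (Finset.mem_erase.1 hy).1
  have hys : y ∈ s := (Finset.mem_erase.1 hy).2
  have hΩ0 : ∀ h ∈ s, (1:ℝ) ≤ ω h := fun h hh => hΩ1.trans ((le_max_left _ _).trans (hΩ h hh))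
  have hρxy : (ω y : ℝ) ≤ θ/2 * ω x := by
    have hle : (ω y : ℝ) ≤ ω x := by exact_mod_cast hxmax y hys
    have hb : min (min ρ1 (θ/2)) 1 ≤ θ/2 := (min_le_left _ _).trans (min_le_right _ _)
    have := hΩ0 x hx
    have := hΩ0 y hys
    rcases hρ y hys x hx hyx with h | h
    · exact h.trans (mul_le_mul_of_nonneg_right hb (by positivity))
    · nlinarith
  -- matrices
  set Dm : ℕ → ℕ → MvPolynomial σ ℤ := fun i j => hs x i (hs y j p) with hDm
  set Wd : ℕ → MvPolynomial σ ℤ := fun k => (Matrix.of fun i j : Fin k => Dm i j).det with hWd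
  have hW1 : Wd 1 ≠ 0 := by simp [hWd, hDm, hs_zero, hp]
  have hWbig : Wd (degreeOf x p + 1 + 1) = 0 := by
    refine Matrix.det_eq_zero_of_row_eq_zero (Fin.last (degreeOf x p + 1)) fun j => ?_
    simp only [Matrix.of_apply, hDm, Fin.val_last]
    exact hs_eq_zero _ _ _ (lt_of_le_of_lt (degreeOf_hs_le _ _ _ _) (Nat.lt_succ_self _))
  have hex : ∃ k, Wd (k+1) = 0 := ⟨_, hWbig⟩
  classical
  obtain ⟨k', hk'⟩ : ∃ k', Nat.find hex = k' + 1 := by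
    refine ⟨Nat.find hex - 1, ?_⟩
    have : Nat.find hex ≠ 0 := by
      intro h0; have := Nat.find_spec hex; rw [h0] at this; exact hW1 this
    omega
  have hz : Wd (k'+2) = 0 := by have := Nat.find_spec hex; rwa [hk'] at this
  have hnz : Wd (k'+1) ≠ 0 := Nat.find_min hex (by omega)
  have hkle : k' ≤ degreeOf x p := by have := Nat.find_min' hex hWbig; omega
  set W := Wd (k'+1) with hW
  have htoda := toda' (pderiv x).toLinearMap.toAddMonoidHom (pderiv y).toLinearMap.toAddMonoidHom
    (fun a b => by change pderiv x (a * b) = a * pderiv x b + b * pderiv x a; rw [pderiv_mul]; ring)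
    (fun a b => by change pderiv y (a * b) = a * pderiv y b + b * pderiv y a; rw [pderiv_mul]; ring)
    Dm (fun i j => pderiv_hs x i (hs y j p))
    (fun i j => by
      change pderiv y (hs x i (hs y j p)) = _ * hs x i (hs y (j+1) p)
      rw [pderiv_hs_ne hyx, pderiv_hs]
      have := hs_smul x i ((j:ℤ)+1) (hs y (j+1) p)
      simpa using this) k' hnz hz
  obtain ⟨b, c, hne, heq⟩ := separate (Ne.symm hyx) W hnz htoda
  set k := k' + 1 with hkd
  -- index of W
  have hkω : ((k - 1 : ℕ) : ℝ) * ω x ≤ M := by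
    refine le_trans (mul_le_mul_of_nonneg_right ?_ (by positivity)) (hdM x hx)
    exact_mod_cast (by omega : k - 1 ≤ degreeOf x p)
  set T := t - k' * ω y with hT
  have hTle : θ/2 * M ≤ T := by
    have h1 : (k' : ℝ) * ω y ≤ θ/2 * M := by
      calc (k':ℝ) * ω y ≤ k' * (θ/2 * ω x) := mul_le_mul_of_nonneg_left hρxy (by positivity)
        _ = θ/2 * (k' * ω x) := by ring
        _ ≤ θ/2 * M := mul_le_mul_of_nonneg_left (by simpa [hkd] using hkω) (by positivity)
    have h2 : t ≤ T + k' * ω y := by omega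
    have h3 : (t:ℝ) ≤ T + k' * ω y := by exact_mod_cast h2
    linarith
  have hIW : Ind ω α (∑ i : Fin k, (T - (i:ℕ) * ω x)) W := by
    refine ind_det k _ ω α _ fun i j => ?_
    simp only [Matrix.of_apply, hDm]
    have h1 := (hI.hs y (j:ℕ)).hs x (i:ℕ)
    refine h1.mono ?_
    have : (j:ℕ) * ω y ≤ k' * ω y := Nat.mul_le_mul_right _ (by omega)
    omega
  set tW := ∑ i : Fin k, (T - (i:ℕ) * ω x) with htW
  have hcount := count_sum k (ω x) T M (θ/2) (by positivity) (by linarith) hM (by omega) hkω hTle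
  rw [← htW] at hcount
  have hIUV : Ind ω α (tW/2 + (tW - tW/2)) (cf y c W * cf x b W) := by
    rw [← heq]
    exact ((hIW.mul (ind_zero ω α (cf x b (cf y c W))))).mono (by omega)
  have hUVne : cf y c W * cf x b W ≠ 0 := by rw [← heq]; exact mul_ne_zero hnz hne
  have hkr : (1:ℝ) ≤ k := by exact_mod_cast (by omega : 1 ≤ k)
  -- norm of W
  have hpn := one_le_nrm p hp
  have hWn : Real.log (nrm iabs (fun _ => 1) W) ≤ η1 * (k * M) := by
    have h1 : nrm iabs (fun _ => 1) W ≤ (k * (2^(degreeOf x p) * (2^(degreeOf y p) * nrm iabs (fun _ => 1) p)))^k := by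
      refine nrm_det_le k _ _ (by positivity) fun i j => ?_
      simp only [Matrix.of_apply, hDm]
      refine (nrm_hs_le x _ _).trans ?_
      refine mul_le_mul (pow_le_pow_right₀ (by norm_num) (degreeOf_hs_le _ _ _ _)) (nrm_hs_le y _ _) (nrm_nonneg (by simp) _) (by positivity)
    have h2 := Real.log_le_log (lt_of_lt_of_le one_pos (one_le_nrm W hnz)) h1
    rw [Real.log_pow, Real.log_mul (by positivity) (by positivity), Real.log_mul (by positivity) (by positivity),
      Real.log_mul (by positivity) (by positivity), Real.log_pow, Real.log_pow] at h2
    have hdeg : ∀ h ∈ s, (degreeOf h p : ℝ) ≤ η1/6 * M := by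
      intro h hh
      have h3 : 6/η1 ≤ ω h := (le_max_right _ _).trans (hΩ h hh)
      have h4 := (mul_le_mul_of_nonneg_left h3 (by positivity : (0:ℝ) ≤ degreeOf h p)).trans (hdM h hh)
      rw [mul_div_assoc', div_le_iff₀ hη1] at h4; linarith
    have hl2 := Real.log_two_lt_d9
    have hl20 : 0 < Real.log 2 := Real.log_pos (by norm_num)
    have hlk : Real.log k ≤ η1/6 * M := by
      have h3 := Real.log_le_sub_one_of_pos (by positivity : (0:ℝ) < k)
      have h4 : (k:ℝ) - 1 ≤ degreeOf x p := by
        have : (k' : ℝ) ≤ degreeOf x p := by exact_mod_cast hkle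
        rw [hkd]; push_cast; linarith
      linarith [hdeg x hx]
    have hx1 : (degreeOf x p : ℝ) * Real.log 2 ≤ η1/6 * M :=
      (mul_le_of_le_one_right (by positivity) (by linarith)).trans (hdeg x hx)
    have hy1 : (degreeOf y p : ℝ) * Real.log 2 ≤ η1/6 * M :=
      (mul_le_of_le_one_right (by positivity) (by linarith)).trans (hdeg y hys)
    refine h2.trans ?_
    have : k * (η1 * M) = η1 * (k * M) := by ring
    rw [← this]
    refine mul_le_mul_of_nonneg_left ?_ (by positivity)
    linarith
  have hWd : ∀ l, degreeOf l W ≤ k * degreeOf l p := by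
    intro l
    refine degreeOf_det_le k _ l _ fun i j => ?_
    exact (degreeOf_hs_le _ _ _ _).trans (degreeOf_hs_le _ _ _ _)
  have fin : ∀ z ∈ s, ∀ (d u : ℕ), cf z d W ≠ 0 → θ^2/64 * (k*M) ≤ u → ¬ Ind ω α u (cf z d W) := by
    intro z hz d u hnz' hu
    refine H (s.erase z) (by rw [Finset.card_erase_of_mem hz]; omega) ω α _ (k * M) u ?_ ?_ ?_ hnz' ?_ ?_ (by positivity) ?_ hu
    · intro h hh; exact (le_max_left _ _).trans (hΩ h (Finset.mem_of_mem_erase hh))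
    · intro h hh h' hh' hne
      have hb : min (min ρ1 (θ/2)) 1 ≤ ρ1 := (min_le_left _ _).trans (min_le_left _ _)
      rcases hρ h (Finset.mem_of_mem_erase hh) h' (Finset.mem_of_mem_erase hh') hne with h1 | h1
      · exact Or.inl (h1.trans (mul_le_mul_of_nonneg_right hb (by positivity)))
      · exact Or.inr (h1.trans (mul_le_mul_of_nonneg_right hb (by positivity)))
    · intro h hh; exact hα h (Finset.mem_of_mem_erase hh)
    · intro h hh
      by_cases hhz : h = z
      · subst hhz; exact degreeOf_cf_self _ _ _
      · have h0 := hd h (fun hc => hh (Finset.mem_erase.2 ⟨hhz, hc⟩))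
        have := (degreeOf_cf_le h z d W).trans (hWd h)
        rw [h0] at this; omega
    · intro h hh
      have h1 := (degreeOf_cf_le h z d W).trans (hWd h)
      have h2 : (degreeOf h (cf z d W) : ℝ) ≤ k * degreeOf h p := by exact_mod_cast h1
      calc (degreeOf h (cf z d W) : ℝ) * ω h ≤ k * degreeOf h p * ω h := mul_le_mul_of_nonneg_right h2 (by positivity)
        _ = k * (degreeOf h p * ω h) := by ring
        _ ≤ _ := mul_le_mul_of_nonneg_left (hdM h (Finset.mem_of_mem_erase hh)) (by positivity)
    · refine le_trans (Real.log_le_log (lt_of_lt_of_le one_pos (one_le_nrm _ hnz')) (nrm_cf_le _ _ _)) hWn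
  have hcount' : θ^2/64 * (k*M) ≤ tW/2 := by nlinarith
  rcases ind_or hIUV with h | h
  · refine fin y hys c _ (left_ne_zero_of_mul hUVne) ?_ h
    have : tW ≤ 2 * (tW/2 + 1) := by omega
    have : (tW:ℝ) ≤ 2 * ((tW/2 + 1 : ℕ):ℝ) := by exact_mod_cast this
    linarith
  · refine fin x hx b _ (right_ne_zero_of_mul hUVne) ?_ h
    have : tW ≤ 2 * (tW - tW/2) := by omega
    have : (tW:ℝ) ≤ 2 * ((tW - tW/2 : ℕ):ℝ) := by exact_mod_cast this
    linarith

theorem roth (m : ℕ) : RothS D σ m := by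
  rcases m with _ | m
  · exact roth_zero D
  · induction m with
    | zero => exact roth_one D
    | succ m ih => exact roth_step D m ih
end
end SU

open MvPolynomial
namespace SU
section cheb
variable {n : ℕ}

/-- exponents of degree `d` in `n` variables -/
def Sd (n d : ℕ) : Finset (Fin n → ℕ) := Finset.piAntidiag Finset.univ d

lemma mem_Sd {d : ℕ} {u : Fin n → ℕ} : u ∈ Sd n d ↔ ∑ i, u i = d := by
  simp [Sd]

lemma Sd_sum_eq (d : ℕ) (i j : Fin n) : ∑ u ∈ Sd n d, (u i : ℝ) = ∑ u ∈ Sd n d, (u j : ℝ) := by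
  refine Finset.sum_nbij' (fun u => u ∘ Equiv.swap i j) (fun u => u ∘ Equiv.swap i j) ?_ ?_ ?_ ?_ ?_
  · intro u hu; rw [mem_Sd] at *; rw [← hu]; exact Equiv.sum_comp (Equiv.swap i j) u
  · intro u hu; rw [mem_Sd] at *; rw [← hu]; exact Equiv.sum_comp (Equiv.swap i j) u
  · intro u _; ext x; simp
  · intro u _; ext x; simp
  · intro u _; simp

lemma Sd_mean (hn : 0 < n) (d : ℕ) (hd : 0 < d) (i : Fin n) :
    ∑ u ∈ Sd n d, ((u i : ℝ) / d - 1 / n) = 0 := by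
  have h1 : ∑ j : Fin n, ∑ u ∈ Sd n d, (u j : ℝ) = (Sd n d).card * d := by
    rw [Finset.sum_comm, Finset.sum_congr rfl (g := fun _ => (d:ℝ)) ?_, Finset.sum_const, nsmul_eq_mul]
    intro u hu; rw [mem_Sd] at hu; exact_mod_cast hu
  rw [Finset.sum_congr rfl fun j _ => Sd_sum_eq d j i, Finset.sum_const, Finset.card_univ,
    Fintype.card_fin, nsmul_eq_mul] at h1
  rw [Finset.sum_sub_distrib, ← Finset.sum_div, Finset.sum_const, nsmul_eq_mul]
  have : (0:ℝ) < n := by exact_mod_cast hn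
  have : (0:ℝ) < d := by exact_mod_cast hd
  field_simp; linarith

lemma cheb_sum {m : ℕ} (S : Fin m → Finset (Fin n → ℕ)) (g : Fin m → (Fin n → ℕ) → ℝ)
    (h0 : ∀ h, ∑ u ∈ S h, g h u = 0) (h1 : ∀ h, ∀ u ∈ S h, |g h u| ≤ 1) :
    ∑ f ∈ Fintype.piFinset S, (∑ h, g h (f h))^2 ≤ m * (Fintype.piFinset S).card := by
  have hcross : ∀ h h', h ≠ h' → ∑ f ∈ Fintype.piFinset S, g h (f h) * g h' (f h') = 0 := by
    intro h h' hne
    have := Finset.prod_univ_sum S (fun k u => if k = h then g h u else if k = h' then g h' u else 1)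
    rw [Finset.prod_eq_zero (Finset.mem_univ h) (by simp [h0])] at this
    rw [this]
    refine Finset.sum_congr rfl fun f _ => ?_
    rw [← Finset.mul_prod_erase _ _ (Finset.mem_univ h),
      ← Finset.mul_prod_erase _ _ (Finset.mem_erase.2 ⟨Ne.symm hne, Finset.mem_univ h'⟩),
      Finset.prod_eq_one]
    · simp [hne.symm]
    · intro k hk
      simp only [Finset.mem_erase] at hk
      simp [hk.1, hk.2.1]
  simp only [sq, Finset.sum_mul_sum]
  rw [Finset.sum_comm]
  have : ∀ h, ∑ f ∈ Fintype.piFinset S, ∑ h', g h (f h) * g h' (f h') ≤ (Fintype.piFinset S).card := by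
    intro h
    rw [Finset.sum_comm, Finset.sum_eq_single h (fun h' _ hne => hcross h h' hne.symm) (by simp)]
    rw [← nsmul_one (Fintype.piFinset S).card]
    refine Finset.sum_le_card_nsmul _ _ _ fun f hf => ?_
    have := h1 h (f h) (Fintype.mem_piFinset.1 hf h)
    have := abs_le.1 this
    nlinarith
  refine (Finset.sum_le_sum fun h _ => this h).trans ?_
  simp

variable {m : ℕ} (d : Fin m → ℕ)

def Ed (n : ℕ) (d : Fin m → ℕ) : Finset (Fin m → Fin n → ℕ) := Fintype.piFinset fun h => Sd n (d h)

def good (η : ℝ) (f : Fin m → Fin n → ℕ) : Prop :=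
  ∀ i, |∑ h, ((f h i : ℝ) / d h - 1 / n)| ≤ η * m

open Classical in
lemma bad_card (hn : 0 < n) (hd : ∀ h, 0 < d h) (η : ℝ) (hη : 0 < η)
    (hm : 2 * n * (n + 1) / η^2 ≤ m) (hm0 : 0 < m) :
    2 * ((n + 1) * ((Ed n d).filter fun f => ¬ good d η f).card) ≤ (Ed n d).card := by
  have hi : ∀ i : Fin n, (((Ed n d).filter fun f => η * m < |∑ h, ((f h i : ℝ) / d h - 1 / n)|).card : ℝ)
      * (η * m)^2 ≤ m * (Ed n d).card := by
    intro i
    have h1 := cheb_sum (fun h => Sd n (d h)) (fun h u => (u i : ℝ) / d h - 1/n)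
      (fun h => Sd_mean hn (d h) (hd h) i) ?_
    · set G : (Fin m → Fin n → ℕ) → ℝ := fun f => ∑ h, ((f h i : ℝ) / d h - 1 / n) with hG
      change ∑ f ∈ Ed n d, (G f)^2 ≤ m * ((Ed n d).card : ℝ) at h1
      change (((Ed n d).filter fun f => η * m < |G f|).card : ℝ) * (η * m)^2 ≤ m * ((Ed n d).card : ℝ)
      refine le_trans ?_ h1
      have h2 : ∀ f ∈ (Ed n d).filter fun f => η * m < |G f|, (η * m)^2 ≤ (G f)^2 := by
        intro f hf
        have := (Finset.mem_filter.1 hf).2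
        rw [← sq_abs (G f)]
        exact pow_le_pow_left₀ (by positivity) this.le 2
      have h3 := Finset.card_nsmul_le_sum _ _ _ h2
      rw [nsmul_eq_mul] at h3
      exact h3.trans (Finset.sum_le_sum_of_subset_of_nonneg (Finset.filter_subset _ _) fun _ _ _ => sq_nonneg _)
    · intro h u hu
      rw [mem_Sd] at hu
      have h2 : u i ≤ d h := by rw [← hu]; exact Finset.single_le_sum (fun _ _ => Nat.zero_le _) (Finset.mem_univ i)
      have h3 : (u i : ℝ) / d h ≤ 1 := by
        rw [div_le_one (by exact_mod_cast hd h)]; exact_mod_cast h2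
      have h4 : (0:ℝ) ≤ (u i : ℝ) / d h := by positivity
      have h5 : (1:ℝ) / n ≤ 1 := by rw [div_le_one (by exact_mod_cast hn)]; exact_mod_cast hn
      have h6 : (0:ℝ) ≤ 1 / n := by positivity
      rw [abs_le]; constructor <;> linarith
  have hsub : ((Ed n d).filter fun f => ¬ good d η f) ⊆
      Finset.univ.biUnion fun i : Fin n => (Ed n d).filter fun f => η * m < |∑ h, ((f h i : ℝ) / d h - 1 / n)| := by
    intro f hf
    obtain ⟨h1, h2⟩ := Finset.mem_filter.1 hf
    simp only [good, not_forall, not_le] at h2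
    obtain ⟨i, hi⟩ := h2
    exact Finset.mem_biUnion.2 ⟨i, Finset.mem_univ _, Finset.mem_filter.2 ⟨h1, hi⟩⟩
  have hc := (Finset.card_le_card hsub).trans Finset.card_biUnion_le
  set b := ((Ed n d).filter fun f => ¬ good d η f).card
  have hc' : (b : ℝ) ≤ ∑ i : Fin n, (((Ed n d).filter fun f => η * m < |∑ h, ((f h i : ℝ) / d h - 1 / n)|).card : ℝ) := by
    exact_mod_cast hc
  have hmr : (0:ℝ) < m := by exact_mod_cast hm0
  have hfin : (b:ℝ) * (η * m)^2 ≤ n * (m * (Ed n d).card) := by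
    refine (mul_le_mul_of_nonneg_right hc' (by positivity)).trans ?_
    rw [Finset.sum_mul]
    refine (Finset.sum_le_sum fun i _ => hi i).trans ?_
    simp
  have h7 : 2 * n * (n + 1) ≤ m * η^2 := by rwa [div_le_iff₀ (by positivity)] at hm
  have h8 : (b:ℝ) * (m * η^2) ≤ n * (Ed n d).card := by
    have : m * (b * (m * η^2)) ≤ m * (n * ((Ed n d).card : ℝ)) := by nlinarith
    exact le_of_mul_le_mul_left this hmr
  have hnr : (0:ℝ) < n := by exact_mod_cast hn
  have h9 : n * (2 * ((n + 1) * (b:ℝ))) ≤ n * (Ed n d).card := by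
    refine le_trans ?_ h8
    have : (0:ℝ) ≤ b := by positivity
    nlinarith
  have h10 := le_of_mul_le_mul_left h9 hnr
  exact_mod_cast h10

lemma Sd_card_le (d : ℕ) : (Sd n d).card ≤ 2 ^ (n * d) := by
  have : Sd n d ⊆ Fintype.piFinset fun _ : Fin n => Finset.range (d+1) := by
    intro u hu
    rw [mem_Sd] at hu
    rw [Fintype.mem_piFinset]
    intro i
    rw [Finset.mem_range, Nat.lt_succ_iff, ← hu]
    exact Finset.single_le_sum (fun _ _ => Nat.zero_le _) (Finset.mem_univ i)
  refine (Finset.card_le_card this).trans ?_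
  rw [Fintype.card_piFinset]
  simp only [Finset.card_range, Finset.prod_const, Finset.card_univ, Fintype.card_fin]
  rw [mul_comm, pow_mul]
  exact Nat.pow_le_pow_left Nat.lt_two_pow_self _

lemma Ed_card_le : (Ed n d).card ≤ 2 ^ (n * ∑ h, d h) := by
  rw [Ed, Fintype.card_piFinset, Finset.mul_sum, ← Finset.prod_pow_eq_pow_sum]
  exact Finset.prod_le_prod' fun h _ => Sd_card_le (d h)

lemma Ed_pos (hn : 0 < n) : (Ed n d).Nonempty := by
  refine ⟨fun h => Pi.single ⟨0, hn⟩ (d h), ?_⟩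
  rw [Ed, Fintype.mem_piFinset]; intro h; rw [mem_Sd]; simp
end cheb
end SU

open MvPolynomial
namespace SU
section siegel
variable {m n : ℕ}

/-- multidegree weights -/
def wt (m n : ℕ) : Fin m × Fin n → (Fin m → ℕ) := fun p => Pi.single p.1 1

lemma weight_wt (e : Fin m × Fin n →₀ ℕ) (h : Fin m) :
    Finsupp.weight (wt m n) e h = ∑ i, e (h, i) := by
  rw [Finsupp.weight_apply, Finsupp.sum_fintype _ _ (by simp), Finset.sum_apply,
    Fintype.sum_prod_type, Finset.sum_eq_single h]
  · simp [wt]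
  · intro h' _ hne; simp [wt, hne.symm]
  · simp

/-- curry an exponent -/
def cu (e : Fin m × Fin n →₀ ℕ) : Fin m → Fin n → ℕ := fun h i => e (h, i)

/-- uncurry -/
noncomputable def toE (f : Fin m → Fin n → ℕ) : Fin m × Fin n →₀ ℕ :=
  Finsupp.equivFunOnFinite.symm fun p => f p.1 p.2

lemma cu_toE (f : Fin m → Fin n → ℕ) : cu (toE f) = f := rfl
lemma toE_cu (e : Fin m × Fin n →₀ ℕ) : toE (cu e) = e := by ext p; rfl

lemma cu_mem_Ed {d : Fin m → ℕ} {e : Fin m × Fin n →₀ ℕ} :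
    cu e ∈ Ed n d ↔ Finsupp.weight (wt m n) e = d := by
  simp only [Ed, Fintype.mem_piFinset, mem_Sd, funext_iff, weight_wt, cu]

/-- the substitutions -/
noncomputable def gs (l : Option (Fin n)) (p : Fin m × Fin n) : MvPolynomial (Fin m × Fin n) ℤ :=
  match l with
  | none => X p
  | some l => if p.2 = l then - X p else X p - X (p.1, l)

lemma gs_invol (l : Option (Fin n)) (P : MvPolynomial (Fin m × Fin n) ℤ) :
    aeval (gs l) (aeval (gs l) P) = P := by
  suffices h : (aeval (gs l)).comp (aeval (gs l)) = AlgHom.id ℤ (MvPolynomial (Fin m × Fin n) ℤ) from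
    congrArg (fun φ => φ P) h
  ext1 p
  rw [AlgHom.comp_apply]
  cases l with
  | none => simp [gs]
  | some l =>
    obtain ⟨h, i⟩ := p
    by_cases hi : i = l
    · simp [gs, hi]
    · simp [gs, hi]

lemma gs_hom (l : Option (Fin n)) (p : Fin m × Fin n) :
    IsWeightedHomogeneous (wt m n) (gs l p) (Pi.single p.1 1) := by
  have hX : ∀ p : Fin m × Fin n, IsWeightedHomogeneous (wt m n) (X p : MvPolynomial _ ℤ) (Pi.single p.1 1) :=
    fun p => isWeightedHomogeneous_X ℤ (wt m n) p
  cases l with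
  | none => exact hX p
  | some l =>
    simp only [gs]
    split_ifs
    · exact (hX p).neg
    · exact (hX p).sub (hX (p.1, l))

lemma aeval_gs_hom (l : Option (Fin n)) {d : Fin m → ℕ} {P : MvPolynomial (Fin m × Fin n) ℤ}
    (hP : IsWeightedHomogeneous (wt m n) P d) :
    IsWeightedHomogeneous (wt m n) (aeval (gs l) P) d := by
  rw [aeval_def, eval₂_eq']
  refine IsWeightedHomogeneous.sum _ _ _ fun e he => ?_
  refine IsWeightedHomogeneous.C_mul ?_ _
  rw [← hP (mem_support_iff.1 he)]
  rw [Finsupp.weight_apply, Finsupp.sum_fintype _ _ (by simp)]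
  exact IsWeightedHomogeneous.prod _ _ _ fun p _ => (gs_hom l p).pow _

lemma nrm_gs (l : Option (Fin n)) (p : Fin m × Fin n) :
    nrm iabs (fun _ => 1) (gs l p) ≤ 2 := by
  have hX : ∀ p : Fin m × Fin n, nrm iabs (fun _ => 1) (X p : MvPolynomial _ ℤ) = 1 :=
    fun p => nrm_X p iabs_one
  have hn : ∀ p : Fin m × Fin n, nrm iabs (fun _ => 1) (- X p : MvPolynomial _ ℤ) = 1 := by
    intro p
    rw [X, ← map_neg (monomial _), nrm_monomial, mon_one, iabs_apply]; simp
  cases l with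
  | none => simp [gs, hX]
  | some l =>
    simp only [gs]
    split_ifs
    · rw [hn]; norm_num
    · rw [sub_eq_add_neg]
      refine (nrm_add_le (by simp) _ _).trans ?_
      rw [hX, hn]; norm_num

lemma mon_two {d : Fin m → ℕ} {e : Fin m × Fin n →₀ ℕ} (c : ℝ) (he : Finsupp.weight (wt m n) e = d) :
    mon (fun _ => c) e = c ^ (∑ h, d h) := by
  rw [mon, Finsupp.prod_fintype _ _ (by simp), Finset.prod_pow_eq_pow_sum, Fintype.sum_prod_type, ← he]
  simp only [weight_wt]

lemma nrm_const {d : Fin m → ℕ} {P : MvPolynomial (Fin m × Fin n) ℤ} (c : ℝ)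
    (hP : IsWeightedHomogeneous (wt m n) P d) :
    nrm iabs (fun _ => c) P = c ^ (∑ h, d h) * nrm iabs (fun _ => 1) P := by
  rw [nrm, nrm, Finset.mul_sum]
  refine Finset.sum_congr rfl fun e he => ?_
  rw [mon_two c (hP (mem_support_iff.1 he)), mon_one]; ring

lemma nrm_aeval_gs (l : Option (Fin n)) {d : Fin m → ℕ} {P : MvPolynomial (Fin m × Fin n) ℤ}
    (hP : IsWeightedHomogeneous (wt m n) P d) :
    nrm iabs (fun _ => 1) (aeval (gs l) P) ≤ 2 ^ (∑ h, d h) * nrm iabs (fun _ => 1) P := by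
  rw [← nrm_const 2 hP]
  exact nrm_aeval_le iabs_one (by simp) (gs l) (fun i => nrm_gs l i) P

theorem aux_poly (hn : 0 < n) (d : Fin m → ℕ) (hd : ∀ h, 0 < d h) (η : ℝ) (hη : 0 < η)
    (hm : 2 * n * (n + 1) / η^2 ≤ m) (hm0 : 0 < m) :
    ∃ P : MvPolynomial (Fin m × Fin n) ℤ, P ≠ 0 ∧ IsWeightedHomogeneous (wt m n) P d ∧
      (∀ l, ∀ e, coeff e (aeval (gs l) P) ≠ 0 → good d η (cu e)) ∧
      nrm iabs (fun _ => 1) P ≤ 2 ^ ((2 * n + 1) * ∑ h, d h) := by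
  classical
  set B := (Ed n d).filter fun f => ¬ good d η f with hB
  have hb := bad_card d hn hd η hη hm hm0
  rw [← hB] at hb
  let mk : (Ed n d → ℤ) → MvPolynomial (Fin m × Fin n) ℤ := fun t => ∑ f, monomial (toE f.1) (t f)
  have hmk : ∀ t, IsWeightedHomogeneous (wt m n) (mk t) d := fun t =>
    IsWeightedHomogeneous.sum _ _ _ fun f _ => isWeightedHomogeneous_monomial _ _ _
      (cu_mem_Ed.1 (by rw [cu_toE]; exact f.2))
  have hco : ∀ t (f : Ed n d), coeff (toE f.1) (mk t) = t f := by
    intro t f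
    simp only [mk, coeff_sum, coeff_monomial]
    rw [Finset.sum_eq_single f]
    · simp
    · intro g _ hg
      rw [if_neg]; intro h; apply hg; ext1; rw [← cu_toE g.1, h, cu_toE]
    · simp
  have hnr : ∀ t (c : ℝ), (∀ f, |(t f : ℝ)| ≤ c) → nrm iabs (fun _ => 1) (mk t) ≤ (Ed n d).card * c := by
    intro t c h
    refine (nrm_sum_le (by simp) _ _).trans ?_
    refine (Finset.sum_le_card_nsmul _ _ c fun f _ => ?_).trans ?_
    · rw [nrm_monomial, mon_one, mul_one, iabs_apply]; exact h f
    · simp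
  have hcard : ((Ed n d).card : ℝ) ≤ 2 ^ (n * ∑ h, d h) := by exact_mod_cast Ed_card_le d
  have key : ∀ t : Ed n d → ℤ, (∀ l, ∀ f ∈ B, coeff (toE f) (aeval (gs l) (mk t)) = 0) →
      ∀ l, ∀ e, coeff e (aeval (gs l) (mk t)) ≠ 0 → good d η (cu e) := by
    intro t ht l e he
    by_contra hg
    refine he ?_
    rw [← toE_cu e]
    exact ht l _ (Finset.mem_filter.2 ⟨cu_mem_Ed.2 (aeval_gs_hom l (hmk t) he), hg⟩)
  rcases B.eq_empty_or_nonempty with hB0 | hB0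
  · obtain ⟨f, hf⟩ := Ed_pos d hn
    refine ⟨mk (Pi.single ⟨f, hf⟩ 1), ?_, hmk _, key _ (by simp [hB0]), ?_⟩
    · intro h0
      have := hco (Pi.single ⟨f, hf⟩ 1) ⟨f, hf⟩
      rw [h0] at this; simp at this
    · refine (hnr _ 1 fun f' => ?_).trans ?_
      · by_cases h : f' = ⟨f, hf⟩
        · subst h; simp
        · simp [Pi.single_eq_of_ne h]
      · rw [mul_one]; refine hcard.trans ?_
        gcongr
        · norm_num
        · omega
  · let A : Matrix (Option (Fin n) × B) (Ed n d) ℤ := fun r f =>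
      coeff (toE r.2.1) (aeval (gs r.1) (monomial (toE f.1) (1:ℤ)))
    have hA : ∀ r f, |(A r f : ℝ)| ≤ 2 ^ (∑ h, d h) := by
      intro r f
      have h1 := coeff_le_nrm (a := iabs) (w := fun _ => 1) (by simp)
        (aeval (gs r.1) (monomial (toE f.1) (1:ℤ))) (toE r.2.1)
      rw [mon_one, mul_one, iabs_apply] at h1
      refine h1.trans ((nrm_aeval_gs r.1 (isWeightedHomogeneous_monomial _ _ _
        (cu_mem_Ed.1 (by rw [cu_toE]; exact f.2)))).trans ?_)
      rw [nrm_monomial, mon_one, iabs_one]; simp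
    have hc1 : Fintype.card (Option (Fin n) × B) = (n+1) * B.card := by simp
    have hc2 : Fintype.card (Ed n d) = (Ed n d).card := by simp
    have hBp : 0 < B.card := hB0.card_pos
    have hp : 0 < (n+1) * B.card := by positivity
    obtain ⟨t, ht0, ht, htn⟩ := Int.Matrix.exists_ne_zero_int_vec_norm_le A
      (by rw [hc1, hc2]; omega) (by rw [hc1]; exact hp)
    let _ : SeminormedAddCommGroup (Matrix (Option (Fin n) × B) (Ed n d) ℤ) :=
      Matrix.seminormedAddCommGroup
    have hAn : ‖A‖ ≤ 2 ^ (∑ h, d h) := by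
      refine (Matrix.norm_le_iff (by positivity)).2 fun r f => ?_
      rw [Int.norm_eq_abs]; exact hA r f
    have htc : ∀ f, |(t f : ℝ)| ≤ 2 ^ (n * ∑ h, d h) * 2 ^ (∑ h, d h) := by
      intro f
      have h1 : |(t f : ℝ)| ≤ ‖t‖ := by rw [← Int.norm_eq_abs]; exact norm_le_pi_norm t f
      refine h1.trans (htn.trans ?_)
      rw [hc1, hc2]
      have h2 : (1:ℝ) ≤ (Ed n d).card * max 1 ‖A‖ := by
        have : (1:ℝ) ≤ (Ed n d).card := by exact_mod_cast (Ed_pos d hn).card_pos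
        nlinarith [le_max_left 1 ‖A‖]
      refine (Real.rpow_le_rpow_of_exponent_le h2 (y := _) (z := 1) ?_).trans ?_
      · have hq : (2:ℝ) * (((n+1) * B.card : ℕ) : ℝ) ≤ (Ed n d).card := by exact_mod_cast hb
        have hq2 : (0:ℝ) < (((n+1) * B.card : ℕ) : ℝ) := by exact_mod_cast hp
        rw [div_le_one (by linarith)]; linarith
      · rw [Real.rpow_one]
        gcongr
        exact max_le (one_le_pow₀ (by norm_num)) hAn
    refine ⟨mk t, ?_, hmk t, key t ?_, ?_⟩
    · intro h0
      apply ht0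
      funext f
      rw [← hco t f, h0]; simp
    · intro l f hf
      have := congrFun ht (l, ⟨f, hf⟩)
      simp only [Matrix.mulVec, dotProduct, A, Pi.zero_apply] at this
      rw [← this]
      simp only [mk, map_sum, coeff_sum]
      refine Finset.sum_congr rfl fun g _ => ?_
      rw [show monomial (toE g.1) (t g) = C (t g) * monomial (toE g.1) 1 by rw [C_mul_monomial, mul_one],
        map_mul, aeval_C, algebraMap_eq, coeff_C_mul, mul_comm]
    · refine (hnr t _ htc).trans ?_
      calc _ ≤ (2:ℝ) ^ (n * ∑ h, d h) * (2 ^ (n * ∑ h, d h) * 2 ^ (∑ h, d h)) := by gcongr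
        _ = _ := by rw [← pow_add, ← pow_add]; congr 1; ring
end siegel
end SU

open MvPolynomial
namespace SU
section elim
variable {σ : Type*} [DecidableEq σ] {K : Type*} [Field K]

/-- the substitution `x ↦ ζ^ω x + b x` for `x ∈ xs` -/
noncomputable def Phi (xs : Finset σ) (ω : σ → ℕ) (b : σ → MvPolynomial σ K) :
    MvPolynomial σ ℤ →ₐ[ℤ] Polynomial (MvPolynomial σ K) :=
  aeval fun x => if x ∈ xs then Polynomial.C (X x) * Polynomial.X ^ ω x + Polynomial.C (b x)
    else Polynomial.C (X x)

/-- set variables in `Z` to zero -/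
noncomputable def kill (Z : Finset σ) : MvPolynomial σ K →ₐ[K] MvPolynomial σ K :=
  aeval fun x => if x ∈ Z then 0 else X x

lemma kill_insert (z : σ) (Z : Finset σ) (f : MvPolynomial σ K) :
    kill (insert z Z) f = kill Z (kill {z} f) := by
  suffices h : kill (K := K) (insert z Z) = (kill Z).comp (kill {z}) from congrArg (fun φ => φ f) h
  ext1 x
  by_cases h : x = z
  · subst h; simp [kill]
  · by_cases h2 : x ∈ Z <;> simp [kill, h, h2]

lemma map_Phi (xs : Finset σ) (ω : σ → ℕ) (b : σ → MvPolynomial σ K)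
    (ψ : MvPolynomial σ K →ₐ[K] MvPolynomial σ K) (δ : σ → MvPolynomial σ ℤ)
    (h1 : ∀ x ∈ xs, ψ (X x) = X x) (h2 : ∀ x ∈ xs, δ x = X x)
    (h3 : ∀ x ∉ xs, Phi xs ω (fun x => ψ (b x)) (δ x) = Polynomial.C (ψ (X x)))
    (p : MvPolynomial σ ℤ) :
    (Phi xs ω b p).map (ψ : MvPolynomial σ K →+* MvPolynomial σ K) =
      Phi xs ω (fun x => ψ (b x)) (aeval δ p) := by
  suffices h : (Polynomial.mapRingHom (ψ : MvPolynomial σ K →+* MvPolynomial σ K)).comp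
      (Phi xs ω b : MvPolynomial σ ℤ →+* _) =
      (Phi xs ω (fun x => ψ (b x)) : MvPolynomial σ ℤ →+* _).comp
        (aeval δ : MvPolynomial σ ℤ →ₐ[ℤ] MvPolynomial σ ℤ) from congrArg (fun φ => φ p) h
  apply MvPolynomial.ringHom_ext
  · intro r; simp
  · intro x
    by_cases hx : x ∈ xs
    · simp [Phi, hx, h1 x hx, h2 x hx]
    · have := h3 x hx
      simp only [RingHom.comp_apply, RingHom.coe_coe, aeval_X, this]
      simp [Phi, hx]

lemma Phi_lift {xs : Finset σ} {ω : σ → ℕ} {b : σ → MvPolynomial σ K} (z : σ) (hz : z ∉ xs) :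
    Phi xs ω b (X z) = Polynomial.C (X z) := by simp [Phi, hz]

lemma exists_lowest (z : σ) (p : MvPolynomial σ ℤ) (hp : p ≠ 0) :
    ∃ r q, cf z r p ≠ 0 ∧ p = X z ^ r * (cf z r p + X z * q) := by
  have h0 : tu z p ≠ 0 := fun h => hp (tu_injective z (by rw [h, map_zero]))
  have hev : ∀ f : MvPolynomial σ ℤ, (tu z f).eval (X z) = f := by
    intro f
    have : ((Polynomial.evalRingHom (X z)).comp (tu z).toRingHom) = RingHom.id _ := by
      apply MvPolynomial.ringHom_ext
      · intro r; simp
      · intro i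
        by_cases h : i = z
        · subst h; simp [tu]
        · simp [tu, h]
    exact congrArg (fun φ => φ f) this
  set T := tu z p
  refine ⟨T.natTrailingDegree, ?_⟩
  have h1 : T.coeff T.natTrailingDegree ≠ 0 := Polynomial.trailingCoeff_nonzero_iff_nonzero.2 h0
  obtain ⟨u, hu⟩ := (Polynomial.X_pow_dvd_iff (f := T) (n := T.natTrailingDegree)).2
    fun d hd => Polynomial.coeff_eq_zero_of_lt_natTrailingDegree hd
  have h2 : u.coeff 0 = T.coeff T.natTrailingDegree := by
    have := Polynomial.coeff_X_pow_mul u T.natTrailingDegree 0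
    rw [zero_add, ← hu] at this; rw [← this]
  refine ⟨u.divX.eval (X z), h1, ?_⟩
  conv_lhs => rw [← hev p]
  change T.eval _ = _
  conv_lhs => rw [hu, ← Polynomial.divX_mul_X_add u, h2]
  simp only [Polynomial.eval_mul, Polynomial.eval_pow, Polynomial.eval_X, Polynomial.eval_add,
    Polynomial.eval_C]
  change _ = X z ^ T.natTrailingDegree * (T.coeff _ + _)
  ring

lemma vars_deg {f : MvPolynomial σ ℤ} {i : σ} (hf : degreeOf i f = 0) (hi : i ∈ f.vars) : False := by
  obtain ⟨e, he, hie⟩ := (mem_vars i).1 hi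
  exact (Finsupp.mem_support_iff.1 hie) (Nat.le_zero.1 (degreeOf_le_iff.1 hf.le e he))

lemma elim_vars (xs : Finset σ) (ω : σ → ℕ) (t : ℕ) (Z : Finset σ) (hZ : Disjoint Z xs) :
    ∀ (b : σ → MvPolynomial σ K) (p : MvPolynomial σ ℤ), p ≠ 0 → Polynomial.X ^ t ∣ Phi xs ω b p →
    ∃ p' : MvPolynomial σ ℤ, p' ≠ 0 ∧ (∀ z ∈ Z, degreeOf z p' = 0) ∧
      (∀ x, degreeOf x p' ≤ degreeOf x p) ∧
      nrm iabs (fun _ => 1) p' ≤ nrm iabs (fun _ => 1) p ∧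
      Polynomial.X ^ t ∣ Phi xs ω (fun x => kill Z (b x)) p' := by
  induction Z using Finset.induction_on with
  | empty =>
    intro b p hp h
    refine ⟨p, hp, by simp, fun x => le_rfl, le_rfl, ?_⟩
    have : (kill (K := K) (∅ : Finset σ)) = AlgHom.id K _ := by ext1 x; simp [kill]
    simpa [this] using h
  | insert z Z hzZ ih =>
    intro b p hp h
    rw [Finset.disjoint_insert_left] at hZ
    obtain ⟨r, q, hr, hpq⟩ := exists_lowest z p hp
    have h1 : Polynomial.X ^ t ∣ Phi xs ω b (cf z r p + X z * q) := by
      rw [hpq, map_mul, map_pow, Phi_lift z hZ.1] at h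
      rw [← Polynomial.C_pow, Polynomial.X_pow_dvd_iff] at h
      rw [Polynomial.X_pow_dvd_iff]
      intro d hd
      have := h d hd
      rw [Polynomial.coeff_C_mul] at this
      exact (mul_eq_zero.1 this).resolve_left (pow_ne_zero _ (X_ne_zero z))
    have h2 : Polynomial.X ^ t ∣ Phi xs ω (fun x => kill {z} (b x)) (cf z r p) := by
      have hm := Polynomial.map_dvd (kill (K := K) {z} : MvPolynomial σ K →+* MvPolynomial σ K) h1
      have hzx : ∀ x ∈ xs, x ≠ z := fun x hx h => hZ.1 (h ▸ hx)
      rw [map_Phi xs ω b (kill {z}) (fun x => if x = z then 0 else X x)] at hm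
      · rw [Polynomial.map_pow, Polynomial.map_X, map_add, map_mul, aeval_X, if_pos rfl, zero_mul,
          add_zero] at hm
        convert hm using 2
        have hc : ∀ f : MvPolynomial σ ℤ, degreeOf z f = 0 →
            f = aeval (fun x => if x = z then 0 else X x) f := by
          intro f hf
          conv_lhs => rw [← aeval_X_left_apply f]
          refine eval₂Hom_congr' rfl ?_ rfl
          intro i hi _
          rw [if_neg]
          rintro rfl
          exact vars_deg hf hi
        exact hc _ (degreeOf_cf_self z r p)
      · intro x hx; simp [kill, hzx x hx]
      · intro x hx; simp [hzx x hx]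
      · intro x hx
        by_cases hxz : x = z
        · simp [hxz, kill]
        · simp [hxz, kill, Phi, hx]
    obtain ⟨p', hp', hd, hdl, hn, hdiv⟩ := ih hZ.2 _ _ hr h2
    refine ⟨p', hp', ?_, fun x => (hdl x).trans (degreeOf_cf_le _ _ _ _), hn.trans (nrm_cf_le _ _ _), ?_⟩
    · intro x hx
      rcases Finset.mem_insert.1 hx with rfl | hx
      · exact Nat.le_zero.1 ((hdl x).trans (degreeOf_cf_self x r p).le)
      · exact hd x hx
    · simpa only [kill_insert] using hdiv

lemma Phi_ind {xs : Finset σ} {ω : σ → ℕ} {t : ℕ} {α : σ → K} {p : MvPolynomial σ ℤ}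
    (hd : ∀ z ∉ xs, degreeOf z p = 0) (h : Polynomial.X ^ t ∣ Phi xs ω (fun x => C (α x)) p) :
    Ind ω α t p := by
  rw [ind_iff]
  convert h using 1
  change ((zet (K := K) ω : MvPolynomial σ K →+* Polynomial (MvPolynomial σ K)).comp
    (shf α : MvPolynomial σ ℤ →+* MvPolynomial σ K)) p
      = (Phi xs ω (fun x => C (α x)) : MvPolynomial σ ℤ →+* Polynomial (MvPolynomial σ K)) p
  refine MvPolynomial.hom_congr_vars ?_ ?_ rfl
  · ext r; simp
  · intro i hi _
    have : i ∈ xs := by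
      by_contra hx
      exact vars_deg (hd i hx) hi
    simp [zet, shf, Phi, this]
end elim
end SU

open MvPolynomial
namespace SU
section E1
variable {m n k : ℕ} {K ι : Type*} [Field K] [Fintype ι]

/-- dual substitution on vectors -/
def gst (l : Option (Fin n)) (w : Fin n → K) (i : Fin n) : K :=
  match l with
  | none => w i
  | some l => if i = l then - w l else w i - w l

/-- parametrisation of the hyperplane plus the transversal direction -/
noncomputable def Psi (i0 : Fin n) (w : Fin m → Fin k → Fin n → K) (p : Fin m × Fin n) :
    MvPolynomial (Fin m × Fin k ⊕ Fin m) K :=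
  ∑ j, C (w p.1 j p.2) * X (Sum.inl (p.1, j)) + if p.2 = i0 then X (Sum.inr p.1) else 0

lemma Psi_gs (i0 : Fin n) (w : Fin m → Fin k → Fin n → K) (l : Option (Fin n)) (p : Fin m × Fin n) :
    aeval (Psi i0 w) (gs l p) = ∑ j, C (gst l (w p.1 j) p.2) * X (Sum.inl (p.1, j)) +
      C (gst l (Pi.single i0 1) p.2) * X (Sum.inr p.1) := by
  have h0 : ∀ i, (C ((Pi.single i0 1 : Fin n → K) i) * X (Sum.inr p.1) : MvPolynomial (Fin m × Fin k ⊕ Fin m) K)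
      = if i = i0 then X (Sum.inr p.1) else 0 := by
    intro i
    by_cases h : i = i0
    · subst h; simp
    · simp [h]
  cases l with
  | none => simp only [gs, gst, aeval_X, Psi, h0]
  | some l =>
    simp only [gs, gst]
    split_ifs with h
    · subst h
      simp only [map_neg, aeval_X, Psi, neg_mul, h0, Finset.sum_neg_distrib]; ring
    · simp only [map_sub, aeval_X, Psi, sub_mul, h0, Finset.sum_sub_distrib]; ring

lemma gst_single_le (a : AbsoluteValue K ℝ) (l : Option (Fin n)) (i0 i : Fin n) :
    a (gst l (Pi.single i0 1 : Fin n → K) i) ≤ 1 := by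
  have h1 : ∀ j, (Pi.single i0 1 : Fin n → K) j = if j = i0 then 1 else 0 := fun j => Pi.single_apply _ _ _
  cases l with
  | none => simp only [gst, h1]; split_ifs <;> simp
  | some l =>
    simp only [gst, h1]; split_ifs <;> simp

lemma nrm_Psi (a : AbsoluteValue K ℝ) (i0 : Fin n) (w : Fin m → Fin k → Fin n → K)
    (l : Option (Fin n)) (p : Fin m × Fin n) (S : Fin m → ℝ) (hS : ∀ h, 0 ≤ S h) (R : ℝ)
    (h1 : ∀ j, a (gst l (w p.1 j) p.2) ≤ R) (h2 : S p.1 ≤ R) :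
    nrm a (Sum.elim (fun _ => 1) S) (aeval (Psi i0 w) (gs l p)) ≤ (k + 1) * R := by
  have hw : ∀ x : Fin m × Fin k ⊕ Fin m, (0:ℝ) ≤ Sum.elim (fun _ => 1) S x := by
    rintro (x | x)
    · simp
    · exact hS x
  rw [Psi_gs]
  refine (nrm_add_le hw _ _).trans ?_
  have h3 : ∀ j, nrm a (Sum.elim (fun _ => 1) S)
      (C (gst l (w p.1 j) p.2) * X (Sum.inl (p.1, j)) : MvPolynomial (Fin m × Fin k ⊕ Fin m) K) ≤ R := by
    intro j
    refine (nrm_mul_le hw _ _).trans ?_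
    rw [nrm_C, nrm_X _ a.map_one]; simpa using h1 j
  have h4 : nrm a (Sum.elim (fun _ => 1) S) (C (gst l (Pi.single i0 1) p.2) * X (Sum.inr p.1) :
      MvPolynomial (Fin m × Fin k ⊕ Fin m) K) ≤ R := by
    refine (nrm_mul_le hw _ _).trans ?_
    rw [nrm_C, nrm_X _ a.map_one]
    refine le_trans ?_ h2
    simp only [Sum.elim_inr]
    exact mul_le_of_le_one_left (hS _) (gst_single_le a l i0 p.2)
  have h5 := (nrm_sum_le hw Finset.univ _).trans (Finset.sum_le_card_nsmul Finset.univ _ R fun j _ => h3 j)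
  simp only [Finset.card_univ, Fintype.card_fin, nsmul_eq_mul] at h5
  linarith

lemma coeff_mem_O (O : Subring K) {τ σ : Type*} (g : σ → MvPolynomial τ K)
    (hg : ∀ p e, coeff e (g p) ∈ O) (P : MvPolynomial σ ℤ) (e : τ →₀ ℕ) :
    coeff e (aeval g P) ∈ O := by
  have hr : ∀ f : MvPolynomial τ K, (∀ e, coeff e f ∈ O) → f ∈ (MvPolynomial.map (σ := τ) O.subtype).range := by
    intro f hf
    rw [f.as_sum]
    refine Subring.sum_mem _ fun e _ => ⟨monomial e ⟨coeff e f, hf e⟩, ?_⟩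
    simp
  choose g' hg' using fun p => hr (g p) (hg p)
  have : aeval g P = MvPolynomial.map O.subtype (aeval g' P) := by
    rw [map_aeval]
    simp only [aeval_def, hg']
    rw [coe_eval₂Hom]
    congr 1
    exact RingHom.ext_int _ _
  rw [this, coeff_map]
  exact (coeff e (aeval g' P)).2

lemma mon_exp {τ : Type*} [Fintype τ] (r : τ → ℝ) (e : τ →₀ ℕ) :
    mon (fun p => Real.exp (r p)) e = Real.exp (∑ p, e p * r p) := by
  rw [mon, Finsupp.prod_fintype _ _ (by simp), Real.exp_sum]
  exact Finset.prod_congr rfl fun p _ => by rw [Real.exp_nat_mul]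

theorem vanish (D : PD K ι) (hD : ∀ v, 0 < D.m v) (l : ι → Option (Fin n)) (c : ι → Fin n → ℝ)
    (i0 : Fin n) (ω d : Fin m → ℕ) (N : ℕ) (hN : ∀ h, ω h * d h = N) (hd : ∀ h, 0 < d h)
    (w : Fin m → Fin k → Fin n → K) (hw : ∀ h j i, w h j i ∈ D.O)
    (hb : ∀ v h j i, D.a v (gst (l v) (w h j) i) ^ D.m v ≤ Real.exp (ω h * c v i))
    (η θ : ℝ) (P : MvPolynomial (Fin m × Fin n) ℤ) (hP : IsWeightedHomogeneous (wt m n) P d)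
    (hg : ∀ l, ∀ e, coeff e (aeval (gs l) P) ≠ 0 → good d η (cu e))
    (hnP : nrm iabs (fun _ => 1) P ≤ 2 ^ ((2 * n + 1) * ∑ h, d h))
    (A : ℝ) (hA : ∀ v i, |c v i| ≤ A)
    (hneg : (∑ v, (D.m v : ℝ)) * (A * θ * N + (∑ h, d h : ℕ) * ((2*n+2) * Real.log 2 + Real.log (k+1)))
      + N * m * ((∑ v, ∑ i, c v i) / n + η * ∑ v, ∑ i, |c v i|) < 0)
    (E : Fin m × Fin k ⊕ Fin m →₀ ℕ) (hE : (∑ h, ω h * E (Sum.inr h) : ℕ) < θ * N) :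
    coeff E (aeval (Psi i0 w) P) = 0 := by
  by_contra hβ
  set β := coeff E (aeval (Psi i0 w) P) with hβd
  have hβO : β ∈ D.O := by
    refine coeff_mem_O D.O _ (fun p e => ?_) P E
    simp only [Psi, coeff_add, coeff_sum, coeff_C_mul, coeff_X']
    refine D.O.add_mem (D.O.sum_mem fun j _ => D.O.mul_mem (hw _ _ _) ?_) ?_
    · split_ifs; exacts [D.O.one_mem, D.O.zero_mem]
    · split_ifs
      · rw [coeff_X']; split_ifs; exacts [D.O.one_mem, D.O.zero_mem]
      · simp [D.O.zero_mem]
  have hpf := D.pf β hβO hβ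
  have hv : ∀ v, D.a v β ^ D.m v ≤ Real.exp (D.m v * (A * θ * N + (∑ h, d h : ℕ) *
      ((2*n+2) * Real.log 2 + Real.log (k+1))) + N * m * ((∑ i, c v i) / n + η * ∑ i, |c v i|)) := by
    intro v
    have hmv : (0:ℝ) < D.m v := by exact_mod_cast hD v
    have hmv1 : (1:ℝ) ≤ D.m v := by exact_mod_cast hD v
    have hA0 : n ≠ 0 := by rintro rfl; exact i0.elim0
    have hAn : 0 ≤ A := (abs_nonneg _).trans (hA v i0)
    set S : Fin m → ℝ := fun h => Real.exp (-A * ω h)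
    set R : Fin m × Fin n → ℝ := fun p => Real.exp (Real.log (k+1) + ω p.1 * c v p.2 / D.m v)
    have hRk : ∀ p, R p = (k+1) * Real.exp (ω p.1 * c v p.2 / D.m v) := by
      intro p; simp only [R]; rw [Real.exp_add, Real.exp_log (by positivity)]
    have h1 : nrm (D.a v) (Sum.elim (fun _ => 1) S) (aeval (Psi i0 w) P) ≤
        nrm iabs R (aeval (gs (l v)) P) := by
      have : aeval (Psi i0 w) P = aeval (fun p => aeval (Psi i0 w) (gs (l v) p)) (aeval (gs (l v)) P) := by
        conv_lhs => rw [← gs_invol (l v) P]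
        generalize aeval (gs (l v)) P = Q
        rw [← AlgHom.comp_apply]
        refine congrArg (fun φ : MvPolynomial (Fin m × Fin n) ℤ →ₐ[ℤ] _ => φ Q) ?_
        ext1 p; simp
      rw [this]
      refine nrm_aeval_le (D.a v).map_one ?_ _ (fun p => ?_) _
      · rintro (x | x)
        · simp
        · exact (Real.exp_pos _).le
      · rw [hRk]
        refine nrm_Psi (D.a v) i0 w (l v) p S (fun h => (Real.exp_pos _).le) _ (fun j => ?_) ?_
        · refine le_of_pow_le_pow_left₀ (hD v).ne' (Real.exp_pos _).le ?_
          refine (hb v p.1 j p.2).trans_eq ?_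
          rw [← Real.exp_nat_mul]; congr 1; field_simp
        · simp only [S]
          apply Real.exp_le_exp.2
          rw [mul_div_assoc]
          have h2 : -A ≤ c v p.2 / D.m v := by
            rw [le_div_iff₀ hmv]
            have := hA v p.2
            have := neg_abs_le (c v p.2)
            nlinarith
          have : (0:ℝ) ≤ ω p.1 := by positivity
          nlinarith
    have h2 := coeff_le_nrm (a := D.a v) (w := Sum.elim (fun _ => 1) S) (by
      rintro (x | x)
      · simp
      · exact (Real.exp_pos _).le) (aeval (Psi i0 w) P) E
    rw [← hβd] at h2
    have h3 : Real.exp (-(A * θ * N)) ≤ mon (Sum.elim (fun _ => 1) S) E := by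
      have : (Sum.elim (fun _ => 1) S : Fin m × Fin k ⊕ Fin m → ℝ) =
          fun x => Real.exp (Sum.elim (fun _ => 0) (fun h => -A * ω h) x) := by
        funext x; rcases x with x | x <;> simp [S]
      rw [this, mon_exp, Fintype.sum_sum_type]
      apply Real.exp_le_exp.2
      simp only [Sum.elim_inl, mul_zero, Finset.sum_const_zero, zero_add, Sum.elim_inr]
      have : ∑ h, (E (Sum.inr h) : ℝ) * (-A * ω h) = -A * (∑ h, ω h * E (Sum.inr h) : ℕ) := by
        push_cast; rw [Finset.mul_sum]; exact Finset.sum_congr rfl fun h _ => by ring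
      rw [this]
      nlinarith
    set B := (∑ h, d h : ℕ) * Real.log (k+1) + N * m * ((∑ i, c v i) / n + η * ∑ i, |c v i|) / D.m v with hB
    have h4 : nrm iabs R (aeval (gs (l v)) P) ≤ Real.exp B * nrm iabs (fun _ => 1) (aeval (gs (l v)) P) := by
      rw [nrm, nrm, Finset.mul_sum]
      refine Finset.sum_le_sum fun e he => ?_
      rw [mem_support_iff] at he
      have hgo := hg (l v) e he
      have hwe := aeval_gs_hom (l v) hP he
      rw [mon_one, mul_one, mul_comm]
      refine mul_le_mul_of_nonneg_right ?_ (iabs.nonneg _)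
      rw [mon_exp]
      apply Real.exp_le_exp.2
      have e1 : ∑ p, (e p : ℝ) * (Real.log (k+1) + ω p.1 * c v p.2 / D.m v) =
          (∑ h, d h : ℕ) * Real.log (k+1) + (∑ i, c v i * ∑ h, ω h * (e (h, i) : ℝ)) / D.m v := by
        simp only [mul_add, Finset.sum_add_distrib, ← Finset.sum_mul]
        congr 1
        · congr 1
          rw [← hwe, Fintype.sum_prod_type]
          simp only [weight_wt]; push_cast; rfl
        · rw [Fintype.sum_prod_type, Finset.sum_comm, Finset.sum_div]
          refine Finset.sum_congr rfl fun i _ => ?_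
          rw [Finset.mul_sum, Finset.sum_div]
          exact Finset.sum_congr rfl fun h _ => by ring
      rw [e1, hB]
      have e2 : ∀ i, ∑ h, ω h * (e (h, i) : ℝ) = N * ∑ h, ((cu e h i : ℝ) / d h - 1 / n) + N * m / n := by
        intro i
        rw [Finset.sum_sub_distrib, Finset.sum_const, Finset.card_univ, Fintype.card_fin, nsmul_eq_mul,
          mul_sub, Finset.mul_sum]
        have : ∀ h, (N:ℝ) * ((cu e h i : ℝ) / d h) = ω h * (e (h,i) : ℝ) := by
          intro h
          have : (0:ℝ) < d h := by exact_mod_cast hd h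
          rw [← hN h]; push_cast; simp only [cu]; field_simp
        simp only [this]; ring
      have e3 : ∑ i, c v i * ∑ h, ω h * (e (h, i) : ℝ) ≤ N * m * ((∑ i, c v i) / n + η * ∑ i, |c v i|) := by
        have : N * m * ((∑ i, c v i) / n + η * ∑ i, |c v i|) =
            ∑ i, (N * m * c v i / n + N * (m * η * |c v i|)) := by
          rw [Finset.sum_add_distrib, ← Finset.sum_div, ← Finset.mul_sum, ← Finset.mul_sum,
            ← Finset.mul_sum]; ring
        rw [this]
        refine Finset.sum_le_sum fun i _ => ?_
        rw [e2]
        have h5 := hgo i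
        set x := ∑ h, ((cu e h i : ℝ) / d h - 1 / n)
        have h6 : c v i * x ≤ |c v i| * (η * m) := by
          refine (le_abs_self _).trans ?_
          rw [abs_mul]; exact mul_le_mul_of_nonneg_left h5 (abs_nonneg _)
        have hN0 : (0:ℝ) ≤ N := by positivity
        have : c v i * (N * x + N * m / n) = N * (c v i * x) + N * m * c v i / n := by ring
        rw [this]
        nlinarith
      have e4 := div_le_div_of_nonneg_right e3 hmv.le
      linarith
    have h5 : nrm iabs (fun _ => 1) (aeval (gs (l v)) P) ≤
        Real.exp ((∑ h, d h : ℕ) * ((2*n+2) * Real.log 2)) := by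
      refine (nrm_aeval_gs (l v) hP).trans ?_
      refine (mul_le_mul_of_nonneg_left hnP (by positivity)).trans_eq ?_
      rw [← pow_add, ← Real.exp_log (show (0:ℝ) < 2 ^ _ by positivity), Real.log_pow]
      congr 1; push_cast; ring
    have h6 : D.a v β * Real.exp (-(A * θ * N)) ≤
        Real.exp B * Real.exp ((∑ h, d h : ℕ) * ((2*n+2) * Real.log 2)) := by
      refine (mul_le_mul_of_nonneg_left h3 ((D.a v).nonneg _)).trans (h2.trans (h1.trans (h4.trans ?_)))
      exact mul_le_mul_of_nonneg_left h5 (Real.exp_pos _).le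
    have h7 : D.a v β ≤ Real.exp (B + (∑ h, d h : ℕ) * ((2*n+2) * Real.log 2) + A * θ * N) := by
      rw [Real.exp_add, Real.exp_add]
      rw [Real.exp_neg, ← div_eq_mul_inv, div_le_iff₀ (Real.exp_pos _)] at h6
      exact h6
    refine (pow_le_pow_left₀ ((D.a v).nonneg _) h7 _).trans_eq ?_
    rw [← Real.exp_nat_mul, hB]
    congr 1
    field_simp; ring
  have h8 := Finset.prod_le_prod (s := Finset.univ) (fun v _ => pow_nonneg ((D.a v).nonneg β) (D.m v))
    (fun v _ => hv v)
  rw [← Real.exp_sum] at h8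
  have h9 := Real.one_le_exp_iff.1 (hpf.trans h8)
  rw [Finset.sum_add_distrib, ← Finset.sum_mul, ← Finset.mul_sum, Finset.sum_add_distrib,
    ← Finset.mul_sum, ← Finset.sum_div] at h9
  linarith
end E1
end SU

open MvPolynomial
namespace SU
section E3
variable {m n k : ℕ} {K ι : Type*} [Field K] [Fintype ι]

/-- dehomogenisation -/
noncomputable def dh (i1 : Fin n) (p : Fin m × Fin n) : MvPolynomial (Fin m × Fin n) ℤ :=
  if p.2 = i1 then 1 else X p

lemma dh_eq (i1 : Fin n) (P : MvPolynomial (Fin m × Fin n) ℤ) :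
    aeval (dh i1) P = ∑ u ∈ P.support, monomial (u.filter fun p => p.2 ≠ i1) (coeff u P) := by
  conv_lhs => rw [P.as_sum, map_sum]
  refine Finset.sum_congr rfl fun u _ => ?_
  rw [aeval_monomial, algebraMap_eq, monomial_eq, Finsupp.prod_filter_index]
  congr 1
  rw [Finsupp.prod, ← Finset.prod_filter_mul_prod_filter_not u.support (fun p => p.2 ≠ i1)]
  have e1 : ∏ p ∈ u.support with ¬ p.2 ≠ i1, dh i1 p ^ u p = 1 := by
    refine Finset.prod_eq_one fun p hp => ?_
    simp only [Finset.mem_filter, not_not] at hp; simp [dh, hp.2]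
  rw [e1, mul_one, Finsupp.support_filter]
  refine Finset.prod_congr rfl fun p hp => ?_
  simp only [Finset.mem_filter] at hp; simp [dh, hp.2]

lemma filter_inj (i1 : Fin n) {d : Fin m → ℕ} {u e : Fin m × Fin n →₀ ℕ}
    (hu : Finsupp.weight (wt m n) u = d) (he : Finsupp.weight (wt m n) e = d)
    (h : (u.filter fun p => p.2 ≠ i1) = e.filter fun p => p.2 ≠ i1) : u = e := by
  have h1 : ∀ h' i, i ≠ i1 → u (h', i) = e (h', i) := by
    intro h' i hi
    have := DFunLike.congr_fun h (h', i)
    simpa [Finsupp.filter_apply, hi] using this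
  ext ⟨h', i⟩
  by_cases hi : i = i1
  · subst hi
    have h2 := congrFun (hu.trans he.symm) h'
    rw [weight_wt, weight_wt, ← Finset.add_sum_erase _ _ (Finset.mem_univ i),
      ← Finset.add_sum_erase _ _ (Finset.mem_univ i), Finset.sum_congr rfl fun j hj =>
      h1 h' j (Finset.ne_of_mem_erase hj)] at h2
    omega
  · exact h1 h' i hi

lemma dh_ne_zero (i1 : Fin n) {d : Fin m → ℕ} {P : MvPolynomial (Fin m × Fin n) ℤ} (hP : P ≠ 0)
    (hh : IsWeightedHomogeneous (wt m n) P d) : aeval (dh i1) P ≠ 0 := by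
  obtain ⟨e, he⟩ := support_nonempty.2 hP
  intro h0
  have := congrArg (coeff (e.filter fun p => p.2 ≠ i1)) h0
  rw [dh_eq, coeff_sum, Finset.sum_eq_single e] at this
  · rw [coeff_monomial, if_pos rfl, coeff_zero] at this
    exact (mem_support_iff.1 he) this
  · intro u hu hne
    rw [coeff_monomial, if_neg]
    exact fun h => hne (filter_inj i1 (hh (mem_support_iff.1 hu)) (hh (mem_support_iff.1 he)) h)
  · intro h; exact absurd he h

lemma dh_degree (i1 : Fin n) {d : Fin m → ℕ} {P : MvPolynomial (Fin m × Fin n) ℤ}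
    (hh : IsWeightedHomogeneous (wt m n) P d) (h : Fin m) (i : Fin n) :
    degreeOf (h, i) (aeval (dh i1) P) ≤ d h := by
  rw [degreeOf_le_iff]
  intro e he
  rw [mem_support_iff, dh_eq, coeff_sum] at he
  obtain ⟨u, hu, hc⟩ := Finset.exists_ne_zero_of_sum_ne_zero he
  rw [coeff_monomial] at hc
  have h1 : (u.filter fun p => p.2 ≠ i1) = e := by by_contra h'; simp [h'] at hc
  rw [← h1, ← hh (mem_support_iff.1 hu), weight_wt]
  have h2 : (u.filter fun p => p.2 ≠ i1) (h, i) ≤ u (h, i) := by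
    rw [Finsupp.filter_apply]; split_ifs <;> simp
  exact h2.trans (Finset.single_le_sum (f := fun i => u (h,i)) (fun _ _ => Nat.zero_le _) (Finset.mem_univ i))

lemma dh_nrm (i1 : Fin n) (P : MvPolynomial (Fin m × Fin n) ℤ) :
    nrm iabs (fun _ => 1) (aeval (dh i1) P) ≤ nrm iabs (fun _ => 1) P := by
  refine nrm_aeval_le iabs_one (by simp) _ (fun p => ?_) P
  unfold dh
  split_ifs
  · rw [← C_1, nrm_C, iabs_one]
  · rw [nrm_X _ iabs_one]

lemma chi_dvd {τ : Type*} [Fintype τ] {κ σ : Type*} (ω : τ → ℕ) (t : ℕ) (G : MvPolynomial (κ ⊕ τ) K)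
    (hG : ∀ E, ∑ h, ω h * E (Sum.inr h) < t → coeff E G = 0)
    (yl : κ → MvPolynomial σ K) (xl : τ → MvPolynomial σ K) :
    (Polynomial.X : Polynomial (MvPolynomial σ K)) ^ t ∣ aeval (Sum.elim (fun q => Polynomial.C (yl q))
      (fun h => Polynomial.C (xl h) * Polynomial.X ^ ω h)) G := by
  classical
  conv_rhs => rw [G.as_sum, map_sum]
  refine Finset.dvd_sum fun E hE => ?_
  have h1 : t ≤ ∑ h, ω h * E (Sum.inr h) := by
    by_contra h; exact (mem_support_iff.1 hE) (hG E (not_le.1 h))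
  rw [aeval_monomial]
  refine Dvd.dvd.mul_left ((pow_dvd_pow _ h1).trans ?_) _
  rw [Finsupp.prod, ← Finset.prod_pow_eq_pow_sum]
  let s : Finset (κ ⊕ τ) := (Finset.univ.filter fun h => E (Sum.inr h) ≠ 0).map ⟨Sum.inr, Sum.inr_injective⟩
  have h2 : s ⊆ E.support := by
    intro x hx
    obtain ⟨h, hh, rfl⟩ := Finset.mem_map.1 hx
    simpa using hh
  refine Dvd.dvd.trans ?_ (Finset.prod_dvd_prod_of_subset _ _ _ h2)
  simp only [s, Finset.prod_map, Function.Embedding.coeFn_mk, Sum.elim_inr]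
  rw [← Finset.prod_filter_mul_prod_filter_not Finset.univ (fun h => E (Sum.inr h) ≠ 0),
    Finset.prod_eq_one (s := Finset.filter (fun h => ¬ E (Sum.inr h) ≠ 0) _), mul_one]
  · refine Finset.prod_dvd_prod_of_dvd _ _ fun h _ => ?_
    rw [pow_mul]
    exact pow_dvd_pow_of_dvd (Dvd.intro_left _ rfl) _
  · intro h hh; simp only [Finset.mem_filter, not_not] at hh; simp [hh.2]

theorem index_dvd (ω : Fin m → ℕ) (t : ℕ) (w : Fin m → Fin k → Fin n → K) (y : Fin m → Fin n → K)
    (i0 : Fin n) (hy : ∀ h, y h i0 ≠ 0)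
    (hspan : ∀ h (u : Fin n → K), ∑ i, u i * y h i = 0 → ∃ lam : Fin k → K, ∀ i, u i = ∑ j, lam j * w h j i)
    (P : MvPolynomial (Fin m × Fin n) ℤ)
    (hG : ∀ E, ∑ h, ω h * E (Sum.inr h) < t → coeff E (aeval (Psi i0 w) P) = 0) :
    Polynomial.X ^ t ∣ Phi (Finset.univ.image fun h => (h, i0)) (fun p => ω p.1)
      (fun p => ∑ i ∈ Finset.univ.erase i0, C (-(y p.1 i / y p.1 i0)) * X (p.1, i)) P := by
  have h1 : ∀ h i', i' ≠ i0 → ∃ lam : Fin k → K, ∀ i, (Pi.single i' 1 - Pi.single i0 (y h i' / y h i0) : Fin n → K) i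
      = ∑ j, lam j * w h j i := by
    intro h i' hi
    apply hspan
    simp only [Pi.sub_apply, sub_mul, Finset.sum_sub_distrib, Pi.single_apply, ite_mul, zero_mul,
      Finset.sum_ite_eq', Finset.mem_univ, if_true, one_mul]
    field_simp [hy h]; ring
  have h1' : ∀ h i', ∃ lam : Fin k → K, i' ≠ i0 → ∀ i, (Pi.single i' 1 - Pi.single i0 (y h i' / y h i0) : Fin n → K) i
      = ∑ j, lam j * w h j i := by
    intro h i'
    by_cases hi : i' = i0
    · exact ⟨0, fun h => absurd hi h⟩
    · obtain ⟨lam, hl⟩ := h1 h i' hi; exact ⟨lam, fun _ => hl⟩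
  choose lam hlam using h1'
  have h2 := chi_dvd ω t _ hG (fun q : Fin m × Fin k => ∑ i' ∈ Finset.univ.erase i0, C (lam q.1 i' q.2) * X (q.1, i'))
    (fun h => (X (h, i0) : MvPolynomial (Fin m × Fin n) K))
  convert h2 using 1
  set χ : MvPolynomial (Fin m × Fin k ⊕ Fin m) K →ₐ[K] Polynomial (MvPolynomial (Fin m × Fin n) K) := aeval _
  suffices h : Phi (Finset.univ.image fun h => (h, i0)) (fun p => ω p.1)
      (fun p => ∑ i ∈ Finset.univ.erase i0, C (-(y p.1 i / y p.1 i0)) * X (p.1, i)) =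
      (χ.restrictScalars ℤ).comp (aeval (Psi i0 w)) from congrArg (fun φ => φ P) h
  ext1 ⟨h, i⟩
  have key : ∑ j, C (w h j i) * ∑ i' ∈ Finset.univ.erase i0, C (lam h i' j) * X (h, i') =
      if i = i0 then ∑ i ∈ Finset.univ.erase i0, C (-(y h i / y h i0)) * X (h, i)
      else (X (h, i) : MvPolynomial (Fin m × Fin n) K) := by
    have : ∑ j, C (w h j i) * ∑ i' ∈ Finset.univ.erase i0, C (lam h i' j) * X (h, i') =
        ∑ i' ∈ Finset.univ.erase i0, C ((Pi.single i' 1 - Pi.single i0 (y h i' / y h i0) : Fin n → K) i) *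
          (X (h, i') : MvPolynomial (Fin m × Fin n) K) := by
      simp only [Finset.mul_sum]
      rw [Finset.sum_comm]
      refine Finset.sum_congr rfl fun i' hi' => ?_
      rw [hlam h i' (Finset.ne_of_mem_erase hi') i, map_sum, Finset.sum_mul]
      refine Finset.sum_congr rfl fun j _ => ?_
      rw [C_mul]; ring
    rw [this]
    split_ifs with hi
    · subst hi
      refine Finset.sum_congr rfl fun i' hi' => ?_
      have := Finset.ne_of_mem_erase hi'
      simp [Pi.single_apply, this.symm]
    · rw [Finset.sum_eq_single i]
      · simp [Pi.single_apply, hi]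
      · intro i' _ hne; simp [Pi.single_apply, hi, hne.symm]
      · intro h; simp [hi] at h
  have hχC : ∀ a : K, χ (C a) = Polynomial.C (C a) := fun a => χ.commutes a
  rw [AlgHom.comp_apply, aeval_X, AlgHom.restrictScalars_apply]
  simp only [Psi, map_add, map_sum, map_mul, hχC]
  simp only [χ, aeval_X, Sum.elim_inl]
  rw [Finset.sum_congr rfl fun j _ => (Polynomial.C_mul (a := C (w h j i))).symm, ← map_sum, key]
  by_cases hi : i = i0
  · subst hi
    simp [Phi]; ring
  · have : (h, i) ∉ Finset.univ.image fun h : Fin m => (h, i0) := by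
      simp [Ne.symm hi]
    simp [Phi, hi, Ne.symm hi]

theorem final_E [CharZero K] (D : PD K ι) (hD : ∀ v, 0 < D.m v) (l : ι → Option (Fin n)) (c : ι → Fin n → ℝ)
    (hc : ∑ v, ∑ i, c v i < 0) (ε : ℝ) (hε : 0 < ε) (i0 i1 : Fin n) (hi : i0 ≠ i1) (k : ℕ) :
    ∃ m : ℕ, ∃ ρ > (0:ℝ), ∃ Ω : ℝ, ∀ (ω : Fin m → ℕ) (w : Fin m → Fin k → Fin n → K) (y : Fin m → Fin n → K),
      (∀ h, Ω ≤ ω h) → (∀ h h', h ≠ h' → (ω h : ℝ) ≤ ρ * ω h' ∨ (ω h' : ℝ) ≤ ρ * ω h) →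
      (∀ h j i, w h j i ∈ D.O) →
      (∀ v h j i, D.a v (gst (l v) (w h j) i) ^ D.m v ≤ Real.exp (ω h * c v i)) →
      (∀ h, y h i0 ≠ 0) →
      (∀ h (u : Fin n → K), ∑ i, u i * y h i = 0 → ∃ lam : Fin k → K, ∀ i, u i = ∑ j, lam j * w h j i) →
      (∀ h, ε * ω h ≤ Real.log (D.H (-(y h i1 / y h i0)))) → False := by
  classical
  have hn : 0 < n := i0.pos
  have hnr : (0:ℝ) < n := by exact_mod_cast hn
  set sg := -∑ v, ∑ i, c v i with hsg
  have hsg0 : 0 < sg := by linarith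
  set A := ∑ v, ∑ i, |c v i| with hAd
  have hAc : ∀ v i, |c v i| ≤ A := fun v i =>
    (Finset.single_le_sum (f := fun i => |c v i|) (fun _ _ => abs_nonneg _) (Finset.mem_univ i)).trans
    (Finset.single_le_sum (f := fun v => ∑ i, |c v i|) (fun _ _ => Finset.sum_nonneg fun _ _ => abs_nonneg _)
      (Finset.mem_univ v))
  have hAsg : sg ≤ A := by
    rw [hsg, hAd, ← Finset.sum_neg_distrib]
    refine Finset.sum_le_sum fun v _ => ?_
    rw [← Finset.sum_neg_distrib]
    exact Finset.sum_le_sum fun i _ => neg_le_abs _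
  have hA0 : 0 < A := by linarith
  set η := sg / (4 * n * A) with hη
  have hη0 : 0 < η := by positivity
  obtain ⟨m, hm⟩ := exists_nat_ge (max 1 (2 * n * (n + 1) / η^2))
  have hm1 : (1:ℝ) ≤ m := (le_max_left _ _).trans hm
  have hm0 : 0 < m := by
    rcases Nat.eq_zero_or_pos m with h | h
    · subst h; norm_num at hm1
    · exact h
  set Mt := ∑ v, (D.m v : ℝ) with hMt
  have hMt0 : 0 ≤ Mt := by positivity
  set θ := m * sg / (4 * n * A * (Mt + 1)) with hθ
  have hθ0 : 0 < θ := by positivity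
  obtain ⟨ρ, hρ, η', hη', Ω', hΩ', hroth⟩ := roth D (σ := Fin m × Fin n) m θ hθ0 ε hε
  set L := (2*n+2) * Real.log 2 + Real.log (k+1) with hL
  have hl2 : 0 < Real.log 2 := Real.log_pos (by norm_num)
  have hL0 : 0 ≤ L := by
    have : 0 ≤ Real.log ((k:ℝ)+1) := Real.log_nonneg (by linarith [(Nat.cast_nonneg k : (0:ℝ) ≤ k)])
    positivity
  set Ω := max Ω' (max (4 * n * Mt * L / sg) ((2*n+1) * Real.log 2 * m / η')) with hΩ
  refine ⟨m, ρ, hρ, Ω, ?_⟩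
  intro ω w y hω hgap hwO hb hy hspan hH
  have hΩ1 : 1 ≤ Ω := hΩ'.trans (le_max_left _ _)
  have hω0 : ∀ h, 0 < ω h := by
    intro h
    have : (1:ℝ) ≤ ω h := hΩ1.trans (hω h)
    exact_mod_cast this
  set N := ∏ h, ω h with hN
  have hN0 : 0 < N := Finset.prod_pos fun h _ => hω0 h
  have hNr : (0:ℝ) < N := by exact_mod_cast hN0
  set d : Fin m → ℕ := fun h => ∏ h' ∈ Finset.univ.erase h, ω h' with hd
  have hNd : ∀ h, ω h * d h = N := fun h => Finset.mul_prod_erase _ _ (Finset.mem_univ h)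
  have hd0 : ∀ h, 0 < d h := fun h => Finset.prod_pos fun h _ => hω0 h
  have hdS : ((∑ h, d h : ℕ) : ℝ) * Ω ≤ N * m := by
    push_cast
    rw [Finset.sum_mul]
    refine (Finset.sum_le_card_nsmul _ _ (N:ℝ) fun h _ => ?_).trans_eq ?_
    · rw [← hNd h]; push_cast; rw [mul_comm]
      exact mul_le_mul_of_nonneg_right (hω h) (by positivity)
    · simp [mul_comm]
  set Sd' := ((∑ h, d h : ℕ) : ℝ) with hSd
  have hSd0 : 0 ≤ Sd' := by positivity
  obtain ⟨P, hP0, hP, hg, hnP⟩ := aux_poly hn d hd0 η hη0 ((le_max_right _ _).trans hm) hm0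
  have hneg : Mt * (A * θ * N + Sd' * L)
      + N * m * ((∑ v, ∑ i, c v i) / n + η * A) < 0 := by
    have e1 : Mt * (A * θ * N) ≤ N * m * sg / (4 * n) := by
      have : Mt * (A * θ * N) = N * m * sg / (4 * n) * (Mt / (Mt + 1)) := by
        rw [hθ]; field_simp
      rw [this]
      exact mul_le_of_le_one_right (by positivity) (by rw [div_le_one (by positivity)]; linarith)
    have e2 : Mt * (Sd' * L) ≤ N * m * sg / (4 * n) := by
      have h1 : 4 * n * Mt * L / sg ≤ Ω := (le_max_left _ _).trans (le_max_right _ _)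
      have h2 : Sd' * (4 * n * Mt * L / sg) ≤ N * m :=
        (mul_le_mul_of_nonneg_left h1 hSd0).trans hdS
      have h3 : Mt * (Sd' * L) = Sd' * (4 * n * Mt * L / sg) * (sg / (4 * n)) := by field_simp
      rw [h3, mul_div_assoc (N * m : ℝ)]
      exact mul_le_mul_of_nonneg_right h2 (div_nonneg hsg0.le (by linarith))
    have e3 : N * m * ((∑ v, ∑ i, c v i) / n + η * A) = - (3 * (N * m * sg / (4 * n))) := by
      have : ∑ v, ∑ i, c v i = -sg := by rw [hsg]; ring
      rw [this, hη]; field_simp; ring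
    have hmr : (0:ℝ) < m := by linarith
    have e4 : 0 < N * m * sg / (4 * n) := div_pos (mul_pos (mul_pos hNr hmr) hsg0) (by linarith)
    rw [e3, mul_add]; linarith
  set t := ⌈θ * N⌉₊ with ht
  have hvan := vanish D hD l c i0 ω d N hNd hd0 w hwO hb η θ P hP hg hnP A hAc hneg
  have hdvd := index_dvd ω t w y i0 hy hspan P fun E hE => hvan E (Nat.lt_ceil.1 hE)
  set xs : Finset (Fin m × Fin n) := Finset.univ.image fun h => (h, i0) with hxs
  have hmem : ∀ p : Fin m × Fin n, p ∈ xs ↔ p.2 = i0 := by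
    intro ⟨h, i⟩; simp [hxs, eq_comm]
  set b : Fin m × Fin n → MvPolynomial (Fin m × Fin n) K :=
    fun p => ∑ i ∈ Finset.univ.erase i0, C (-(y p.1 i / y p.1 i0)) * X (p.1, i) with hbd
  let ψ : MvPolynomial (Fin m × Fin n) K →ₐ[K] MvPolynomial (Fin m × Fin n) K :=
    aeval fun p => if p.2 = i1 then 1 else X p
  have hdvd2 := Polynomial.map_dvd (ψ : MvPolynomial (Fin m × Fin n) K →+* MvPolynomial (Fin m × Fin n) K) hdvd
  rw [Polynomial.map_pow, Polynomial.map_X, map_Phi xs (fun p => ω p.1) b ψ (dh i1)] at hdvd2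
  rotate_left
  · intro p hp; rw [hmem] at hp; simp [ψ, hp, hi]
  · intro p hp; rw [hmem] at hp; simp [dh, hp, hi]
  · intro p hp
    by_cases h : p.2 = i1
    · simp [dh, h, ψ]
    · simp [dh, h, ψ, Phi, hp]
  have hZ : Disjoint (Finset.univ.filter fun p : Fin m × Fin n => p.2 ≠ i0) xs := by
    rw [Finset.disjoint_left]; intro p hp hp'; rw [hmem] at hp'; simp [hp'] at hp
  obtain ⟨p, hp0, hpd, hpdl, hpn, hpdiv⟩ := elim_vars xs (fun p => ω p.1) t _ hZ _ _
    (dh_ne_zero i1 hP0 hP) hdvd2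
  have hkill : ∀ x : Fin m × Fin n, kill (Finset.univ.filter fun p : Fin m × Fin n => p.2 ≠ i0) (ψ (b x))
      = C (-(y x.1 i1 / y x.1 i0)) := by
    intro x
    simp only [hbd, map_sum, map_mul]
    rw [Finset.sum_eq_single i1]
    · simp only [ψ, aeval_X, if_pos, map_one, mul_one, algHom_C, algebraMap_eq]
    · intro i hii hne
      have := Finset.ne_of_mem_erase hii
      simp [ψ, hne, kill, this]
    · intro h; simp [Ne.symm hi] at h
  simp only [hkill] at hpdiv
  have hpd' : ∀ z ∉ xs, degreeOf z p = 0 := by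
    intro z hz; rw [hmem] at hz; exact hpd z (by simp [hz])
  refine hroth xs ?_ (fun p => ω p.1) (fun x => -(y x.1 i1 / y x.1 i0)) p N t ?_ ?_ ?_ hp0 hpd' ?_ hNr ?_ ?_
    (Phi_ind hpd' hpdiv)
  · rw [hxs, Finset.card_image_of_injective _ (fun a b h => (Prod.mk.inj h).1)]; simp
  · intro x _; exact (le_max_left _ _).trans (hω x.1)
  · intro x hx x' hx' hne
    apply hgap
    intro h
    rw [hmem] at hx hx'
    exact hne (Prod.ext h (hx.trans hx'.symm))
  · intro x _; exact hH x.1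
  · intro x _
    have h1 : degreeOf x p ≤ d x.1 := (hpdl x).trans (dh_degree i1 hP x.1 x.2)
    have : degreeOf x p * ω x.1 ≤ N := by
      rw [← hNd x.1, mul_comm]; exact Nat.mul_le_mul_left _ h1
    exact_mod_cast this
  · have h1 : nrm iabs (fun _ => 1) p ≤ 2 ^ ((2 * n + 1) * ∑ h, d h) := hpn.trans ((dh_nrm i1 P).trans hnP)
    have h2 := Real.log_le_log (lt_of_lt_of_le one_pos (one_le_nrm p hp0)) h1
    rw [Real.log_pow] at h2
    refine h2.trans ?_
    have h3 : (2*n+1) * Real.log 2 * m / η' ≤ Ω := (le_max_right _ _).trans (le_max_right _ _)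
    have h4 : Sd' * ((2*n+1) * Real.log 2 * m / η') ≤ N * m := (mul_le_mul_of_nonneg_left h3 hSd0).trans hdS
    have hmr : (0:ℝ) < m := by linarith
    have h5 : (((2 * n + 1) * ∑ h, d h : ℕ) : ℝ) * Real.log 2 =
        Sd' * ((2*n+1) * Real.log 2 * m / η') * (η' / m) := by
      rw [hSd]; push_cast; field_simp
    rw [h5]
    refine (mul_le_mul_of_nonneg_right h4 (by positivity)).trans_eq ?_
    field_simp
  · exact Nat.le_ceil _
end E3
end SU

open MvPolynomial
namespace SU
section C1
variable {F : Type*} [Field F] {n : ℕ}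

def GM (l : Option (Fin n)) : Matrix (Fin n) (Fin n) F := Matrix.of fun i k =>
  match l with
  | none => if i = k then 1 else 0
  | some l => if i = l then -1 else if i = k then 1 else 0

def gact {F : Type*} [Ring F] (l : Option (Fin n)) (u : Fin n → F) (i : Fin n) : F :=
  match l with
  | none => u i
  | some l => if i = l then - ∑ k, u k else u i

lemma GM_mulVec (l : Option (Fin n)) (u : Fin n → F) : Matrix.mulVec (GM l) u = gact l u := by
  ext i
  cases l with
  | none => simp [Matrix.mulVec, dotProduct, GM, gact]
  | some l =>
    by_cases h : i = l
    · subst h; simp [Matrix.mulVec, dotProduct, GM, gact]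
    · simp [Matrix.mulVec, dotProduct, GM, gact, h]

lemma GM_vecMul (l : Option (Fin n)) (u : Fin n → F) : Matrix.vecMul u (GM l) = gst l u := by
  ext i
  cases l with
  | none => simp [Matrix.vecMul, dotProduct, GM, gst]
  | some l =>
    have : ∀ k, u k * (if k = l then (-1:F) else if k = i then 1 else 0) =
        (if k = l then - u k else 0) + (if k = i then (if i = l then 0 else u k) else 0) := by
      intro k; split_ifs <;> simp_all
    simp only [Matrix.vecMul, dotProduct, GM, Matrix.of_apply, this, Finset.sum_add_distrib,
      Finset.sum_ite_eq', Finset.mem_univ, if_true, gst]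
    split_ifs <;> ring

lemma gact_gact (l : Option (Fin n)) (u : Fin n → F) : gact l (gact l u) = u := by
  ext i
  cases l with
  | none => rfl
  | some l =>
    simp only [gact]
    split_ifs with h
    · have : ∀ k, (if k = l then - ∑ j, u j else u k) =
          u k + (if k = l then - (∑ j, u j) - u k else 0) := by intro k; split_ifs <;> ring
      simp only [this, Finset.sum_add_distrib, Finset.sum_ite_eq', Finset.mem_univ, if_true, h]; ring
    · rfl

lemma gact_add (l : Option (Fin n)) (u v : Fin n → F) : gact l (u + v) = gact l u + gact l v := by
  rw [← GM_mulVec, Matrix.mulVec_add, GM_mulVec, GM_mulVec]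
lemma gact_smul (l : Option (Fin n)) (c : F) (u : Fin n → F) : gact l (c • u) = c • gact l u := by
  rw [← GM_mulVec, Matrix.mulVec_smul, GM_mulVec]

lemma GM_sq (l : Option (Fin n)) : (GM l : Matrix _ _ F) * GM l = 1 := by
  apply Matrix.ext_of_mulVec_single
  intro j
  rw [← Matrix.mulVec_mulVec, GM_mulVec, GM_mulVec, gact_gact, Matrix.one_mulVec]

lemma abs_det_GM (a : AbsoluteValue F ℝ) (l : Option (Fin n)) : a (GM l : Matrix _ _ F).det = 1 := by
  have h := congrArg (fun M => a (Matrix.det M)) (GM_sq (F := F) l)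
  simp only [Matrix.det_mul, Matrix.det_one, map_mul, map_one] at h
  nlinarith [a.nonneg (GM l : Matrix _ _ F).det]

lemma na_sum {a : AbsoluteValue F ℝ} (na : IsNonarchimedean a) {α : Type*} (s : Finset α)
    (f : α → F) {M : ℝ} (hM : 0 ≤ M) (h : ∀ i ∈ s, a (f i) ≤ M) : a (∑ i ∈ s, f i) ≤ M := by
  classical
  induction s using Finset.induction_on with
  | empty => simpa
  | insert x s hx ih =>
    rw [Finset.sum_insert hx]
    exact (na _ _).trans (max_le (h x (by simp)) (ih fun i hi => h i (by simp [hi])))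

lemma det_le {a : AbsoluteValue F ℝ} (na : IsNonarchimedean a) (M : Matrix (Fin n) (Fin n) F)
    (α β : Fin n → ℝ) (hα : ∀ i, 0 ≤ α i) (hβ : ∀ i, 0 ≤ β i) (h : ∀ i j, a (M i j) ≤ α i * β j) :
    a M.det ≤ (∏ i, α i) * ∏ i, β i := by
  rw [Matrix.det_apply]
  refine na_sum na _ _ (mul_nonneg (Finset.prod_nonneg fun i _ => hα i) (Finset.prod_nonneg fun i _ => hβ i)) ?_
  intro σ _
  have h1 : a (Equiv.Perm.sign σ • ∏ i, M (σ i) i) = a (∏ i, M (σ i) i) := by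
    rcases Int.units_eq_one_or (Equiv.Perm.sign σ) with h | h <;> simp [h]
  rw [h1, map_prod, ← Equiv.prod_comp σ α, ← Finset.prod_mul_distrib]
  exact Finset.prod_le_prod (fun i _ => a.nonneg _) fun i _ => h _ _

lemma adj_le {a : AbsoluteValue F ℝ} (na : IsNonarchimedean a) (M : Matrix (Fin n) (Fin n) F)
    (α β : Fin n → ℝ) (hα : ∀ i, 0 < α i) (hβ : ∀ i, 0 < β i) (h : ∀ i j, a (M i j) ≤ α i * β j)
    (j i : Fin n) : a (M.adjugate j i) ≤ (∏ i' ∈ Finset.univ.erase i, α i') * ∏ j' ∈ Finset.univ.erase j, β j' := by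
  rw [Matrix.adjugate_apply]
  refine (det_le na _ (Function.update α i (β j)⁻¹) β ?_ (fun i => (hβ i).le) ?_).trans_eq ?_
  · intro k; by_cases hk : k = i
    · subst hk; simpa using (hβ j).le
    · simpa [hk] using (hα k).le
  · intro k j'
    by_cases hk : k = i
    · subst hk
      rw [Matrix.updateRow_self, Function.update_self]
      by_cases hj : j' = j
      · subst hj; simp [(hβ j').ne']
      · rw [Pi.single_apply, if_neg hj, map_zero]; exact mul_nonneg (inv_nonneg.2 (hβ j).le) (hβ _).le
    · rw [Matrix.updateRow_ne hk, Function.update_of_ne hk]; exact h _ _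
  · rw [← Finset.mul_prod_erase _ _ (Finset.mem_univ i), ← Finset.mul_prod_erase _ β (Finset.mem_univ j),
      Function.update_self, Finset.prod_congr rfl (g := α)]
    · field_simp [(hβ j).ne']
    · intro k hk; rw [Function.update_of_ne (Finset.ne_of_mem_erase hk)]

/-- L2 -/
lemma flag_perm [NeZero n] {a : AbsoluteValue F ℝ} (na : IsNonarchimedean a) (α : Fin n → ℝ) (hα : ∀ i, 0 < α i)
    (W : ℕ → Submodule F (Fin n → F)) (b : ℕ → Fin n → F) (h0 : W 0 = ⊥)
    (hs : ∀ k, W (k+1) = W k ⊔ F ∙ b k) (hb : ∀ k < n, b k ∉ W k) (j : ℕ) (hj : j ≤ n) :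
    ∃ p : ℕ → Fin n, (∀ k < j, ∀ k' < k, p k' ≠ p k) ∧
      (∀ c : Fin n → F, ∃ z ∈ W j, ∀ k < j, z (p k) = c (p k)) ∧
      (∀ i ≤ j, ∀ z ∈ W i, ∀ M, 0 ≤ M → (∀ k < i, a (z (p k)) ≤ M * α (p k)) → ∀ t, a (z t) ≤ M * α t) := by
  induction j with
  | zero =>
    refine ⟨fun _ => 0, by simp, fun c => ⟨0, by simp, by simp⟩, ?_⟩
    intro i hi z hz M hM _ t
    obtain rfl : i = 0 := by omega
    rw [h0, Submodule.mem_bot] at hz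
    subst hz; simpa using mul_nonneg hM (hα t).le
  | succ j ih =>
    obtain ⟨p, hp, hsur, hnorm⟩ := ih (by omega)
    obtain ⟨z0, hz0, hz0'⟩ := hsur (b j)
    set b' := b j - z0 with hb'
    have hb'0 : b' ≠ 0 := by
      intro h; rw [hb', sub_eq_zero] at h; exact hb j (by omega) (h ▸ hz0)
    have hb'v : ∀ k < j, b' (p k) = 0 := fun k hk => by simp [hb', hz0' k hk]
    have hW : W j ≤ W (j+1) := by rw [hs]; exact le_sup_left
    have hb'W : b' ∈ W (j+1) := by
      refine sub_mem ?_ (hW hz0)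
      rw [hs]; exact Submodule.mem_sup_right (Submodule.mem_span_singleton_self _)
    have hne : (Finset.univ : Finset (Fin n)).Nonempty := ⟨p 0, by simp⟩
    obtain ⟨i1, -, hi1⟩ := Finset.exists_max_image Finset.univ (fun i => a (b' i) / α i) hne
    have hbi1 : b' i1 ≠ 0 := by
      intro h
      apply hb'0; ext t
      have := hi1 t (by simp)
      rw [h, map_zero, zero_div] at this
      have h2 := (div_le_iff₀ (hα t)).1 this
      rw [zero_mul] at h2
      simpa using le_antisymm h2 (a.nonneg _)
    have hup : ∀ k < j, Function.update p j i1 k = p k := fun k hk => Function.update_of_ne hk.ne _ _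
    refine ⟨Function.update p j i1, ?_, ?_, ?_⟩
    · intro k hk k' hk'
      rcases Nat.lt_succ_iff_lt_or_eq.1 hk with h | h
      · rw [hup k h, hup k' (by omega)]; exact hp k h k' hk'
      · subst h; rw [hup k' hk', Function.update_self]
        intro h; exact hbi1 (h ▸ hb'v k' hk')
    · intro c
      obtain ⟨z, hz, hz'⟩ := hsur c
      refine ⟨z + ((c i1 - z i1) / b' i1) • b', add_mem (hW hz) (Submodule.smul_mem _ _ hb'W), ?_⟩
      intro k hk
      rcases Nat.lt_succ_iff_lt_or_eq.1 hk with h | h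
      · rw [hup k h]; simp [hz' k h, hb'v k h]
      · subst h; rw [Function.update_self]; simp [hbi1]
    · intro i hi z hz M hM hzM
      rcases Nat.lt_or_eq_of_le hi with h | h
      · refine hnorm i (by omega) z hz M hM fun k hk => ?_
        have := hzM k hk
        rwa [hup k (by omega)] at this
      subst h
      obtain ⟨x, hx, hzx⟩ : ∃ x ∈ W j, ∃ y : F, z = x + y • b' := by
        rw [hs, Submodule.mem_sup] at hz
        obtain ⟨x, hx, y', hy', rfl⟩ := hz
        obtain ⟨y, rfl⟩ := Submodule.mem_span_singleton.1 hy'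
        exact ⟨x + y • z0, add_mem hx (Submodule.smul_mem _ _ hz0), y, by rw [hb', smul_sub]; abel⟩
      obtain ⟨y, rfl⟩ := hzx
      have h1 : ∀ t, a (x t) ≤ M * α t := by
        refine hnorm j le_rfl x hx M hM fun k hk => ?_
        have := hzM k (by omega)
        rw [hup k hk] at this
        simpa [hb'v k hk] using this
      have h2 : a (y * b' i1) ≤ M * α i1 := by
        have h3 := hzM j (by omega)
        rw [Function.update_self] at h3
        have : y * b' i1 = (x + y • b') i1 + (- x i1) := by simp
        rw [this]
        exact (na _ _).trans (max_le h3 (by rw [AbsoluteValue.map_neg]; exact h1 _))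
      intro t
      refine (na _ _).trans (max_le (h1 t) ?_)
      have h4 := hi1 t (by simp)
      rw [div_le_div_iff₀ (hα _) (hα _)] at h4
      simp only [Pi.smul_apply, smul_eq_mul, map_mul] at h2 ⊢
      have h5 : a y * a (b' t) * α i1 ≤ M * α i1 * α t := by
        calc _ = a y * (a (b' t) * α i1) := by ring
          _ ≤ a y * (a (b' i1) * α t) := by gcongr
          _ = (a y * a (b' i1)) * α t := by ring
          _ ≤ _ := mul_le_mul_of_nonneg_right h2 (hα t).le
      nlinarith [hα i1, hα t]
end C1
end SU

open MvPolynomial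
namespace SU
section C2
set_option linter.unusedSectionVars false

structure GN (F ι : Type*) (n : ℕ) [Field F] [Fintype ι] where
  a : ι → AbsoluteValue F ℝ
  na : ∀ v, IsNonarchimedean (a v)
  O : Subring F
  pf : ∀ x ∈ O, x ≠ 0 → 1 ≤ ∏ v, a v x
  l : ι → Option (Fin n)
  m1 : ∀ A : ι → Fin n → ℝ, (∀ v i, 0 < A v i) → 1 < ∏ v, ∏ i, A v i →
    ∃ w : Fin n → F, w ≠ 0 ∧ (∀ i, w i ∈ O) ∧ ∀ v i, a v (gact (l v) w i) ≤ A v i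

variable {F ι : Type*} {n : ℕ} [Field F] [Fintype ι] [NeZero n] (G : GN F ι n) (A : ι → Fin n → ℝ)

noncomputable def GN.loc (v : ι) (u : Fin n → F) : ℝ := ⨆ i, G.a v (gact (G.l v) u i) / A v i
noncomputable def GN.H (u : Fin n → F) : ℝ := ∏ v, G.loc A v u

variable {G A}
lemma le_loc (hA : ∀ v i, 0 < A v i) (v : ι) (u : Fin n → F) (i : Fin n) :
    G.a v (gact (G.l v) u i) ≤ G.loc A v u * A v i := by
  rw [← div_le_iff₀ (hA v i)]
  exact le_ciSup (f := fun i => G.a v (gact (G.l v) u i) / A v i) (Set.finite_range _).bddAbove i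

lemma loc_le (hA : ∀ v i, 0 < A v i) (v : ι) (u : Fin n → F) {M : ℝ}
    (h : ∀ i, G.a v (gact (G.l v) u i) ≤ M * A v i) : G.loc A v u ≤ M :=
  ciSup_le fun i => (div_le_iff₀ (hA v i)).2 (h i)

lemma loc_nonneg (hA : ∀ v i, 0 < A v i) (v : ι) (u : Fin n → F) : 0 ≤ G.loc A v u :=
  Real.iSup_nonneg fun i => div_nonneg ((G.a v).nonneg _) (hA v i).le

lemma gact_le {a : AbsoluteValue F ℝ} (na : IsNonarchimedean a) (l : Option (Fin n)) (z : Fin n → F) {M : ℝ}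
    (hM : 0 ≤ M) (h : ∀ i, a (z i) ≤ M) (i : Fin n) : a (gact l z i) ≤ M := by
  cases l with
  | none => exact h i
  | some l =>
    simp only [gact]
    split_ifs
    · rw [AbsoluteValue.map_neg]; exact na_sum na _ _ hM fun i _ => h i
    · exact h i

lemma le_loc' (hA : ∀ v i, 0 < A v i) (v : ι) (u : Fin n → F) (i : Fin n) :
    G.a v (u i) ≤ G.loc A v u * ∑ k, A v k := by
  have h0 := loc_nonneg (G := G) hA v u
  have := gact_le (G.na v) (G.l v) (gact (G.l v) u) (M := G.loc A v u * ∑ k, A v k)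
    (mul_nonneg h0 (Finset.sum_nonneg fun k _ => (hA v k).le)) (fun k => (le_loc hA v u k).trans
      (mul_le_mul_of_nonneg_left (Finset.single_le_sum (f := A v) (fun k _ => (hA v k).le) (Finset.mem_univ k)) h0)) i
  rwa [gact_gact] at this

lemma loc_pos (hA : ∀ v i, 0 < A v i) (v : ι) (u : Fin n → F) (hu : u ≠ 0) : 0 < G.loc A v u := by
  obtain ⟨i, hi⟩ := Function.ne_iff.1 hu
  have h1 := le_loc' (G := G) hA v u i
  have h2 := (G.a v).pos hi
  have h3 := loc_nonneg (G := G) hA v u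
  rcases h3.lt_or_eq with h | h
  · exact h
  · rw [← h, zero_mul] at h1; linarith

lemma loc_smul (v : ι) (c : F) (u : Fin n → F) : G.loc A v (c • u) = G.a v c * G.loc A v u := by
  unfold GN.loc
  rw [Real.mul_iSup_of_nonneg ((G.a v).nonneg _)]
  congr 1; ext i
  rw [gact_smul]; simp [mul_div_assoc]

lemma H_pos (hA : ∀ v i, 0 < A v i) (u : Fin n → F) (hu : u ≠ 0) : 0 < G.H A u :=
  Finset.prod_pos fun v _ => loc_pos hA v u hu

lemma H_lower (hA : ∀ v i, 0 < A v i) : ∃ c > 0, ∀ u : Fin n → F, (∀ i, u i ∈ G.O) → u ≠ 0 → c ≤ G.H A u := by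
  have hS : ∀ v, 0 < ∑ k, A v k := fun v => Finset.sum_pos (fun k _ => hA v k) ⟨0, by simp⟩
  have hP : 0 < ∏ v, ∑ k, A v k := Finset.prod_pos fun v _ => hS v
  refine ⟨(∏ v, ∑ k, A v k)⁻¹, by positivity, fun u hu hu0 => ?_⟩
  obtain ⟨i, hi⟩ := Function.ne_iff.1 hu0
  rw [inv_le_iff_one_le_mul₀ hP, GN.H, ← Finset.prod_mul_distrib]
  exact (G.pf _ (hu i) hi).trans (Finset.prod_le_prod (fun v _ => (G.a v).nonneg _) fun v _ => le_loc' hA v u i)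

lemma GUcol (v : ι) (U : Matrix (Fin n) (Fin n) F) (i j : Fin n) :
    ((GM (G.l v) : Matrix _ _ F) * U) i j = gact (G.l v) (fun i => U i j) i := by
  rw [← GM_mulVec]; rfl

/-- L1 -/
lemma one_le_prodH (hA : ∀ v i, 0 < A v i) (U : Matrix (Fin n) (Fin n) F) (hU : ∀ i j, U i j ∈ G.O)
    (hd : U.det ≠ 0) : 1 ≤ (∏ v, ∏ i, A v i) * ∏ j, G.H A (fun i => U i j) := by
  have hdO : U.det ∈ G.O := by
    rw [Matrix.det_apply]
    exact sum_mem fun σ _ => by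
      rcases Int.units_eq_one_or (Equiv.Perm.sign σ) with h | h <;> simp only [h, one_smul, Units.neg_smul]
      · exact prod_mem fun i _ => hU _ _
      · exact neg_mem (prod_mem fun i _ => hU _ _)
  refine (G.pf _ hdO hd).trans ?_
  unfold GN.H
  rw [Finset.prod_comm (s := (Finset.univ : Finset (Fin n))) , ← Finset.prod_mul_distrib]
  refine Finset.prod_le_prod (fun v _ => (G.a v).nonneg _) fun v _ => ?_
  have := det_le (G.na v) ((GM (G.l v) : Matrix _ _ F) * U) (A v) (fun j => G.loc A v (fun i => U i j))
    (fun i => (hA v i).le) (fun j => loc_nonneg hA v _) (fun i j => by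
      rw [GUcol, mul_comm]; exact le_loc hA v _ i)
  rwa [Matrix.det_mul, map_mul, abs_det_GM, one_mul] at this

lemma pick (hA : ∀ v i, 0 < A v i) {θ : ℝ} (hθ : 1 < θ) (W : Submodule F (Fin n → F)) (hW : W ≠ ⊤) :
    ∃ b : Fin n → F, b ∉ W ∧ (∀ i, b i ∈ G.O) ∧ ∀ u : Fin n → F, (∀ i, u i ∈ G.O) → u ∉ W → G.H A b ≤ θ * G.H A u := by
  obtain ⟨c, hc, hcH⟩ := H_lower (G := G) hA
  let S := {x : ℝ | ∃ u : Fin n → F, (∀ i, u i ∈ G.O) ∧ u ∉ W ∧ x = G.H A u}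
  have hSb : ∀ x ∈ S, c ≤ x := by
    rintro x ⟨u, hu, huW, rfl⟩
    exact hcH u hu (fun h => huW (h ▸ zero_mem _))
  have hSn : S.Nonempty := by
    by_contra hne
    apply hW
    rw [eq_top_iff, ← (Pi.basisFun F (Fin n)).span_eq, Submodule.span_le]
    rintro _ ⟨i, rfl⟩
    by_contra hi
    refine hne ⟨_, _, fun k => ?_, hi, rfl⟩
    rw [Pi.basisFun_apply, Pi.single_apply]
    split_ifs
    · exact one_mem _
    · exact zero_mem _
  have hI : c ≤ sInf S := le_csInf hSn hSb
  obtain ⟨x, ⟨b, hb, hbW, rfl⟩, hx⟩ := exists_lt_of_csInf_lt (b := θ * sInf S) hSn (by nlinarith)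
  refine ⟨b, hbW, hb, fun u hu huW => hx.le.trans ?_⟩
  exact mul_le_mul_of_nonneg_left (csInf_le ⟨c, hSb⟩ ⟨u, hu, huW, rfl⟩) (by linarith)

variable (G) in
structure IsGreedy (A : ι → Fin n → ℝ) (θ : ℝ) (W : ℕ → Submodule F (Fin n → F)) (b : ℕ → Fin n → F) : Prop where
  h0 : W 0 = ⊥
  hs : ∀ k, W (k+1) = W k ⊔ F ∙ b k
  hb : ∀ k < n, b k ∉ W k
  hO : ∀ k < n, ∀ i, b k i ∈ G.O
  hm : ∀ k < n, ∀ u : Fin n → F, (∀ i, u i ∈ G.O) → u ∉ W k → G.H A (b k) ≤ θ * G.H A u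

open Module in
lemma greedy (hA : ∀ v i, 0 < A v i) {θ : ℝ} (hθ : 1 < θ) : ∃ W b, IsGreedy G A θ W b := by
  classical
  let pk : Submodule F (Fin n → F) → (Fin n → F) := fun W => if h : W ≠ ⊤ then (pick (G := G) hA hθ W h).choose else 0
  obtain ⟨W, hW0, hWs⟩ : ∃ W : ℕ → Submodule F (Fin n → F), W 0 = ⊥ ∧ ∀ k, W (k+1) = W k ⊔ F ∙ pk (W k) :=
    ⟨fun k => Nat.rec ⊥ (fun _ W => W ⊔ F ∙ pk W) k, rfl, fun _ => rfl⟩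
  have hr : ∀ k, finrank F ↥(W k) ≤ k := by
    intro k
    induction k with
    | zero => simp [hW0]
    | succ k ih =>
      rw [hWs]
      refine (Submodule.finrank_add_le_finrank_add_finrank (W k) (F ∙ pk (W k))).trans ?_
      exact add_le_add ih ((finrank_span_le_card ({pk (W k)} : Set (Fin n → F))).trans (by simp))
  have ht : ∀ k < n, W k ≠ ⊤ := by
    intro k hk h
    have := hr k
    rw [h, finrank_top, finrank_fin_fun] at this
    omega
  refine ⟨W, fun k => pk (W k), hW0, hWs, ?_, ?_, ?_⟩ <;> intro k hk <;>
    simp only [pk, dif_pos (ht k hk)]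
  · exact (pick (G := G) hA hθ _ (ht k hk)).choose_spec.1
  · exact (pick (G := G) hA hθ _ (ht k hk)).choose_spec.2.1
  · exact (pick (G := G) hA hθ _ (ht k hk)).choose_spec.2.2

variable {θ : ℝ} {W : ℕ → Submodule F (Fin n → F)} {b : ℕ → Fin n → F}
open Module in
lemma IsGreedy.top (h : IsGreedy G A θ W b) : W n = ⊤ := by
  have hr : ∀ k ≤ n, k ≤ finrank F (W k) := by
    intro k
    induction k with
    | zero => simp
    | succ k ih =>
      intro hk
      have : W k < W (k+1) := by
        rw [h.hs]
        refine lt_of_le_of_ne le_sup_left fun he => h.hb k (by omega) ?_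
        rw [he]; exact Submodule.mem_sup_right (Submodule.mem_span_singleton_self _)
      have := Submodule.finrank_lt_finrank_of_lt this
      have := ih (by omega)
      omega
  apply Submodule.eq_top_of_finrank_eq
  rw [finrank_fin_fun]
  refine le_antisymm ?_ (hr n le_rfl)
  simpa using Submodule.finrank_le (W n)

lemma IsGreedy.mono (h : IsGreedy G A θ W b) : Monotone W :=
  monotone_nat_of_le_succ fun k => by rw [h.hs]; exact le_sup_left

lemma IsGreedy.det (h : IsGreedy G A θ W b) : (Matrix.of fun i j : Fin n => b j i).det ≠ 0 := by
  have hsp : ∀ k ≤ n, W k ≤ Submodule.span F (Set.range fun j : Fin n => b j) := by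
    intro k
    induction k with
    | zero => intro _; rw [h.h0]; exact bot_le
    | succ k ih =>
      intro hk
      rw [h.hs]
      refine sup_le (ih (by omega)) ?_
      rw [Submodule.span_singleton_le_iff_mem]
      exact Submodule.subset_span ⟨⟨k, by omega⟩, rfl⟩
  have hli : LinearIndependent F (fun j : Fin n => b j) :=
    linearIndependent_of_top_le_span_of_card_eq_finrank (by rw [← h.top]; exact hsp n le_rfl) (by simp)
  have := (Matrix.linearIndependent_cols_iff_isUnit (A := Matrix.of fun i j : Fin n => b j i)).1 hli
  exact ((Matrix.isUnit_iff_isUnit_det _).1 this).ne_zero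

/-- deformation -/
lemma IsGreedy.deform (h : IsGreedy G A θ W b) (hA : ∀ v i, 0 < A v i) (v0 : ι) (ν : ℕ → ℝ) (hν : Monotone ν)
    (hν0 : ∀ j, 0 < ν j) : ∃ A' : ι → Fin n → ℝ, (∀ v i, 0 < A' v i) ∧
      (∏ v, ∏ i, A' v i) = (∏ v, ∏ i, A v i) * ∏ j : Fin n, ν j ∧
      ∀ j < n, ∀ u ∈ W (j+1), G.H A u ≤ ν j * G.H A' u := by
  classical
  let ga : (Fin n → F) →ₗ[F] (Fin n → F) := Matrix.mulVecLin (GM (G.l v0))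
  have hga : ∀ u, ga u = gact (G.l v0) u := fun u => GM_mulVec _ _
  have hinj : Function.Injective ga := fun x y hxy => by
    rw [hga, hga] at hxy; rw [← gact_gact (G.l v0) x, hxy, gact_gact]
  obtain ⟨p, hp, -, hn⟩ := flag_perm (G.na v0) (A v0) (hA v0) (fun k => (W k).map ga) (fun k => ga (b k))
    (by simp [h.h0]) (fun k => by simp only [h.hs, Submodule.map_sup, Submodule.map_span, Set.image_singleton])
    (fun k hk hmem => by
      obtain ⟨x, hx, hxe⟩ := hmem
      exact h.hb k hk (hinj hxe ▸ hx)) n le_rfl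
  have hpi : Function.Injective (fun k : Fin n => p k) := by
    intro i j hij
    rcases lt_trichotomy (i : ℕ) j with h | h | h
    · exact absurd hij (hp j j.2 i h)
    · exact Fin.ext h
    · exact absurd hij.symm (hp i i.2 j h)
  let e : Fin n ≃ Fin n := Equiv.ofBijective _ (Finite.injective_iff_bijective.1 hpi)
  let A' : ι → Fin n → ℝ := fun v i => if v = v0 then A v i * ν (e.symm i) else A v i
  have hA' : ∀ v i, 0 < A' v i := by
    intro v i; simp only [A']; split_ifs
    · exact mul_pos (hA v i) (hν0 _)
    · exact hA v i
  refine ⟨A', hA', ?_, ?_⟩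
  · rw [← Finset.mul_prod_erase _ _ (Finset.mem_univ v0),
      ← Finset.mul_prod_erase Finset.univ (fun v => ∏ i, A v i) (Finset.mem_univ v0)]
    rw [Finset.prod_congr rfl (g := fun v => ∏ i, A v i)]
    · simp only [A', if_true, Finset.prod_mul_distrib]
      rw [Equiv.prod_comp e.symm (fun i : Fin n => ν i)]; ring
    · intro v hv; simp only [A', if_neg (Finset.ne_of_mem_erase hv)]
  · intro j hj u hu
    unfold GN.H
    rw [← Finset.mul_prod_erase _ _ (Finset.mem_univ v0),
      ← Finset.mul_prod_erase Finset.univ (fun v => G.loc A' v u) (Finset.mem_univ v0), ← mul_assoc]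
    have he : ∏ v ∈ Finset.univ.erase v0, G.loc A v u = ∏ v ∈ Finset.univ.erase v0, G.loc A' v u := by
      refine Finset.prod_congr rfl fun v hv => ?_
      simp only [GN.loc, A', if_neg (Finset.ne_of_mem_erase hv)]
    rw [he]
    refine mul_le_mul_of_nonneg_right ?_ (Finset.prod_nonneg fun v _ => loc_nonneg hA' v u)
    refine loc_le hA v0 u fun t => ?_
    rw [← hga]
    refine hn (j+1) (by omega) (ga u) (Submodule.mem_map_of_mem hu) _
      (mul_nonneg (hν0 j).le (loc_nonneg hA' v0 u)) (fun k hk => ?_) t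
    have hk' : k < n := by omega
    have h1 := le_loc (G := G) hA' v0 u (p k)
    have h2 : e.symm (p k) = ⟨k, hk'⟩ := by
      rw [Equiv.symm_apply_eq]; rfl
    simp only [A', if_true, h2] at h1
    rw [hga]
    refine h1.trans ?_
    have h3 : ν k ≤ ν j := hν (by omega)
    have := loc_nonneg (G := G) hA' v0 u
    calc _ = G.loc A' v0 u * A v0 (p k) * ν k := by ring
      _ ≤ G.loc A' v0 u * A v0 (p k) * ν j := by
          refine mul_le_mul_of_nonneg_left h3 (mul_nonneg this (hA _ _).le)
      _ = _ := by ring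

lemma deg_le (hA : ∀ v i, 0 < A v i) (v0 : ι) {s : ℝ} (hs : 0 < s)
    (h : ∀ u : Fin n → F, (∀ i, u i ∈ G.O) → u ≠ 0 → s ≤ G.H A u) : (∏ v, ∏ i, A v i) * s ^ n ≤ 1 := by
  classical
  by_contra hlt
  push Not at hlt
  -- choose c < s with still > 1
  have hcont : ContinuousAt (fun c : ℝ => (∏ v, ∏ i, A v i) * c ^ n) s := by fun_prop
  have hev := hcont.eventually (lt_mem_nhds hlt)
  obtain ⟨c, ⟨hc0, hcs⟩, hc⟩ : ∃ c, (0 < c ∧ c < s) ∧ 1 < (∏ v, ∏ i, A v i) * c ^ n := by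
    have h1 := hev.filter_mono (nhdsWithin_le_nhds (s := Set.Iio s))
    have h2 : ∀ᶠ c in nhdsWithin s (Set.Iio s), c ∈ Set.Ioo 0 s := Ioo_mem_nhdsLT hs
    obtain ⟨c, hc⟩ := (h1.and h2).exists
    exact ⟨c, hc.2, hc.1⟩
  let A' : ι → Fin n → ℝ := fun v i => if v = v0 then A v i * c else A v i
  have hA' : ∀ v i, 0 < A' v i := by
    intro v i; simp only [A']; split_ifs
    · exact mul_pos (hA v i) hc0
    · exact hA v i
  obtain ⟨w, hw0, hwO, hw⟩ := G.m1 A' hA' (by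
    convert hc using 1
    rw [← Finset.mul_prod_erase _ _ (Finset.mem_univ v0),
      ← Finset.mul_prod_erase Finset.univ (fun v => ∏ i, A v i) (Finset.mem_univ v0)]
    rw [Finset.prod_congr rfl (g := fun v => ∏ i, A v i) (fun v hv => by
      simp only [A', if_neg (Finset.ne_of_mem_erase hv)])]
    simp only [A', if_true, Finset.prod_mul_distrib]
    simp; ring)
  have h1 := h w hwO hw0
  have h2 : G.H A w ≤ c := by
    unfold GN.H
    rw [← Finset.mul_prod_erase _ _ (Finset.mem_univ v0)]
    have h3 : G.loc A v0 w ≤ c := loc_le hA v0 w fun i => by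
      have := hw v0 i; simp only [A', if_true] at this; linarith
    have h4 : ∏ v ∈ Finset.univ.erase v0, G.loc A v w ≤ 1 :=
      Finset.prod_le_one (fun v _ => loc_nonneg hA v w) fun v hv => loc_le hA v w fun i => by
        have := hw v i; simp only [A', if_neg (Finset.ne_of_mem_erase hv)] at this; linarith
    calc _ ≤ c * 1 := mul_le_mul h3 h4 (Finset.prod_nonneg fun v _ => loc_nonneg hA v w) hc0.le
      _ = c := mul_one c
  linarith
end C2
end SU

open MvPolynomial
namespace SU
section C3
set_option linter.unusedSectionVars false
variable {F ι : Type*} {n : ℕ} [Field F] [Fintype ι] [NeZero n] {G : GN F ι n} {A : ι → Fin n → ℝ}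
variable {θ : ℝ} {W : ℕ → Submodule F (Fin n → F)} {b : ℕ → Fin n → F}

lemma IsGreedy.nu (h : IsGreedy G A θ W b) (hA : ∀ v i, 0 < A v i) (hθ : 1 < θ) : ∃ ν : ℕ → ℝ, Monotone ν ∧ (∀ j, 0 < ν j) ∧
    (∀ j < n, G.H A (b j) ≤ ν j ∧ ν j ≤ θ * G.H A (b j)) ∧ ν 0 = G.H A (b 0) := by
  have hn : 0 < n := Nat.pos_of_ne_zero (NeZero.ne n)
  let ν : ℕ → ℝ := fun j => (Finset.range (j+1)).sup' ⟨0, by simp⟩ (fun k => G.H A (b k))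
  have hmem : ∀ j k, k ≤ j → G.H A (b k) ≤ ν j := fun j k hk =>
    Finset.le_sup' (fun k => G.H A (b k)) (by simp; omega)
  refine ⟨ν, ?_, ?_, ?_, ?_⟩
  · intro i j hij
    exact Finset.sup'_mono _ (Finset.range_mono (by omega)) _
  · intro j
    refine lt_of_lt_of_le (H_pos hA (b 0) ?_) (hmem j 0 (by omega))
    intro h0; exact h.hb 0 hn (h0 ▸ zero_mem _)
  · intro j hj
    refine ⟨hmem j j le_rfl, Finset.sup'_le _ _ fun k hk => ?_⟩
    have hk' : k ≤ j := by simp at hk; omega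
    exact h.hm k (by omega) _ (h.hO j hj) fun hm => h.hb j hj (h.mono hk' hm)
  · simp [ν]

lemma IsGreedy.deform' (h : IsGreedy G A θ W b) (hA : ∀ v i, 0 < A v i) (hθ : 1 < θ) (v0 : ι) (r : ℕ)
    (ν : ℕ → ℝ) (h1 : Monotone ν) (h2 : ∀ j, 0 < ν j)
    (h3 : ∀ j < n, G.H A (b j) ≤ ν j ∧ ν j ≤ θ * G.H A (b j)) :
    ∃ A' : ι → Fin n → ℝ, (∀ v i, 0 < A' v i) ∧
      (∏ v, ∏ i, A' v i) = (∏ v, ∏ i, A v i) * ∏ j : Fin n, ν (max j r) ∧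
      ∀ u : Fin n → F, (∀ i, u i ∈ G.O) → u ∉ W r → (θ^2)⁻¹ ≤ G.H A' u := by
  obtain ⟨A', hA', hd, hH⟩ := h.deform hA v0 (fun j => ν (max j r))
    (fun i j hij => h1 (max_le_max_right _ hij)) (fun j => h2 _)
  refine ⟨A', hA', hd, fun u hu huW => ?_⟩
  have hex : ∃ j, u ∈ W j := ⟨n, by rw [h.top]; trivial⟩
  classical
  have hle : Nat.find hex ≤ n := Nat.find_min' hex (by rw [h.top]; trivial)
  have hgt : r < Nat.find hex := by
    by_contra hcon
    exact huW (h.mono (not_lt.1 hcon) (Nat.find_spec hex))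
  obtain ⟨j, hj⟩ : ∃ j, Nat.find hex = j + 1 := ⟨Nat.find hex - 1, by omega⟩
  have hnot : u ∉ W j := Nat.find_min hex (by omega)
  have hin : u ∈ W (j+1) := hj ▸ Nat.find_spec hex
  have e1 := hH j (by omega) u hin
  simp only [max_eq_left (show r ≤ j by omega)] at e1
  have e2 := h.hm j (by omega) u hu hnot
  have e3 := (h3 j (by omega)).2
  have hu0 : u ≠ 0 := fun h => huW (h ▸ zero_mem _)
  have e4 := H_pos (G := G) hA' u hu0
  rw [inv_le_iff_one_le_mul₀ (by positivity)]
  have e5 : ν j ≤ θ ^ 2 * (ν j * G.H A' u) := by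
    calc ν j ≤ θ * (θ * G.H A u) := e3.trans (mul_le_mul_of_nonneg_left e2 (by linarith))
      _ = θ ^ 2 * G.H A u := by ring
      _ ≤ _ := mul_le_mul_of_nonneg_left e1 (by positivity)
  have := h2 j
  nlinarith

lemma mink2 (hA : ∀ v i, 0 < A v i) (hθ : 1 < θ) (v0 : ι) : ∃ U : Matrix (Fin n) (Fin n) F, (∀ i j, U i j ∈ G.O) ∧
    U.det ≠ 0 ∧ (∏ v, ∏ i, A v i) * ∏ j, G.H A (fun i => U i j) ≤ θ ^ (2 * n) := by
  obtain ⟨W, b, h⟩ := greedy (G := G) hA hθ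
  obtain ⟨ν, h1, h2, h3, -⟩ := h.nu hA hθ
  obtain ⟨A', hA', hd, hH⟩ := h.deform' hA hθ v0 0 ν h1 h2 h3
  refine ⟨_, fun i j => h.hO j j.2 i, h.det, ?_⟩
  have := deg_le (G := G) hA' v0 (s := (θ^2)⁻¹) (by positivity) (fun u hu hu0 => hH u hu (by rwa [h.h0, Submodule.mem_bot]))
  rw [inv_pow, ← pow_mul, mul_inv_le_iff₀ (by positivity), one_mul, hd] at this
  refine le_trans (mul_le_mul_of_nonneg_left ?_ (Finset.prod_nonneg fun v _ => Finset.prod_nonneg fun i _ => (hA v i).le)) this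
  refine Finset.prod_le_prod (fun j _ => Finset.prod_nonneg fun v _ => loc_nonneg hA v _) fun j _ => ?_
  simpa using (h3 j j.2).1

lemma rescale (hA : ∀ v i, 0 < A v i) (hθ : 1 < θ) (v0 : ι) (u : Fin n → F) (hu : u ≠ 0) :
    ∃ κ ∈ G.O, κ ≠ 0 ∧ (∀ v, v ≠ v0 → G.loc A v (κ • u) ≤ 1) ∧ G.loc A v0 (κ • u) ≤ θ * G.H A u := by
  classical
  have hl := fun v => loc_pos (G := G) hA v u hu
  have hP : 0 < ∏ v ∈ Finset.univ.erase v0, G.loc A v u := Finset.prod_pos fun v _ => hl v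
  let τ : ι → ℝ := fun v => if v = v0 then θ * ∏ v ∈ Finset.univ.erase v0, G.loc A v u else (G.loc A v u)⁻¹
  have hτ : ∀ v, 0 < τ v := by
    intro v; simp only [τ]; split_ifs
    · exact mul_pos (by linarith) hP
    · exact inv_pos.2 (hl v)
  have hτp : ∏ v, τ v = θ := by
    rw [← Finset.mul_prod_erase _ _ (Finset.mem_univ v0), Finset.prod_congr rfl (g := fun v => (G.loc A v u)⁻¹)
      (fun v hv => by simp only [τ, if_neg (Finset.ne_of_mem_erase hv)])]
    simp only [τ, if_true, Finset.prod_inv_distrib]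
    field_simp
  obtain ⟨w, hw0, hwO, hw⟩ := G.m1 (fun v _ => τ v) (fun v _ => hτ v) (by
    simp only [Finset.prod_const, Finset.prod_pow, hτp]
    simpa using one_lt_pow₀ hθ (NeZero.ne n))
  obtain ⟨i, hi⟩ := Function.ne_iff.1 hw0
  have hwi : ∀ v, G.a v (w i) ≤ τ v := fun v => by
    have := gact_le (G.na v) (G.l v) (gact (G.l v) w) (hτ v).le (hw v) i
    rwa [gact_gact] at this
  refine ⟨w i, hwO i, hi, fun v hv => ?_, ?_⟩
  · rw [loc_smul]
    have := hwi v
    simp only [τ, if_neg hv] at this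
    calc _ ≤ (G.loc A v u)⁻¹ * G.loc A v u := mul_le_mul_of_nonneg_right this (hl v).le
      _ = 1 := inv_mul_cancel₀ (hl v).ne'
  · rw [loc_smul]
    have := hwi v0
    simp only [τ, if_true] at this
    refine (mul_le_mul_of_nonneg_right this (hl v0).le).trans_eq ?_
    rw [GN.H, ← Finset.mul_prod_erase _ _ (Finset.mem_univ v0)]; ring

lemma prod_div_self {P : ℝ} {f : Fin n → ℝ} (hf : ∀ i, 0 < f i) (hP : P = ∏ i, f i) : ∏ i, P / f i = P ^ n / P := by
  rw [Finset.prod_div_distrib, ← hP]; simp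

lemma exists_theta {Λ : ℝ} (h : 1 < Λ) (N : ℕ) : ∃ θ > 1, θ ^ N < Λ := by
  have hL := Real.log_pos h
  refine ⟨Real.exp (Real.log Λ / (N + 1)), Real.one_lt_exp_iff.2 (by positivity), ?_⟩
  rw [← Real.exp_nat_mul, ← Real.lt_log_iff_exp_lt (by linarith)]
  rw [mul_div_assoc', div_lt_iff₀ (by positivity)]; nlinarith

theorem gn_main (hA : ∀ v i, 0 < A v i) (hn : 2 ≤ n) (v0 : ι) (y : Fin n → F) (hy0 : y ≠ 0)
    (hyO : ∀ i, y i ∈ G.O) (hy : G.H A y ≤ 1) {Λ : ℝ} (hΛ : 1 < Λ)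
    (hu : ∀ u : Fin n → F, (∀ i, u i ∈ G.O) → u ∉ Submodule.span F {y} → Λ ≤ G.H A u) :
    ∃ (U : Matrix (Fin n) (Fin n) F) (j0 : Fin n) (B : ι → Fin n → ℝ), (∀ i j, U i j ∈ G.O) ∧ U.det ≠ 0 ∧
      (∃ c : F, ∀ i, U i j0 = c * y i) ∧ (∀ v i, 0 < B v i) ∧ ∏ v, ∏ i, B v i < 1 ∧
      ∀ j ≠ j0, ∀ v i, G.a v (gst (G.l v) (U.adjugate j) i) ≤ B v i := by
  classical
  obtain ⟨θ, hθ, hθΛ⟩ := exists_theta hΛ ((3*n+1)*n*Fintype.card ι + 1 + (4*n+1))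
  have hθ0 : 0 < θ := by linarith
  -- first greedy
  obtain ⟨W, b, h⟩ := greedy (G := G) hA hθ
  obtain ⟨ν, h1, h2, h3, h4⟩ := h.nu hA hθ
  have hb0 : G.H A (b 0) ≤ θ := by
    have := h.hm 0 (by omega) y hyO (by rwa [h.h0, Submodule.mem_bot])
    nlinarith
  have hθΛ1 : θ < Λ := lt_of_le_of_lt (le_self_pow₀ hθ.le (by omega)) hθΛ
  have hb0y : b 0 ∈ Submodule.span F {y} := by
    by_contra hc
    have := hu (b 0) (h.hO 0 (by omega)) hc
    linarith
  have hW1 : W 1 = Submodule.span F {y} := by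
    have hle : W 1 ≤ Submodule.span F {y} := by
      rw [h.hs, h.h0, bot_sup_eq, Submodule.span_singleton_le_iff_mem]; exact hb0y
    refine le_antisymm hle ?_
    obtain ⟨c, hc⟩ := Submodule.mem_span_singleton.1 hb0y
    have hb00 : b 0 ≠ 0 := fun h0 => h.hb 0 (by omega) (h0 ▸ zero_mem _)
    have hc0 : c ≠ 0 := by rintro rfl; simp at hc; exact hb00 hc.symm
    rw [Submodule.span_singleton_le_iff_mem, h.hs, h.h0, bot_sup_eq, Submodule.mem_span_singleton]
    exact ⟨c⁻¹, by rw [← hc, smul_smul, inv_mul_cancel₀ hc0, one_smul]⟩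
  obtain ⟨A', hA', hd, hH⟩ := h.deform' hA hθ v0 1 ν h1 h2 h3
  rw [hW1] at hH
  set D := ∏ v, ∏ i, A' v i with hD
  have hdA : 0 < ∏ v, ∏ i, A v i := Finset.prod_pos fun v _ => Finset.prod_pos fun i _ => hA v i
  have hD0 : 0 < D := Finset.prod_pos fun v _ => Finset.prod_pos fun i _ => hA' v i
  have hDΛ : Λ ≤ θ * D := by
    have e1 := one_le_prodH (G := G) hA (Matrix.of fun i j : Fin n => b j i) (fun i j => h.hO j j.2 i) h.det
    have e2 : Λ ≤ ν 1 := (hu (b 1) (h.hO 1 (by omega)) (by rw [← hW1]; exact h.hb 1 (by omega))).trans (h3 1 (by omega)).1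
    have e3 : Λ * ∏ j : Fin n, ν j ≤ θ * ∏ j : Fin n, ν (max j 1) := by
      rw [← Finset.mul_prod_erase _ _ (Finset.mem_univ (0 : Fin n)),
        ← Finset.mul_prod_erase Finset.univ (fun j : Fin n => ν (max j 1)) (Finset.mem_univ (0 : Fin n))]
      rw [Finset.prod_congr rfl (g := fun j : Fin n => ν j) (s₁ := Finset.univ.erase 0) (f := fun j : Fin n => ν (max j 1)) (fun j hj => by
        have : (j : ℕ) ≠ 0 := fun h0 => Finset.ne_of_mem_erase hj (Fin.ext (by simpa using h0))
        rw [max_eq_left (by omega)])]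
      have hP : 0 ≤ ∏ j ∈ Finset.univ.erase (0 : Fin n), ν j := Finset.prod_nonneg fun j _ => (h2 _).le
      rw [← mul_assoc, ← mul_assoc]
      refine mul_le_mul_of_nonneg_right ?_ hP
      simp only [Fin.coe_ofNat_eq_mod, Nat.zero_mod]
      rw [h4, show max 0 1 = 1 by rfl, mul_comm]
      exact mul_le_mul hb0 e2 (by linarith) hθ0.le
    have e4 : (∏ j : Fin n, G.H A (b j)) ≤ ∏ j : Fin n, ν j :=
      Finset.prod_le_prod (fun j _ => Finset.prod_nonneg fun v _ => loc_nonneg hA v _) fun j _ => (h3 j j.2).1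
    have e5 : 1 ≤ (∏ v, ∏ i, A v i) * ∏ j : Fin n, ν j := le_trans e1 (mul_le_mul_of_nonneg_left e4 hdA.le)
    rw [hd]
    calc Λ ≤ Λ * ((∏ v, ∏ i, A v i) * ∏ j : Fin n, ν j) := le_mul_of_one_le_right (by linarith) e5
      _ = (∏ v, ∏ i, A v i) * (Λ * ∏ j : Fin n, ν j) := by ring
      _ ≤ (∏ v, ∏ i, A v i) * (θ * ∏ j : Fin n, ν (max j 1)) := mul_le_mul_of_nonneg_left e3 hdA.le
      _ = _ := by ring
  -- second
  obtain ⟨U, hUO, hUd, hUH⟩ := mink2 (G := G) hA' hθ v0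
  rw [← hD] at hUH
  have hcol0 : ∀ j, (fun i => U i j) ≠ 0 := fun j hj =>
    hUd (Matrix.det_eq_zero_of_column_eq_zero j fun i => congrFun hj i)
  have hHp := fun j => H_pos (G := G) hA' _ (hcol0 j)
  obtain ⟨j0, hj0⟩ : ∃ j, (fun i => U i j) ∈ Submodule.span F {y} := by
    by_contra hc
    push Not at hc
    have e1 : ((θ^2)⁻¹) ^ n ≤ ∏ j, G.H A' (fun i => U i j) := by
      calc _ = ∏ j : Fin n, (θ^2)⁻¹ := by simp
        _ ≤ _ := Finset.prod_le_prod (fun j _ => by positivity) fun j _ => hH _ (fun i => hUO i j) (hc j)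
    have e2 : D ≤ θ ^ (4 * n) := by
      have := (mul_le_mul_of_nonneg_left e1 hD0.le).trans hUH
      rw [inv_pow, ← pow_mul, mul_inv_le_iff₀ (by positivity), ← pow_add] at this
      rwa [show 2 * n + 2 * n = 4 * n by ring] at this
    have e3 : Λ ≤ θ ^ (4*n+1) := by
      rw [pow_succ']; exact hDΛ.trans (mul_le_mul_of_nonneg_left e2 hθ0.le)
    exact absurd (lt_of_le_of_lt (pow_le_pow_right₀ hθ.le (by omega)) hθΛ) (not_lt.2 e3)
  have hj : ∀ j ≠ j0, (fun i => U i j) ∉ Submodule.span F {y} := by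
    intro j hj hm
    obtain ⟨c, hc⟩ := Submodule.mem_span_singleton.1 hm
    obtain ⟨d, hd⟩ := Submodule.mem_span_singleton.1 hj0
    have : (d • Pi.single j 1 - c • Pi.single j0 1 : Fin n → F) = 0 := by
      apply Matrix.eq_zero_of_mulVec_eq_zero hUd
      rw [Matrix.mulVec_sub, Matrix.mulVec_smul, Matrix.mulVec_smul, Matrix.mulVec_single_one, Matrix.mulVec_single_one]
      change d • (fun i => U i j) - c • (fun i => U i j0) = 0
      rw [← hc, ← hd, smul_smul, smul_smul, mul_comm, sub_self]
    have := congrFun this j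
    simp [hj] at this
    subst this
    exact hcol0 j0 (by rw [← hd, zero_smul])
  choose κ hκO hκ0 hκ1 hκ2 using fun j => rescale (G := G) hA' hθ v0 _ (hcol0 j)
  let U2 : Matrix (Fin n) (Fin n) F := Matrix.of fun i j => κ j * U i j
  have hU2c : ∀ j, (fun i => U2 i j) = κ j • (fun i => U i j) := fun j => rfl
  have hU2n : ∀ j, (fun i => U2 i j) ≠ 0 := fun j => by rw [hU2c]; exact smul_ne_zero (hκ0 j) (hcol0 j)
  let P : ι → ℝ := fun v => ∏ i, A' v i
  have hP : ∀ v, 0 < P v := fun v => Finset.prod_pos fun i _ => hA' v i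
  let E : ι → ℝ := fun v => if v = v0 then θ ^ (3*n+1) * D⁻¹ else θ ^ (3*n+1)
  have hE : ∀ v, 0 < E v := fun v => by simp only [E]; split_ifs <;> positivity
  refine ⟨U2, j0, fun v i => P v / A' v i * E v, fun i j => mul_mem (hκO j) (hUO i j), ?_, ?_, ?_, ?_, ?_⟩
  · rw [Matrix.det_mul_row]; exact mul_ne_zero (Finset.prod_ne_zero_iff.2 fun j _ => hκ0 j) hUd
  · obtain ⟨d, hd⟩ := Submodule.mem_span_singleton.1 hj0
    refine ⟨κ j0 * d, fun i => ?_⟩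
    have := congrFun hd i
    simp only [Pi.smul_apply, smul_eq_mul] at this
    change κ j0 * U i j0 = _
    rw [← this]; ring
  · intro v i; exact mul_pos (div_pos (hP v) (hA' v i)) (hE v)
  · have e1 : ∀ v, ∏ i, P v / A' v i * E v = P v ^ n / P v * E v ^ n := fun v => by
      rw [Finset.prod_mul_distrib, prod_div_self (P := P v) (hA' v) rfl, Finset.prod_const, Finset.card_univ, Fintype.card_fin]
    simp only [e1]
    rw [Finset.prod_mul_distrib, Finset.prod_div_distrib, Finset.prod_pow, Finset.prod_pow]
    have e2 : ∏ v, E v = θ ^ ((3*n+1) * Fintype.card ι) * D⁻¹ := by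
      have : ∀ v, E v = θ ^ (3*n+1) * (if v = v0 then D⁻¹ else 1) := fun v => by simp only [E]; split_ifs <;> simp
      simp only [this, Finset.prod_mul_distrib, Finset.prod_const, Finset.card_univ, ← pow_mul, Finset.prod_ite_eq', Finset.mem_univ, if_true]
    rw [show ∏ v, P v = D from rfl, e2, mul_pow, ← pow_mul, inv_pow]
    have : D ^ n / D * (θ ^ ((3*n+1) * Fintype.card ι * n) * (D^n)⁻¹) = θ ^ ((3*n+1) * Fintype.card ι * n) / D := by
      field_simp
    rw [this, div_lt_one hD0]
    have e3 : θ ^ ((3*n+1) * Fintype.card ι * n) * θ < Λ := by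
      rw [← pow_succ]
      refine lt_of_le_of_lt (pow_le_pow_right₀ hθ.le ?_) hθΛ
      rw [show (3*n+1) * Fintype.card ι * n = (3*n+1) * n * Fintype.card ι by ring]; omega
    have := e3.trans_le hDΛ
    nlinarith
  · intro j hjj v i
    have e0 : G.a v (gst (G.l v) (U2.adjugate j) i) = G.a v (((GM (G.l v) : Matrix _ _ F) * U2).adjugate j i) := by
      have e1 : (GM (G.l v) : Matrix _ _ F).adjugate = (GM (G.l v) : Matrix _ _ F).det • GM (G.l v) := by
        have := congrArg (· * (GM (G.l v) : Matrix _ _ F)) (Matrix.adjugate_mul (GM (G.l v) : Matrix _ _ F))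
        simpa [mul_assoc, GM_sq] using this
      rw [Matrix.adjugate_mul_distrib, e1, Matrix.mul_smul, Matrix.smul_apply, smul_eq_mul, map_mul, abs_det_GM, one_mul,
        ← GM_vecMul]
      rfl
    rw [e0]
    refine (adj_le (G.na v) _ (A' v) (fun j => G.loc A' v (fun i => U2 i j)) (hA' v)
      (fun j => loc_pos hA' v _ (hU2n j)) (fun i j => by rw [GUcol, mul_comm]; exact le_loc hA' v _ i) j i).trans ?_
    have e1 : ∏ i' ∈ Finset.univ.erase i, A' v i' = P v / A' v i := by
      rw [eq_div_iff (hA' v i).ne', Finset.prod_erase_mul _ _ (Finset.mem_univ i)]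
    rw [e1]
    refine mul_le_mul_of_nonneg_left ?_ (div_pos (hP v) (hA' v i)).le
    simp only [E]
    split_ifs with hv
    · subst hv
      calc _ ≤ ∏ j' ∈ Finset.univ.erase j, θ * G.H A' (fun i => U i j') :=
            Finset.prod_le_prod (fun _ _ => loc_nonneg hA' _ _) fun j' _ => hκ2 j'
        _ = θ ^ (n-1) * ∏ j' ∈ Finset.univ.erase j, G.H A' (fun i => U i j') := by
            rw [Finset.prod_mul_distrib]; simp [Finset.card_erase_of_mem]
        _ ≤ θ ^ (n-1) * (θ ^ (2*n+2) * D⁻¹) := by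
            refine mul_le_mul_of_nonneg_left ?_ (by positivity)
            have e3 := hH _ (fun i => hUO i j) (hj j hjj)
            rw [← Finset.mul_prod_erase _ _ (Finset.mem_univ j)] at hUH
            set Q := ∏ j' ∈ Finset.univ.erase j, G.H A' (fun i => U i j')
            have hQ : 0 ≤ Q := Finset.prod_nonneg fun j' _ => (hHp j').le
            rw [← div_eq_mul_inv, le_div_iff₀ hD0]
            rw [inv_le_iff_one_le_mul₀ (by positivity)] at e3
            calc Q * D ≤ Q * D * (G.H A' (fun i => U i j) * θ^2) := le_mul_of_one_le_right (by positivity) e3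
              _ = D * (G.H A' (fun i => U i j) * Q) * θ ^ 2 := by ring
              _ ≤ θ ^ (2*n) * θ ^ 2 := mul_le_mul_of_nonneg_right hUH (by positivity)
              _ = _ := by rw [← pow_add]
        _ = _ := by rw [← mul_assoc, ← pow_add]; congr 2; omega
    · refine le_trans (Finset.prod_le_one (fun _ _ => loc_nonneg hA' _ _) fun j' _ => ?_) (one_le_pow₀ hθ.le)
      exact hκ1 j' v hv
end C3
end SU

open MvPolynomial
namespace SU
section N1
set_option linter.unusedSectionVars false
open NumberField
variable {K : Type*} [Field K] [NumberField K]

lemma fin_le_of_mem_pow (v : FinitePlace K) (k : ℕ) (x : 𝓞 K) (hx : x ∈ v.maximalIdeal.asIdeal ^ k) :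
    v (x : K) ≤ ((Ideal.absNorm v.maximalIdeal.asIdeal : ℝ) ^ k)⁻¹ := by
  have h1 := HeightOneSpectrum.one_lt_absNorm v.maximalIdeal
  have h1' : (1:ℝ) < Ideal.absNorm v.maximalIdeal.asIdeal := by exact_mod_cast h1
  by_cases hx0 : x = 0
  · subst hx0; simp
  have h2 := FinitePlace.apply_mul_absNorm_pow_eq_one v hx0
  have hnz : Ideal.span {x} ≠ ⊥ := mt Submodule.span_singleton_eq_bot.mp hx0
  have hf : FiniteMultiplicity v.maximalIdeal.asIdeal (Ideal.span {x}) :=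
    FiniteMultiplicity.of_not_isUnit (by rw [Ideal.isUnit_iff]; exact v.maximalIdeal.isPrime.ne_top) hnz
  have h3 : k ≤ multiplicity v.maximalIdeal.asIdeal (Ideal.span {x}) :=
    hf.le_multiplicity_of_pow_dvd (by rw [Ideal.dvd_span_singleton]; exact hx)
  have h4 := pow_le_pow_right₀ h1'.le h3
  have h5 : (0:ℝ) < (Ideal.absNorm v.maximalIdeal.asIdeal : ℝ) ^ k := by positivity
  rw [← one_div, le_div_iff₀ h5, ← h2]
  exact mul_le_mul_of_nonneg_left h4 (apply_nonneg v _)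

lemma fin_int_le_one (v : FinitePlace K) (x : 𝓞 K) : v (x : K) ≤ 1 := by
  simpa using fin_le_of_mem_pow v 0 x (by simp)

variable (T : Finset (FinitePlace K))
abbrev Pl := InfinitePlace K ⊕ {w // w ∈ T}
def pabs : Pl T → AbsoluteValue K ℝ
  | Sum.inl v => v.1
  | Sum.inr w => w.1.1
noncomputable def pm : Pl T → ℕ
  | Sum.inl v => v.mult
  | Sum.inr _ => 1
def OT : Subring K where
  carrier := {x | ∀ w : FinitePlace K, w ∉ T → w x ≤ 1}
  mul_mem' := fun {a b} ha hb w hw => by rw [map_mul]; exact mul_le_one₀ (ha w hw) (apply_nonneg w b) (hb w hw)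
  one_mem' := fun w _ => by simp
  add_mem' := fun {a b} ha hb w hw => (FinitePlace.add_le w a b).trans (max_le (ha w hw) (hb w hw))
  zero_mem' := fun w _ => by simp
  neg_mem' := fun {a} ha w hw => by rw [FinitePlace.coe_apply, AbsoluteValue.map_neg]; exact ha w hw

lemma int_mem_OT (x : 𝓞 K) : (x : K) ∈ OT T := fun w _ => fin_int_le_one w x

lemma pm_pos (v : Pl T) : 0 < pm T v := by
  rcases v with v | w
  · exact InfinitePlace.mult_pos
  · exact one_pos

lemma prod_pabs (x : K) : ∏ v, pabs T v x ^ pm T v = (∏ v : InfinitePlace K, v x ^ v.mult) * ∏ w ∈ T, w x := by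
  rw [Fintype.prod_sum_type]
  congr 1
  simp only [pabs, pm, pow_one]
  exact Finset.prod_coe_sort T (fun w : FinitePlace K => w x)

open Classical in
lemma pf_aux (x : K) (hx0 : x ≠ 0) : ∃ s : Finset (FinitePlace K), (∀ w ∉ s, w x = 1) ∧ T ⊆ s ∧
    (∏ v, pabs T v x ^ pm T v) * ∏ w ∈ s \ T, w x = 1 := by
  have hfin := FinitePlace.hasFiniteMulSupport hx0
  refine ⟨hfin.toFinset ∪ T, ?_, Finset.subset_union_right, ?_⟩
  · intro w hw; by_contra h; exact hw (Finset.mem_union_left _ (hfin.mem_toFinset.2 h))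
  · rw [← prod_abs_eq_one hx0, prod_pabs, mul_assoc]
    congr 1
    rw [mul_comm, Finset.prod_sdiff Finset.subset_union_right]
    rw [finprod_eq_prod_of_mulSupport_subset]
    intro w hw; exact Finset.mem_union_left _ (hfin.mem_toFinset.2 hw)

open Classical in
lemma pf_OT (x : K) (hx : x ∈ OT T) (hx0 : x ≠ 0) : 1 ≤ ∏ v, pabs T v x ^ pm T v := by
  obtain ⟨s, hs, hT, h⟩ := pf_aux T x hx0
  rw [← h]
  exact mul_le_of_le_one_right (Finset.prod_nonneg fun v _ => pow_nonneg ((pabs T v).nonneg _) _)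
    (Finset.prod_le_one (fun w _ => apply_nonneg w x) fun w hw => hx w (Finset.mem_sdiff.1 hw).2)

open Classical in
lemma pf_unit (x : K) (hx : ∀ w ∉ T, w x = 1) (hx0 : x ≠ 0) : ∏ v, pabs T v x ^ pm T v = 1 := by
  obtain ⟨s, hs, hT, h⟩ := pf_aux T x hx0
  rw [Finset.prod_eq_one (s := s \ T) (fun w hw => hx w (Finset.mem_sdiff.1 hw).2), mul_one] at h
  exact h

lemma logH_OT (x : K) (hx : x ∈ OT T) : Height.logHeight₁ x = ∑ v, pm T v * Real.posLog (pabs T v x) := by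
  rw [logHeight₁_eq, Fintype.sum_sum_type]
  congr 1
  rw [finsum_eq_sum_of_support_subset (s := T)]
  · simp only [pabs, pm, Nat.cast_one, one_mul]
    exact (Finset.sum_coe_sort T (fun w : FinitePlace K => Real.posLog (w x))).symm
  · intro w hw
    by_contra hwT
    apply hw
    exact Real.posLog_eq_zero_iff _ |>.2 (by rw [abs_of_nonneg (apply_nonneg w x)]; exact hx w hwT)

lemma logH_ge (x : K) (v : Pl T) : pm T v * Real.posLog (pabs T v x) ≤ Height.logHeight₁ x := by
  by_cases hx0 : x = 0
  · subst hx0; simp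
  rw [logHeight₁_eq]
  have h1 : 0 ≤ ∑ v : InfinitePlace K, (v.mult : ℝ) * Real.posLog (v x) :=
    Finset.sum_nonneg fun v _ => mul_nonneg (by positivity) Real.posLog_nonneg
  have h2 : 0 ≤ ∑ᶠ w : FinitePlace K, Real.posLog (w x) := finsum_nonneg fun w => Real.posLog_nonneg
  rcases v with v | w
  · have := Finset.single_le_sum (f := fun v : InfinitePlace K => (v.mult : ℝ) * Real.posLog (v x))
      (fun v _ => mul_nonneg (by positivity) Real.posLog_nonneg) (Finset.mem_univ v)
    simp only [pabs, pm]
    have h3 : (v.mult : ℝ) * Real.posLog (v x) ≤ _ := this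
    have h4 : v.1 x = v x := rfl
    rw [h4]; linarith
  · have := single_le_finsum (f := fun w : FinitePlace K => Real.posLog (w x)) w.1
      ((FinitePlace.hasFiniteMulSupport hx0).subset fun w hw => by
        intro h; apply hw; simp only at h; simp [h]) (fun w => Real.posLog_nonneg)
    simp only [pabs, pm, Nat.cast_one, one_mul]
    have h4 : w.1.1 x = w.1 x := rfl
    rw [h4]; linarith
end N1
end SU

open MvPolynomial
namespace SU
section N2
set_option linter.unusedSectionVars false
open NumberField
variable {K : Type*} [Field K] [NumberField K] {n : ℕ}

noncomputable def code (v : InfinitePlace K) (r : ℝ) (x : K) : ℤ × ℤ :=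
  (⌊(v.embedding x).re / r⌋, ⌊(v.embedding x).im / r⌋)
open Classical in
noncomputable def cellset (v : InfinitePlace K) (L : ℕ) : Finset (ℤ × ℤ) :=
  Finset.Icc (-L : ℤ) L ×ˢ if v.IsReal then {0} else Finset.Icc (-L : ℤ) L

lemma cell_card (v : InfinitePlace K) (L : ℕ) : (cellset v L).card = (2 * L + 1) ^ v.mult := by
  have h : (L + 1 + L : ℤ).toNat = 2 * L + 1 := by omega
  unfold cellset InfinitePlace.mult
  split_ifs <;> simp [h, sq]

lemma code_mem (v : InfinitePlace K) {r : ℝ} (hr : 0 < r) (L : ℕ) (x : K) (hx : v x ≤ L * r) :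
    code v r x ∈ cellset v L := by
  rw [← InfinitePlace.norm_embedding_eq] at hx
  have key : ∀ t : ℝ, |t| ≤ L * r → ⌊t / r⌋ ∈ Finset.Icc (-L : ℤ) L := by
    intro t ht
    rw [abs_le] at ht
    rw [Finset.mem_Icc, Int.le_floor]
    constructor
    · push_cast; rw [le_div_iff₀ hr]; linarith
    · have : (⌊t / r⌋ : ℝ) ≤ L := (Int.floor_le _).trans (by rw [div_le_iff₀ hr]; linarith)
      exact_mod_cast this
  unfold code cellset
  refine Finset.mem_product.2 ⟨key _ ((Complex.abs_re_le_norm _).trans hx), ?_⟩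
  split_ifs with h
  · have h0 : (v.embedding x).im = 0 := by exact (congrArg Complex.im (InfinitePlace.embedding_of_isReal_apply h x)).symm.trans (Complex.ofReal_im _)
    simp [h0]
  · exact key _ ((Complex.abs_im_le_norm _).trans hx)

lemma code_eq (v : InfinitePlace K) {r : ℝ} (hr : 0 < r) (x y : K) (h : code v r x = code v r y) :
    v (x - y) ≤ 2 * r := by
  rw [← InfinitePlace.norm_embedding_eq, map_sub]
  have key : ∀ s t : ℝ, ⌊s / r⌋ = ⌊t / r⌋ → |s - t| ≤ r := by
    intro s t h
    have := Int.abs_sub_lt_one_of_floor_eq_floor h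
    rw [← sub_div, abs_div, abs_of_pos hr, div_lt_one hr] at this
    exact this.le
  have h1 := key _ _ (congrArg Prod.fst h)
  have h2 := key _ _ (congrArg Prod.snd h)
  refine (Complex.norm_le_abs_re_add_abs_im _).trans ?_
  simp only [Complex.sub_re, Complex.sub_im]
  linarith

lemma gact_sub {F : Type*} [Ring F] (l : Option (Fin n)) (u v : Fin n → F) (i : Fin n) :
    gact l (u - v) i = gact l u i - gact l v i := by
  cases l <;> simp only [gact, Pi.sub_apply, Finset.sum_sub_distrib]
  split_ifs <;> abel

lemma gact_coe (l : Option (Fin n)) (u : Fin n → 𝓞 K) (i : Fin n) :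
    ((gact l u i : 𝓞 K) : K) = gact l (fun i => (u i : K)) i := by
  cases l <;> simp only [gact]
  split_ifs <;> simp

lemma gact_abs {F : Type*} [Field F] (a : AbsoluteValue F ℝ) (l : Option (Fin n)) (u : Fin n → F) (i : Fin n) :
    a (gact l u i) ≤ ∑ k, a (u k) := by
  have h1 : ∀ i, a (u i) ≤ ∑ k, a (u k) := fun i =>
    Finset.single_le_sum (f := fun k => a (u k)) (fun _ _ => a.nonneg _) (Finset.mem_univ i)
  cases l <;> simp only [gact]
  · exact h1 i
  split_ifs
  · rw [a.map_neg]; exact a.sum_le _ _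
  · exact h1 i

lemma count_ineq {V : Type*} [Fintype V] (mu : V → ℕ) {d : ℕ} (hd : ∑ v, mu v = d) {P : ℝ} (hP : 0 ≤ P)
    {r : V → Fin n → ℝ} (hr : ∀ v i, 0 < r v i) {c N : ℝ} (hc : 0 ≤ c) (hN0 : 0 < N) (hN : ∀ v i, r v i ≤ N)
    {L : V → Fin n → ℕ} (hL : ∀ v i, (L v i : ℝ) < c * N / r v i + 1)
    (h : (2 * c + 3) ^ (n * d) * P < ∏ v, ∏ i, r v i ^ mu v) :
    (∏ v, ∏ i, (2 * (L v i : ℝ) + 1) ^ mu v) * P < N ^ (n * d) := by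
  have h2 : ∏ v, ∏ i, (2 * (L v i : ℝ) + 1) ^ mu v ≤ ∏ v, ∏ i, ((2 * c + 3) * N / r v i) ^ mu v := by
    refine Finset.prod_le_prod (fun _ _ => by positivity) fun v _ =>
      Finset.prod_le_prod (fun _ _ => by positivity) fun i _ => ?_
    refine pow_le_pow_left₀ (by positivity) ?_ _
    have h3 := hL v i
    have h4 : 1 ≤ N / r v i := by rw [one_le_div (hr v i)]; exact hN v i
    have h5 : (2 * c + 3) * N / r v i = 2 * (c * N / r v i) + 3 * (N / r v i) := by ring
    rw [h5]; linarith
  have hmul : ∀ x : ℝ, ∏ v, ∏ _i : Fin n, x ^ mu v = x ^ (n * d) := by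
    intro x
    simp only [Finset.prod_const, Finset.card_univ, Fintype.card_fin, ← pow_mul]
    rw [Finset.prod_pow_eq_pow_sum, ← Finset.sum_mul, hd, mul_comm]
  have h3 : ∏ v, ∏ i, ((2 * c + 3) * N / r v i) ^ mu v =
      ((2 * c + 3) ^ (n * d) * N ^ (n * d)) / ∏ v, ∏ i, r v i ^ mu v := by
    simp only [div_pow, Finset.prod_div_distrib]
    rw [hmul, mul_pow]
  have h6 : 0 < ∏ v, ∏ i, r v i ^ mu v :=
    Finset.prod_pos fun v _ => Finset.prod_pos fun i _ => pow_pos (hr v i) _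
  refine (mul_le_mul_of_nonneg_right (h2.trans h3.le) hP).trans_lt ?_
  rw [div_mul_eq_mul_div, div_lt_iff₀ h6]
  nlinarith [mul_lt_mul_of_pos_left h (pow_pos hN0 (n * d))]

variable (T : Finset (FinitePlace K))

set_option maxHeartbeats 1000000 in
lemma m1_int (l : Pl T → Option (Fin n)) : ∃ C > 0, ∀ (r : InfinitePlace K → Fin n → ℝ) (k : {w // w ∈ T} → Fin n → ℕ),
    (∀ v i, 0 < r v i) →
    C * ∏ w, ∏ i, (Ideal.absNorm w.1.maximalIdeal.asIdeal : ℝ) ^ k w i < ∏ v, ∏ i, r v i ^ v.mult →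
    ∃ w : Fin n → 𝓞 K, w ≠ 0 ∧ (∀ v i, v ((gact (l (Sum.inl v)) w i : 𝓞 K) : K) ≤ 2 * r v i) ∧
      ∀ v i, gact (l (Sum.inr v)) w i ∈ v.1.maximalIdeal.asIdeal ^ k v i := by
  classical
  let b := RingOfIntegers.basis K
  let I := Module.Free.ChooseBasisIndex ℤ (𝓞 K)
  obtain ⟨B, hB0, hB⟩ : ∃ B : ℝ, 0 ≤ B ∧ ∀ v : InfinitePlace K, ∑ j, v (b j : K) ≤ B := by
    refine ⟨∑ v : InfinitePlace K, ∑ j, v (b j : K),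
      Finset.sum_nonneg fun v _ => Finset.sum_nonneg fun _ _ => apply_nonneg v _, fun v => ?_⟩
    exact Finset.single_le_sum (f := fun v : InfinitePlace K => ∑ j, v (b j : K))
      (fun v _ => Finset.sum_nonneg fun _ _ => apply_nonneg v _) (Finset.mem_univ v)
  set d := Module.finrank ℚ K
  have hI : Fintype.card I = d := by
    simp only [d]
    rw [← RingOfIntegers.rank K, Module.finrank_eq_card_basis b]
  refine ⟨(2 * (n * B) + 3) ^ (n * d), by positivity, fun r k hr h => ?_⟩
  obtain ⟨N, hN⟩ : ∃ N : ℕ, 0 < N ∧ ∀ v i, r v i ≤ N := by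
    obtain ⟨N, hN⟩ := exists_nat_ge (∑ v, ∑ i, r v i)
    refine ⟨N + 1, by omega, fun v i => ?_⟩
    have h1 := Finset.single_le_sum (f := fun i => r v i) (fun i _ => (hr v i).le) (Finset.mem_univ i)
    have h2 := Finset.single_le_sum (f := fun v => ∑ i, r v i)
      (fun v _ => Finset.sum_nonneg fun i _ => (hr v i).le) (Finset.mem_univ v)
    push_cast
    linarith
  obtain ⟨hN0, hN⟩ := hN
  have hN0' : (0:ℝ) < N := by exact_mod_cast hN0
  let W : (Fin n × I → Fin N) → Fin n → 𝓞 K := fun c i => ∑ j, (((c (i, j) : ℕ) : ℤ)) • b j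
  have hWinj : Function.Injective W := by
    intro c c' hc
    ext ⟨i, j⟩
    have := congrArg (fun x => b.repr x j) (congrFun hc i)
    simp only [W] at this
    rw [b.repr_sum_self, b.repr_sum_self] at this
    exact_mod_cast this
  have hWle : ∀ c (v : InfinitePlace K) i, v ((gact (l (Sum.inl v)) (W c) i : 𝓞 K) : K) ≤ n * B * N := by
    intro c v i
    rw [gact_coe]
    refine (gact_abs v.1 _ _ _).trans ?_
    have : ∀ i, v.1 (W c i : K) ≤ B * N := by
      intro i
      simp only [W, map_sum, zsmul_eq_mul, map_mul]
      refine (v.1.sum_le _ _).trans ?_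
      refine le_trans ?_ (mul_le_mul_of_nonneg_right (hB v) hN0'.le)
      rw [Finset.sum_mul]
      refine Finset.sum_le_sum fun j _ => ?_
      rw [map_mul, mul_comm]
      refine mul_le_mul_of_nonneg_left ?_ (apply_nonneg v _)
      have h1 : v.1 ((((c (i, j) : ℕ) : ℤ) : 𝓞 K) : K) = ((c (i, j) : ℕ) : ℝ) := by
        have := InfinitePlace.norm_embedding_eq v ((c (i, j) : ℕ) : K)
        rw [map_natCast, Complex.norm_natCast] at this
        push_cast
        exact this.symm
      have h2 : v.1 ((algebraMap (𝓞 K) K) (((c (i, j) : ℕ) : ℤ) : 𝓞 K)) = ((c (i, j) : ℕ) : ℝ) := h1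
      rw [h2]
      exact_mod_cast (c (i, j)).2.le
    refine (Finset.sum_le_sum fun i _ => this i).trans ?_
    simp [mul_assoc]
  have hP : 0 ≤ ∏ w : {w // w ∈ T}, ∏ i, (Ideal.absNorm w.1.maximalIdeal.asIdeal : ℝ) ^ k w i :=
    Finset.prod_nonneg fun _ _ => Finset.prod_nonneg fun _ _ => pow_nonneg (Nat.cast_nonneg _) _
  have hnB : 0 ≤ n * B := mul_nonneg (Nat.cast_nonneg _) hB0
  have hnBN : 0 ≤ n * B * N := mul_nonneg hnB hN0'.le
  let L : InfinitePlace K × Fin n → ℕ := fun p => ⌈n * B * N / r p.1 p.2⌉₊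
  have hne : ∀ p : {w // w ∈ T} × Fin n, p.1.1.maximalIdeal.asIdeal ^ k p.1 p.2 ≠ ⊥ := fun p =>
    pow_ne_zero _ p.1.1.maximalIdeal.ne_bot
  have : ∀ p : {w // w ∈ T} × Fin n, Fintype (𝓞 K ⧸ p.1.1.maximalIdeal.asIdeal ^ k p.1 p.2) := fun p =>
    @Fintype.ofFinite _ (Ideal.finiteQuotientOfFreeOfNeBot _ (hne p))
  let f : (Fin n × I → Fin N) → (InfinitePlace K × Fin n → ℤ × ℤ) ×
      (∀ p : {w // w ∈ T} × Fin n, 𝓞 K ⧸ p.1.1.maximalIdeal.asIdeal ^ k p.1 p.2) := fun c =>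
    (fun p => code p.1 (r p.1 p.2) (gact (l (Sum.inl p.1)) (W c) p.2 : 𝓞 K),
      fun p => Ideal.Quotient.mk _ (gact (l (Sum.inr p.1)) (W c) p.2))
  let t := Fintype.piFinset (fun p : InfinitePlace K × Fin n => cellset p.1 (L p)) ×ˢ
    (Finset.univ : Finset (∀ p : {w // w ∈ T} × Fin n, 𝓞 K ⧸ p.1.1.maximalIdeal.asIdeal ^ k p.1 p.2))
  have hcard : t.card < (Finset.univ : Finset (Fin n × I → Fin N)).card := by
    have h1 : (t.card : ℝ) = (∏ v, ∏ i, (2 * (L (v, i) : ℝ) + 1) ^ v.mult) *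
        ∏ w, ∏ i, (Ideal.absNorm w.1.maximalIdeal.asIdeal : ℝ) ^ k w i := by
      rw [Finset.card_product, Fintype.card_piFinset, Finset.card_univ, Fintype.card_pi]
      simp only [cell_card]
      push_cast
      rw [Fintype.prod_prod_type, Fintype.prod_prod_type]
      congr 1
      refine Finset.prod_congr rfl fun w _ => Finset.prod_congr rfl fun i _ => ?_
      rw [← Nat.card_eq_fintype_card, ← Submodule.cardQuot_apply, ← Ideal.absNorm_apply, map_pow]
      push_cast; rfl
    have h4 : (t.card : ℝ) < (N : ℝ) ^ (n * d) := by
      rw [h1]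
      exact count_ineq _ InfinitePlace.sum_mult_eq hP hr hnB hN0' hN
        (fun v i => Nat.ceil_lt_add_one (div_nonneg hnBN (hr v i).le)) h
    have h5 : (Finset.univ : Finset (Fin n × I → Fin N)).card = N ^ (n * d) := by
      simp [hI]
    rw [h5]; exact_mod_cast h4
  obtain ⟨c, -, c', -, hcc, hf⟩ := Finset.exists_ne_map_eq_of_card_lt_of_maps_to hcard (f := f) (by
    intro c _
    refine Finset.mem_coe.2 (Finset.mem_product.2 ⟨Fintype.mem_piFinset.2 fun p => ?_, Finset.mem_univ _⟩)
    refine code_mem _ (hr _ _) _ _ ((hWle c p.1 p.2).trans ?_)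
    rw [← div_le_iff₀ (hr _ _)]
    exact Nat.le_ceil _)
  refine ⟨W c - W c', sub_ne_zero.2 fun h => hcc (hWinj h), fun v i => ?_, fun v i => ?_⟩
  · rw [gact_sub]
    push_cast
    exact code_eq v (hr v i) _ _ (congrFun (congrArg Prod.fst hf) (v, i))
  · rw [gact_sub]
    exact Ideal.Quotient.eq.1 (congrFun (congrArg Prod.snd hf) (v, i))

end N2
end SU

open MvPolynomial
namespace SU
section N3
set_option linter.unusedSectionVars false
open NumberField
variable {K : Type*} [Field K] [NumberField K] {n : ℕ}
variable (T : Finset (FinitePlace K))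

set_option maxHeartbeats 1000000 in
lemma m1_pt (q : ℕ) (hq0 : q ≠ 0) (hq : ∀ w : FinitePlace K, w ∈ T ↔ w (q : K) ≠ 1) (l : Pl T → Option (Fin n)) :
    ∃ C > 0, ∀ (ρ : Pl T → Fin n → ℝ), (∀ v i, 0 < ρ v i) → C < ∏ v, ∏ i, ρ v i ^ pm T v →
    ∃ w : Fin n → K, w ≠ 0 ∧ (∀ i, w i ∈ OT T) ∧ ∀ v i, pabs T v (gact (l v) w i) ≤ ρ v i := by
  obtain ⟨C0, hC0, H⟩ := m1_int T l
  have hqK : (q : K) ≠ 0 := by exact_mod_cast hq0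
  let Nm : {w // w ∈ T} → ℝ := fun w => Ideal.absNorm w.1.maximalIdeal.asIdeal
  have hNm : ∀ w, 1 < Nm w := fun w => by
    have := HeightOneSpectrum.one_lt_absNorm w.1.maximalIdeal
    simp only [Nm]; exact_mod_cast this
  have hNm0 : ∀ w, 0 < Nm w := fun w => one_pos.trans (hNm w)
  have hD : 0 < ∏ w : {w // w ∈ T}, ∏ _i : Fin n, Nm w :=
    Finset.prod_pos fun w _ => Finset.prod_pos fun _ _ => hNm0 w
  refine ⟨C0 * (∏ v : InfinitePlace K, ∏ _i : Fin n, (2:ℝ) ^ v.mult) * ∏ w, ∏ _i : Fin n, Nm w, by positivity,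
    fun ρ hρ hC => ?_⟩
  have hlt : ∀ w : {w // w ∈ T}, w.1 (q : K) < 1 := fun w =>
    lt_of_le_of_ne (by simpa using fin_int_le_one w.1 (q : 𝓞 K)) ((hq _).1 w.2)
  have hex : ∀ p : {w // w ∈ T} × Fin n, ∀ᶠ s : ℕ in Filter.atTop, ρ (Sum.inr p.1) p.2 * p.1.1 (q : K) ^ s < 1 := by
    intro p
    have := (tendsto_pow_atTop_nhds_zero_of_lt_one (apply_nonneg p.1.1 (q : K)) (hlt p.1)).const_mul
      (ρ (Sum.inr p.1) p.2)
    rw [mul_zero] at this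
    exact this.eventually_lt_const one_pos
  obtain ⟨s, hs⟩ := (Filter.eventually_all.2 hex).exists
  have hqs : (q : K) ^ s ≠ 0 := pow_ne_zero _ hqK
  have hqpos : ∀ v, 0 < pabs T v ((q : K) ^ s) := fun v => (pabs T v).pos hqs
  set ρ' : Pl T → Fin n → ℝ := fun v i => ρ v i * pabs T v ((q : K) ^ s) with hρ'
  have hρ'0 : ∀ v i, 0 < ρ' v i := fun v i => mul_pos (hρ v i) (hqpos v)
  have hprod : ∏ v, ∏ i, ρ v i ^ pm T v = ∏ v, ∏ i, ρ' v i ^ pm T v := by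
    simp only [hρ', mul_pow, Finset.prod_mul_distrib, Finset.prod_const]
    rw [Finset.prod_pow, pf_unit T ((q : K) ^ s) (fun w hw => by
      rw [map_pow, not_not.1 (mt (hq w).2 hw), one_pow]) hqs, one_pow, mul_one]
  have hk : ∀ (w : {w // w ∈ T}) i, ∃ k : ℕ, (Nm w ^ k)⁻¹ ≤ ρ' (Sum.inr w) i ∧ ρ' (Sum.inr w) i ≤ Nm w * (Nm w ^ k)⁻¹ := by
    intro w i
    have h1 : ρ' (Sum.inr w) i < 1 := by
      simp only [hρ', map_pow]; exact hs (w, i)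
    obtain ⟨k, hk1, hk2⟩ := exists_nat_pow_near_of_lt_one (hρ'0 (Sum.inr w) i) h1.le (inv_pos.2 (hNm0 w)) (inv_lt_one_of_one_lt₀ (hNm w))
    refine ⟨k + 1, by rw [← inv_pow]; exact hk1.le, hk2.trans (le_of_eq ?_)⟩
    have := (hNm0 w).ne'
    rw [inv_pow, pow_succ]; field_simp
  choose k hk1 hk2 using hk
  obtain ⟨w, hw0, hwi, hwf⟩ := H (fun v i => ρ' (Sum.inl v) i / 2) k (fun v i => half_pos (hρ'0 _ i)) (by
    rw [hprod, Fintype.prod_sum_type] at hC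
    have h1 : ∏ w : {w // w ∈ T}, ∏ i, ρ' (Sum.inr w) i ^ pm T (Sum.inr w) ≤
        (∏ w, ∏ _i : Fin n, Nm w) * (∏ w, ∏ i, Nm w ^ k w i)⁻¹ := by
      rw [← Finset.prod_inv_distrib, ← Finset.prod_mul_distrib]
      refine Finset.prod_le_prod (fun w _ => Finset.prod_nonneg fun i _ => pow_nonneg (hρ'0 _ i).le _) fun w _ => ?_
      rw [← Finset.prod_inv_distrib, ← Finset.prod_mul_distrib]
      refine Finset.prod_le_prod (fun i _ => pow_nonneg (hρ'0 _ i).le _) fun i _ => ?_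
      simp only [pm, pow_one]; exact hk2 w i
    have h2 : 0 ≤ ∏ v : InfinitePlace K, ∏ i, ρ' (Sum.inl v) i ^ pm T (Sum.inl v) :=
      Finset.prod_nonneg fun w _ => Finset.prod_nonneg fun i _ => pow_nonneg (hρ'0 _ i).le _
    have h3 := hC.trans_le (mul_le_mul_of_nonneg_left h1 h2)
    have h4 : 0 < ∏ w, ∏ i, Nm w ^ k w i := Finset.prod_pos fun w _ => Finset.prod_pos fun _ _ => pow_pos (hNm0 w) _
    rw [mul_left_comm, mul_comm (∏ w, ∏ _i : Fin n, Nm w)] at h3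
    have h5 := lt_of_mul_lt_mul_right h3 hD.le
    rw [← div_eq_mul_inv, lt_div_iff₀ h4] at h5
    simp only [div_pow, Finset.prod_div_distrib]
    have h6 : (0:ℝ) < ∏ v : InfinitePlace K, ∏ _i : Fin n, (2:ℝ) ^ v.mult := by positivity
    rw [lt_div_iff₀ h6]
    refine lt_of_eq_of_lt ?_ h5
    simp only [Nm]; ring)
  have hg : ∀ v i, pabs T v (gact (l v) (fun i => (w i : K)) i) ≤ ρ' v i := by
    rintro (v | v) i
    · rw [← gact_coe]; have := hwi v i
      refine le_trans this (le_of_eq (by ring))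
    · rw [← gact_coe]; exact (fin_le_of_mem_pow v.1 _ _ (hwf v i)).trans (hk1 v i)
  refine ⟨((q : K) ^ s)⁻¹ • fun i => (w i : K), ?_, fun i => ?_, fun v i => ?_⟩
  · refine smul_ne_zero (inv_ne_zero hqs) fun h => hw0 (funext fun i => ?_)
    have := congrFun h i
    simpa using this
  · refine (OT T).mul_mem (fun v hv => ?_) (int_mem_OT T _)
    rw [map_inv₀, map_pow, not_not.1 (mt (hq v).2 hv)]; simp
  · rw [gact_smul, Pi.smul_apply, smul_eq_mul, map_mul, map_inv₀, inv_mul_le_iff₀ (hqpos v), mul_comm]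
    exact hg v i
end N3
end SU

open MvPolynomial
namespace SU
section F1
set_option linter.unusedSectionVars false
open NumberField Filter Topology
variable {K : Type*} [Field K] [NumberField K]

noncomputable abbrev UU : Filter ℕ := (hyperfilter ℕ : Filter ℕ)
abbrev SK (K : Type*) := Germ (hyperfilter ℕ : Filter ℕ) K

noncomputable def rep {K : Type*} (α : SK K) : ℕ → K := Classical.choose (Quot.exists_rep α)
lemma rep_eq {K : Type*} (α : SK K) : ((rep α : ℕ → K) : SK K) = α := Classical.choose_spec (Quot.exists_rep α)
lemma rep_coe {K : Type*} (f : ℕ → K) : ∀ᶠ t in UU, rep (f : SK K) t = f t := Germ.coe_eq.1 (rep_eq _)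

lemma height_div_le (T : Finset (FinitePlace K)) (z z' : K) (hz : z ∈ OT T) (hz' : z' ∈ OT T) (h0 : z' ≠ 0) :
    Height.logHeight₁ (z / z') ≤ Real.log (∏ v, (pabs T v z + pabs T v z') ^ pm T v) := by
  classical
  rw [Height.logHeight₁_div_eq_logHeight, Height.logHeight_eq_log_mulHeight,
    NumberField.mulHeight_eq (x := ![z, z']) (fun h => h0 (by simpa using congrFun h 1))]
  have hfin := FinitePlace.hasFiniteMulSupport h0
  have hM : ∀ a : AbsoluteValue K ℝ, ⨆ i, a (![z, z'] i) ≤ a z + a z' := fun a => ciSup_le fun i => by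
    fin_cases i
    · exact le_add_of_nonneg_right (a.nonneg _)
    · exact le_add_of_nonneg_left (a.nonneg _)
  have hM0 : ∀ a : AbsoluteValue K ℝ, 0 < ⨆ i, a (![z, z'] i) := fun a =>
    lt_of_lt_of_le (a.pos h0) (le_ciSup (f := fun i => a (![z, z'] i)) (Set.finite_range _).bddAbove 1)
  have hM1 : ∀ w : FinitePlace K, w ∉ T → ⨆ i, w (![z, z'] i) ≤ 1 := fun w hw => ciSup_le fun i => by
    fin_cases i
    · exact hz w hw
    · exact hz' w hw
  have hfp : ∏ᶠ w : FinitePlace K, ⨆ i, w (![z, z'] i) ≤ ∏ w : {w // w ∈ T}, (w.1.1 z + w.1.1 z') := by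
    rw [finprod_eq_prod_of_mulSupport_subset (s := hfin.toFinset ∪ T)]
    · rw [← Finset.prod_sdiff Finset.subset_union_right, Finset.prod_coe_sort T (fun w => w.1 z + w.1 z')]
      have h1 : ∏ w ∈ (hfin.toFinset ∪ T) \ T, ⨆ i, w (![z, z'] i) ≤ 1 :=
        Finset.prod_le_one (fun w _ => (hM0 w.1).le) fun w hw => hM1 w (Finset.mem_sdiff.1 hw).2
      have h2 : ∏ w ∈ T, ⨆ i, w (![z, z'] i) ≤ ∏ w ∈ T, (w.1 z + w.1 z') :=
        Finset.prod_le_prod (fun w _ => (hM0 w.1).le) fun w _ => hM w.1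
      refine (mul_le_mul_of_nonneg_right h1 (Finset.prod_nonneg fun w _ => (hM0 w.1).le)).trans ?_
      rw [one_mul]; exact h2
    · intro w hw
      by_contra hn
      rw [Finset.mem_coe, Finset.mem_union, not_or] at hn
      refine hw (le_antisymm (hM1 w hn.2) ?_)
      have h1 : w z' = 1 := by by_contra h; exact hn.1 (hfin.mem_toFinset.2 h)
      rw [← h1]
      exact le_ciSup (f := fun i => w (![z, z'] i)) (Set.finite_range _).bddAbove 1
  have hp0 : 0 < ∏ᶠ w : FinitePlace K, ⨆ i, w (![z, z'] i) :=
    finprod_induction (0 < ·) one_pos (fun _ _ => mul_pos) fun w => hM0 w.1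
  rw [Fintype.prod_sum_type]
  simp only [pabs, pm, pow_one]
  refine Real.log_le_log (mul_pos (Finset.prod_pos fun v _ => pow_pos (hM0 v.1) _) hp0) ?_
  · refine mul_le_mul (Finset.prod_le_prod (fun v _ => pow_nonneg (hM0 v.1).le _) fun v _ =>
      pow_le_pow_left₀ (hM0 v.1).le (hM v.1) _) hfp hp0.le
      (Finset.prod_nonneg fun v _ => pow_nonneg (add_nonneg (v.1.nonneg _) (v.1.nonneg _)) _)

lemma pabs_pow_le (T : Finset (FinitePlace K)) (x : K) (v : Pl T) :
    pabs T v x ^ pm T v ≤ Real.exp (Height.logHeight₁ x) := by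
  by_cases h : pabs T v x = 0
  · rw [h, zero_pow (pm_pos T v).ne']; positivity
  have h1 := logH_ge T x v
  have h2 : 0 < pabs T v x := lt_of_le_of_ne ((pabs T v).nonneg _) (Ne.symm h)
  rw [← Real.exp_log (pow_pos h2 _), Real.exp_le_exp, Real.log_pow]
  refine le_trans (mul_le_mul_of_nonneg_left ?_ (Nat.cast_nonneg _)) h1
  exact le_max_right _ _

/-- subfield of germs whose height satisfies `P` -/
def mkSub (P : (ℕ → ℝ) → Prop) (h1 : ∀ c, P fun _ => c) (h2 : ∀ f g, P f → P g → P (f + g))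
    (h3 : ∀ f g : ℕ → ℝ, (∀ᶠ t in UU, f t ≤ g t) → P g → P f) : Subfield (SK K) where
  carrier := {α | P fun t => Height.logHeight₁ (rep α t)}
  mul_mem' := fun {a b} ha hb => by
    refine h3 _ _ ?_ (h2 _ _ ha hb)
    have := rep_coe (rep a * rep b)
    rw [Germ.coe_mul, rep_eq, rep_eq] at this
    filter_upwards [this] with t ht
    rw [ht]; exact Height.logHeight₁_mul_le _ _
  one_mem' := by
    refine h3 _ _ ?_ (h1 0)
    have := rep_coe (1 : ℕ → K)
    filter_upwards [this] with t ht
    have h : rep (1 : SK K) t = 1 := ht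
    rw [h, Height.logHeight₁_one]
  add_mem' := fun {a b} ha hb => by
    refine h3 _ _ ?_ (h2 _ _ (h2 _ _ (h1 (Height.totalWeight K * Real.log 2)) ha) hb)
    have := rep_coe (rep a + rep b)
    rw [Germ.coe_add, rep_eq, rep_eq] at this
    filter_upwards [this] with t ht
    rw [ht]; exact Height.logHeight₁_add_le _ _
  zero_mem' := by
    refine h3 _ _ ?_ (h1 0)
    have := rep_coe (0 : ℕ → K)
    filter_upwards [this] with t ht
    have h : rep (0 : SK K) t = 0 := ht
    rw [h, Height.logHeight₁_zero]
  neg_mem' := fun {a} ha => by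
    refine h3 _ _ ?_ ha
    have := rep_coe (- rep a)
    rw [Germ.coe_neg, rep_eq] at this
    filter_upwards [this] with t ht
    rw [ht, Pi.neg_apply, Height.logHeight₁_neg]
  inv_mem' := fun a ha => by
    refine h3 _ _ ?_ ha
    have := rep_coe (rep a)⁻¹
    rw [Germ.coe_inv, rep_eq] at this
    filter_upwards [this] with t ht
    rw [ht, Pi.inv_apply, Height.logHeight₁_inv]

/-- growth function -/
structure GQ where
  Q : ℕ → ℕ
  pos : ∀ t, 0 < Q t
  top : Tendsto Q UU atTop
variable (q : GQ)

lemma GQ.topR : Tendsto (fun t => (q.Q t : ℝ)) UU atTop := tendsto_natCast_atTop_atTop.comp q.top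
lemma GQ.posR (t : ℕ) : (0:ℝ) < q.Q t := by exact_mod_cast q.pos t

variable (K) in
def FF : Subfield (SK K) := mkSub (fun f => ∃ c : ℝ, ∀ᶠ t in UU, f t ≤ c * q.Q t)
  (fun c => ⟨1, by filter_upwards [q.topR.eventually_ge_atTop c] with t ht; linarith⟩)
  (fun f g ⟨c, hc⟩ ⟨d, hd⟩ => ⟨c + d, by
    filter_upwards [hc, hd] with t h1 h2; rw [add_mul]; exact add_le_add h1 h2⟩)
  (fun f g h ⟨c, hc⟩ => ⟨c, by filter_upwards [h, hc] with t h1 h2 using h1.trans h2⟩)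

variable (K) in
def F0 : Subfield (SK K) := mkSub (fun f => ∀ ε : ℝ, 0 < ε → ∀ᶠ t in UU, f t ≤ ε * q.Q t)
  (fun c ε hε => by
    filter_upwards [q.topR.eventually_ge_atTop (c / ε)] with t ht
    rw [mul_comm]; exact (div_le_iff₀ hε).1 ht)
  (fun f g hc hd ε hε => by
    filter_upwards [hc _ (half_pos hε), hd _ (half_pos hε)] with t h1 h2
    have := add_le_add h1 h2
    rw [← add_mul, add_halves] at this
    exact this)
  (fun f g h hc ε hε => by filter_upwards [h, hc ε hε] with t h1 h2 using h1.trans h2)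

lemma mem_FF (f : ℕ → K) : (f : SK K) ∈ FF K q ↔ ∃ c : ℝ, ∀ᶠ t in UU, Height.logHeight₁ (f t) ≤ c * q.Q t := by
  constructor
  · rintro ⟨c, hc⟩; refine ⟨c, ?_⟩; filter_upwards [hc, rep_coe f] with t h1 h2; rwa [h2] at h1
  · rintro ⟨c, hc⟩; refine ⟨c, ?_⟩; filter_upwards [hc, rep_coe f] with t h1 h2; rwa [h2]

lemma mem_F0 (f : ℕ → K) : (f : SK K) ∈ F0 K q ↔
    ∀ ε : ℝ, 0 < ε → ∀ᶠ t in UU, Height.logHeight₁ (f t) ≤ ε * q.Q t := by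
  constructor
  · intro hc ε hε; filter_upwards [hc ε hε, rep_coe f] with t h1 h2; rwa [h2] at h1
  · intro hc ε hε; filter_upwards [hc ε hε, rep_coe f] with t h1 h2; rwa [h2]

lemma F0_le : F0 K q ≤ FF K q := fun _ hα => ⟨1, hα 1 one_pos⟩

variable (T : Finset (FinitePlace K))
noncomputable def na0 (v : Pl T) (f : ℕ → K) (t : ℕ) : ℝ := pabs T v (f t) ^ ((pm T v : ℝ) / q.Q t)

lemma na0_nonneg (v : Pl T) (f : ℕ → K) (t : ℕ) : 0 ≤ na0 q T v f t := Real.rpow_nonneg ((pabs T v).nonneg _) _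

lemma na0_le {v : Pl T} {f : ℕ → K} {t : ℕ} {c : ℝ} : na0 q T v f t ≤ Real.exp c ↔
    pabs T v (f t) ^ pm T v ≤ Real.exp (q.Q t * c) := by
  have h1 : na0 q T v f t = (pabs T v (f t) ^ pm T v) ^ ((q.Q t : ℝ)⁻¹) := by
    rw [na0, ← Real.rpow_natCast, ← Real.rpow_mul ((pabs T v).nonneg _), div_eq_mul_inv]
  rw [h1, Real.rpow_inv_le_iff_of_pos (pow_nonneg ((pabs T v).nonneg _) _) (Real.exp_pos _).le (q.posR t),
    ← Real.exp_mul, mul_comm]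

noncomputable def nav (v : Pl T) (α : SK K) : ℝ := limUnder UU (na0 q T v (rep α))

lemma nav_tendsto' (v : Pl T) (α : SK K) (h : α ∈ FF K q) : Tendsto (na0 q T v (rep α)) UU (𝓝 (nav q T v α)) := by
  obtain ⟨c, hc⟩ := h
  refine tendsto_nhds_limUnder ?_
  obtain ⟨L, -, hL⟩ := (isCompact_Icc (a := (0:ℝ)) (b := Real.exp c)).ultrafilter_le_nhds
    ((hyperfilter ℕ).map (na0 q T v (rep α))) (by
      rw [Ultrafilter.coe_map, le_principal_iff, mem_map]
      filter_upwards [hc] with t ht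
      refine ⟨na0_nonneg q T v _ t, (na0_le q T).2 ?_⟩
      exact (pabs_pow_le T _ v).trans (Real.exp_le_exp.2 (by linarith [mul_comm c (q.Q t : ℝ)])))
  exact ⟨L, hL⟩

lemma nav_tendsto (v : Pl T) {α : SK K} (h : α ∈ FF K q) {f : ℕ → K} (hf : (f : SK K) = α) :
    Tendsto (na0 q T v f) UU (𝓝 (nav q T v α)) := by
  refine (nav_tendsto' q T v α h).congr' ?_
  have := rep_coe f
  rw [hf] at this
  filter_upwards [this] with t ht
  rw [na0, ht, na0]

lemma exp_tendsto (m : ℝ) : Tendsto (fun t => m / (q.Q t : ℝ)) UU (𝓝 0) := q.topR.const_div_atTop m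

lemma nav_nonneg (v : Pl T) (α : FF K q) : 0 ≤ nav q T v α.1 :=
  ge_of_tendsto' (nav_tendsto' q T v α.1 α.2) fun t => na0_nonneg q T v _ t

lemma nav_add (v : Pl T) (α β : FF K q) : nav q T v (α + β).1 ≤ max (nav q T v α.1) (nav q T v β.1) := by
  have h := ((tendsto_const_nhds (x := (2:ℝ))).rpow (exp_tendsto q (pm T v)) (Or.inl two_ne_zero)).mul
    ((nav_tendsto q T v α.2 (rep_eq _)).max (nav_tendsto q T v β.2 (rep_eq _)))
  rw [Real.rpow_zero, one_mul] at h
  refine le_of_tendsto_of_tendsto' (nav_tendsto q T v (α + β).2 (f := rep α.1 + rep β.1) (by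
    rw [Germ.coe_add, rep_eq, rep_eq]; rfl)) h fun t => ?_
  simp only [na0, Pi.add_apply]
  have he : 0 ≤ (pm T v : ℝ) / q.Q t := by positivity
  have key : ∀ a b s : ℝ, 0 ≤ b → 0 ≤ s → s ≤ 2 * b → b ^ ((pm T v : ℝ) / q.Q t) ≤ a →
      s ^ ((pm T v : ℝ) / q.Q t) ≤ 2 ^ ((pm T v : ℝ) / q.Q t) * a := by
    intro a b s hb hs h1 h2
    refine (Real.rpow_le_rpow hs h1 he).trans ?_
    rw [Real.mul_rpow two_pos.le hb]
    exact mul_le_mul_of_nonneg_left h2 (by positivity)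
  have h1 := (pabs T v).add_le (rep α.1 t) (rep β.1 t)
  rcases le_total (pabs T v (rep α.1 t)) (pabs T v (rep β.1 t)) with h | h
  · exact key _ _ _ ((pabs T v).nonneg _) ((pabs T v).nonneg _) (by linarith) (le_max_right _ _)
  · exact key _ _ _ ((pabs T v).nonneg _) ((pabs T v).nonneg _) (by linarith) (le_max_left _ _)

noncomputable def avF (v : Pl T) : AbsoluteValue (FF K q) ℝ where
  toFun α := nav q T v α.1
  map_mul' := fun α β => by
    have h := (nav_tendsto q T v α.2 (rep_eq _)).mul (nav_tendsto q T v β.2 (rep_eq _))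
    refine tendsto_nhds_unique (nav_tendsto q T v (α * β).2 (f := rep α.1 * rep β.1) (by
      rw [Germ.coe_mul, rep_eq, rep_eq]; rfl)) (h.congr fun t => ?_)
    simp only [na0, Pi.mul_apply, map_mul]
    rw [Real.mul_rpow ((pabs T v).nonneg _) ((pabs T v).nonneg _)]
  nonneg' := nav_nonneg q T v
  eq_zero' := fun α => by
    constructor
    · intro h0
      by_contra hne
      have h := (nav_tendsto q T v α.2 (rep_eq _)).mul (nav_tendsto q T v (α⁻¹).2 (rep_eq _))
      have h1 : nav q T v α.1 * nav q T v (α⁻¹ : FF K q).1 = 1 := by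
        refine tendsto_nhds_unique h (tendsto_const_nhds.congr' ?_)
        have e : ((rep α.1 * rep (α⁻¹ : FF K q).1 : ℕ → K) : SK K) = ((1 : ℕ → K) : SK K) := by
          rw [Germ.coe_mul, rep_eq, rep_eq, Germ.coe_one]
          exact congrArg Subtype.val (mul_inv_cancel₀ hne)
        filter_upwards [Germ.coe_eq.1 e] with t ht
        simp only [na0]
        rw [← Real.mul_rpow ((pabs T v).nonneg _) ((pabs T v).nonneg _), ← map_mul]
        have ht' : rep α.1 t * rep (α⁻¹ : FF K q).1 t = 1 := ht
        rw [ht', map_one, Real.one_rpow]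
      rw [h0, zero_mul] at h1
      exact zero_ne_one h1
    · rintro rfl
      refine tendsto_nhds_unique (nav_tendsto q T v (0 : FF K q).2 (f := 0) rfl) (tendsto_const_nhds.congr fun t => ?_)
      rw [na0, Pi.zero_apply, map_zero, Real.zero_rpow]
      exact div_ne_zero (by exact_mod_cast (pm_pos T v).ne') (q.posR t).ne'
  add_le' := fun α β => (nav_add q T v α β).trans (max_le_add_of_nonneg (nav_nonneg q T v α) (nav_nonneg q T v β))

end F1
end SU

open MvPolynomial
namespace SU
section F2
set_option linter.unusedSectionVars false
open NumberField Filter Topology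
variable {K : Type*} [Field K] [NumberField K] (q : GQ) (T : Finset (FinitePlace K)) {n : ℕ}

lemma map_gact {R S : Type*} [Ring R] [Ring S] (φ : R →+* S) (l : Option (Fin n)) (u : Fin n → R) (i : Fin n) :
    φ (gact l u i) = gact l (fun i => φ (u i)) i := by
  cases l <;> simp only [gact]
  split_ifs <;> simp

lemma gact_germ (l : Option (Fin n)) (α : Fin n → FF K q) (f : ℕ → Fin n → K)
    (hf : ∀ i, ((fun t => f t i : ℕ → K) : SK K) = (α i).1) (i : Fin n) :
    ((fun t => gact l (f t) i : ℕ → K) : SK K) = (gact l α i).1 := by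
  have h1 := map_gact (FF K q).subtype l α i
  have h2 := map_gact (Germ.coeRingHom (hyperfilter ℕ : Filter ℕ)) l (fun i t => f t i) i
  have h3 : gact l (fun i t => f t i) i = fun t => gact l (f t) i := by
    funext t; exact map_gact (Pi.evalRingHom (fun _ => K) t) l (fun i t => f t i) i
  rw [h3] at h2
  refine h2.trans (Eq.trans ?_ h1.symm)
  congr 1
  funext i; exact hf i

lemma av_ev (v : Pl T) {α : FF K q} {f : ℕ → K} (hf : (f : SK K) = α.1) {c : ℝ} (h : avF q T v α < Real.exp c) :
    ∀ᶠ t in UU, pabs T v (f t) ^ pm T v ≤ Real.exp (q.Q t * c) := by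
  filter_upwards [(nav_tendsto q T v α.2 hf).eventually_lt_const h] with t ht
  exact (na0_le q T).1 ht.le

lemma ev_av (v : Pl T) {α : FF K q} {f : ℕ → K} (hf : (f : SK K) = α.1) {c : ℝ}
    (h : ∀ᶠ t in UU, pabs T v (f t) ^ pm T v ≤ Real.exp (q.Q t * c)) : avF q T v α ≤ Real.exp c := by
  refine le_of_tendsto (nav_tendsto q T v α.2 hf) ?_
  filter_upwards [h] with t ht
  exact (na0_le q T).2 ht

def OF : Subring (FF K q) where
  carrier := {α | ∃ f : ℕ → K, (f : SK K) = α.1 ∧ ∀ t, f t ∈ OT T}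
  mul_mem' := by
    rintro a b ⟨f, hf, hf'⟩ ⟨g, hg, hg'⟩
    exact ⟨f * g, by rw [Germ.coe_mul, hf, hg]; rfl, fun t => (OT T).mul_mem (hf' t) (hg' t)⟩
  one_mem' := ⟨1, rfl, fun _ => (OT T).one_mem⟩
  add_mem' := by
    rintro a b ⟨f, hf, hf'⟩ ⟨g, hg, hg'⟩
    exact ⟨f + g, by rw [Germ.coe_add, hf, hg]; rfl, fun t => (OT T).add_mem (hf' t) (hg' t)⟩
  zero_mem' := ⟨0, rfl, fun _ => (OT T).zero_mem⟩
  neg_mem' := by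
    rintro a ⟨f, hf, hf'⟩
    exact ⟨-f, by rw [Germ.coe_neg, hf]; rfl, fun t => (OT T).neg_mem (hf' t)⟩

lemma pf_OF (x : FF K q) (hx : x ∈ OF q T) (hx0 : x ≠ 0) : 1 ≤ ∏ v, avF q T v x := by
  obtain ⟨f, hf, hf'⟩ := hx
  refine ge_of_tendsto (tendsto_finsetProd _ fun v _ => nav_tendsto q T v x.2 hf) ?_
  have hne : ∀ᶠ t in UU, f t ≠ 0 := by
    by_contra h
    rw [← Ultrafilter.eventually_not] at h
    apply hx0
    apply Subtype.ext
    rw [← hf]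
    exact Germ.coe_eq.2 (by filter_upwards [h] with t ht; exact not_not.1 ht)
  filter_upwards [hne] with t ht
  have h1 := pf_OT T (f t) (hf' t) ht
  have h2 : ∏ v, na0 q T v f t = (∏ v, pabs T v (f t) ^ pm T v) ^ ((q.Q t : ℝ)⁻¹) := by
    rw [← Real.finsetProd_rpow _ _ fun v _ => pow_nonneg ((pabs T v).nonneg _) _]
    refine Finset.prod_congr rfl fun v _ => ?_
    rw [na0, ← Real.rpow_natCast, ← Real.rpow_mul ((pabs T v).nonneg _), div_eq_mul_inv]
  rw [h2]
  exact Real.one_le_rpow h1 (inv_nonneg.2 (q.posR t).le)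

lemma m1_F (N : ℕ) (hN0 : N ≠ 0) (hN : ∀ w : FinitePlace K, w ∈ T ↔ w (N : K) ≠ 1) (l : Pl T → Option (Fin n))
    (A : Pl T → Fin n → ℝ) (hA : ∀ v i, 0 < A v i) (hA1 : 1 < ∏ v, ∏ i, A v i) :
    ∃ w : Fin n → FF K q, w ≠ 0 ∧ (∀ i, w i ∈ OF q T) ∧ ∀ v i, avF q T v (gact (l v) w i) ≤ A v i := by
  obtain ⟨C, hC, H⟩ := m1_pt T N hN0 hN l
  let c : Pl T → Fin n → ℝ := fun v i => Real.log (A v i)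
  have hc : ∀ v i, A v i = Real.exp (c v i) := fun v i => (Real.exp_log (hA v i)).symm
  have hs : 0 < ∑ v, ∑ i, c v i := by
    simp only [hc] at hA1
    simp only [← Real.exp_sum] at hA1
    exact (Real.one_lt_exp_iff).1 hA1
  let ρ : ℕ → Pl T → Fin n → ℝ := fun t v i => Real.exp (q.Q t * c v i / pm T v)
  have hpm : ∀ v, (pm T v : ℝ) ≠ 0 := fun v => by exact_mod_cast (pm_pos T v).ne'
  have hρ : ∀ t v i, ρ t v i ^ pm T v = Real.exp (q.Q t * c v i) := by
    intro t v i
    simp only [ρ]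
    rw [← Real.exp_nat_mul, mul_div_cancel₀ _ (hpm v)]
  have hex : ∀ᶠ t in UU, C < ∏ v, ∏ i, ρ t v i ^ pm T v := by
    filter_upwards [(Real.tendsto_exp_atTop.comp (q.topR.atTop_mul_const hs)).eventually_gt_atTop C] with t ht
    refine ht.trans_eq ?_
    simp only [hρ, ← Real.exp_sum, Function.comp, Finset.mul_sum]
  have hw : ∀ t, ∃ w : Fin n → K, (∀ i, w i ∈ OT T) ∧ (C < ∏ v, ∏ i, ρ t v i ^ pm T v →
      w ≠ 0 ∧ ∀ v i, pabs T v (gact (l v) w i) ≤ ρ t v i) := by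
    intro t
    by_cases h : C < ∏ v, ∏ i, ρ t v i ^ pm T v
    · obtain ⟨w, h1, h2, h3⟩ := H (ρ t) (fun v i => Real.exp_pos _) h
      exact ⟨w, h2, fun _ => ⟨h1, h3⟩⟩
    · exact ⟨0, fun _ => (OT T).zero_mem, fun h' => absurd h' h⟩
  choose w hwO hw using hw
  obtain ⟨M, hM0, hM⟩ : ∃ M : ℝ, 0 ≤ M ∧ ∀ v i, c v i / pm T v ≤ M := by
    refine ⟨∑ v, ∑ i, |c v i / pm T v|, by positivity, fun v i => (le_abs_self _).trans ?_⟩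
    refine (Finset.single_le_sum (f := fun i => |c v i / pm T v|) (fun _ _ => abs_nonneg _) (Finset.mem_univ i)).trans ?_
    exact Finset.single_le_sum (f := fun v => ∑ i, |c v i / pm T v|)
      (fun _ _ => Finset.sum_nonneg fun _ _ => abs_nonneg _) (Finset.mem_univ v)
  have hF : ∀ i, ((fun t => w t i : ℕ → K) : SK K) ∈ FF K q := by
    intro i
    rw [mem_FF]
    refine ⟨∑ v, pm T v * (n + M), ?_⟩
    filter_upwards [hex] with t ht
    rw [logH_OT T _ (hwO t i), Finset.sum_mul]
    refine Finset.sum_le_sum fun v _ => ?_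
    rw [mul_assoc]
    refine mul_le_mul_of_nonneg_left ?_ (Nat.cast_nonneg _)
    have h0 : 0 ≤ ((n : ℝ) + M) * q.Q t := by positivity
    refine max_le h0 ?_
    by_cases hz : pabs T v (w t i) = 0
    · rw [hz, Real.log_zero]; exact h0
    rw [Real.log_le_iff_le_exp (lt_of_le_of_ne ((pabs T v).nonneg _) (Ne.symm hz))]
    have h1 := gact_abs (pabs T v) (l v) (gact (l v) (w t)) i
    rw [gact_gact] at h1
    refine h1.trans ?_
    have h2 : ∀ k, pabs T v (gact (l v) (w t) k) ≤ Real.exp (M * q.Q t) := fun k => by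
      refine ((hw t ht).2 v k).trans (Real.exp_le_exp.2 ?_)
      rw [mul_div_assoc, mul_comm]
      exact mul_le_mul_of_nonneg_right (hM v k) (q.posR t).le
    refine (Finset.sum_le_sum fun k _ => h2 k).trans ?_
    rw [Finset.sum_const, Finset.card_univ, Fintype.card_fin, nsmul_eq_mul, add_mul, Real.exp_add]
    refine mul_le_mul_of_nonneg_right ?_ (Real.exp_pos _).le
    have h3 := Real.add_one_le_exp ((n : ℝ) * q.Q t)
    have h4 : (1:ℝ) ≤ q.Q t := by exact_mod_cast q.pos t
    nlinarith [mul_le_mul_of_nonneg_left h4 (Nat.cast_nonneg (α := ℝ) n)]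
  refine ⟨fun i => ⟨_, hF i⟩, ?_, fun i => ⟨fun t => w t i, rfl, fun t => hwO t i⟩, fun v i => ?_⟩
  · intro h0
    have h1 : ∀ i, ∀ᶠ t in UU, w t i = 0 := fun i => Germ.coe_eq.1 (congrArg Subtype.val (congrFun h0 i))
    obtain ⟨t, ht1, ht2⟩ := ((eventually_all.2 h1).and hex).exists
    exact (hw t ht2).1 (funext ht1)
  · rw [hc]
    refine ev_av q T v (gact_germ q (l v) _ w (fun i => rfl) i) ?_
    filter_upwards [hex] with t ht
    rw [← hρ]
    exact pow_le_pow_left₀ ((pabs T v).nonneg _) ((hw t ht).2 v i) _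

noncomputable def gnF (N : ℕ) (hN0 : N ≠ 0) (hN : ∀ w : FinitePlace K, w ∈ T ↔ w (N : K) ≠ 1)
    (l : Pl T → Option (Fin n)) : GN (FF K q) (Pl T) n where
  a := avF q T
  na v α β := nav_add q T v α β
  O := OF q T
  pf := pf_OF q T
  l := l
  m1 := m1_F q T N hN0 hN l

end F2
end SU

open MvPolynomial
namespace SU
section F3
set_option linter.unusedSectionVars false
open NumberField Filter Topology
variable {K : Type*} [Field K] [NumberField K] (q : GQ) (T : Finset (FinitePlace K)) {n : ℕ}

lemma germ_ne_ev {f g : ℕ → K} (h : (f : SK K) ≠ g) : ∀ᶠ t in UU, f t ≠ g t := by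
  rw [Ne, Germ.coe_eq] at h
  exact Ultrafilter.eventually_not.2 h

lemma av_F0_le (v : Pl T) (α : FF K q) (h : α.1 ∈ F0 K q) : avF q T v α ≤ 1 := by
  refine le_of_forall_gt_imp_ge_of_dense fun a ha => ?_
  rw [← Real.exp_log (one_pos.trans ha)]
  refine ev_av q T v (rep_eq _) ?_
  filter_upwards [h _ (Real.log_pos ha)] with t ht
  exact (pabs_pow_le T _ v).trans (Real.exp_le_exp.2 (by rw [mul_comm]; exact ht))

lemma av_F0 (v : Pl T) (α : FF K q) (h : α.1 ∈ F0 K q) (h0 : α ≠ 0) : avF q T v α = 1 := by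
  refine le_antisymm (av_F0_le q T v α h) ?_
  have h1 := av_F0_le q T v α⁻¹ ((F0 K q).inv_mem h)
  rw [map_inv₀] at h1
  exact (inv_le_one₀ ((avF q T v).pos h0)).1 h1

lemma den_F0 (a : SK K) (h : a ∈ F0 K q) : ∃ d : ℕ → ℕ, (∀ t, d t ≠ 0) ∧
    ((fun t => (d t : K) : ℕ → K) : SK K) ∈ F0 K q ∧ ∀ t, (d t : K) * rep a t ∈ OT T := by
  choose d hd0 hd1 hd2 using fun t => exists_nat_le_mulHeight₁ (rep a t)
  refine ⟨d, hd0, ?_, fun t => int_mem_OT T ⟨_, hd2 t⟩⟩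
  rw [mem_F0]
  intro ε hε
  have hS : 0 < 1 + ∑ v, (pm T v : ℝ) := by positivity
  filter_upwards [h _ (div_pos hε hS)] with t ht
  rw [logH_OT T _ (by simpa using int_mem_OT T (d t : 𝓞 K))]
  have hd : (1:ℝ) ≤ d t := by exact_mod_cast Nat.one_le_iff_ne_zero.2 (hd0 t)
  have h1 : ∀ v, Real.posLog (pabs T v (d t : K)) ≤ Height.logHeight₁ (rep a t) := by
    intro v
    refine (Real.posLog_le_posLog ((pabs T v).nonneg _) ((pabs T v).apply_nat_le_self (d t))).trans ?_
    rw [Real.posLog_eq_log (by rw [abs_of_nonneg (by linarith)]; exact hd)]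
    exact Real.log_le_log (by linarith) (hd1 t)
  refine (Finset.sum_le_sum fun v _ => mul_le_mul_of_nonneg_left (h1 v) (Nat.cast_nonneg _)).trans ?_
  rw [← Finset.sum_mul]
  have h2 := Height.zero_le_logHeight₁ (rep a t)
  calc _ ≤ (1 + ∑ v, (pm T v : ℝ)) * Height.logHeight₁ (rep a t) := by nlinarith
    _ ≤ (1 + ∑ v, (pm T v : ℝ)) * (ε / (1 + ∑ v, (pm T v : ℝ)) * q.Q t) := mul_le_mul_of_nonneg_left ht hS.le
    _ = ε * q.Q t := by field_simp

def ext {R : Type*} [Ring R] (u : Fin n → R) : Option (Fin n) → R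
  | none => - ∑ i, u i
  | some i => u i
def sg (l : Option (Fin n)) (i : Fin n) : Option (Fin n) := if l = some i then none else some i

lemma gact_ext {R : Type*} [Ring R] (l : Option (Fin n)) (u : Fin n → R) (i : Fin n) : gact l u i = ext u (sg l i) := by
  cases l with
  | none => simp [gact, sg, ext]
  | some l =>
    by_cases h : i = l
    · subst h; simp [gact, sg, ext]
    · have : l ≠ i := fun h' => h h'.symm
      simp [gact, sg, ext, h, this]

lemma ext_self {R : Type*} [Field R] (l : Option (Fin n)) (u : Fin n → R) : ext u l = - ∑ i, gact l u i := by
  cases l with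
  | none => simp [ext, gact]
  | some l =>
    have := congrFun (gact_gact (some l) u) l
    rw [← neg_neg (∑ i, _)]
    simpa [gact, ext] using this.symm

lemma exists_sg (l j : Option (Fin n)) (h : j ≠ l) : ∃ i, sg l i = j := by
  cases j with
  | some j => exact ⟨j, by rw [sg, if_neg (Ne.symm h)]⟩
  | none => cases l with
    | none => exact absurd rfl h
    | some l => exact ⟨l, by simp [sg]⟩

lemma ext_sum {R : Type*} [Ring R] (u : Fin n → R) : ∑ j, ext u j = 0 := by
  rw [Fintype.sum_option]; simp [ext]

lemma ext_germ (α : Fin n → FF K q) (f : ℕ → Fin n → K)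
    (hf : ∀ i, ((fun t => f t i : ℕ → K) : SK K) = (α i).1) (j : Option (Fin n)) :
    ((fun t => ext (f t) j : ℕ → K) : SK K) = (ext α j).1 := by
  cases j with
  | some i => exact hf i
  | none =>
    simp only [ext]
    push_cast
    simp only [← hf]
    have := map_sum (Germ.coeRingHom (hyperfilter ℕ : Filter ℕ)) (fun i t => f t i) Finset.univ
    refine Eq.trans ?_ (congrArg Neg.neg this)
    refine Eq.trans (congrArg _ ?_) (Germ.coe_neg _)
    funext t; simp

variable (N : ℕ) (hN0 : N ≠ 0) (hN : ∀ w : FinitePlace K, w ∈ T ↔ w (N : K) ≠ 1)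

noncomputable def Mt (x : Option (Fin n) → ℕ → K) (t : ℕ) (u : Fin n → K) : ℝ :=
  ∏ v, (∑ j, pabs T v (ext u j / x j t)) ^ pm T v

lemma Mt_le [NeZero n] (x : Option (Fin n) → ℕ → K) (X : Option (Fin n) → FF K q) (hX : ∀ j, ((x j : ℕ → K) : SK K) = (X j).1)
    (hX0 : ∀ j, X j ≠ 0) (l : Pl T → Option (Fin n)) (hl : ∀ v j, avF q T v (X j) ≤ avF q T v (X (l v)))
    (u : Fin n → FF K q) (hu : u ≠ 0) (f : ℕ → Fin n → K)
    (hf : ∀ i, ((fun t => f t i : ℕ → K) : SK K) = (u i).1) {ε : ℝ} (hε : 0 < ε)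
    (hH : (gnF q T N hN0 hN l).H (fun v i => avF q T v (X (sg (l v) i))) u < Real.exp ε) :
    ∀ᶠ t in UU, Mt T x t (f t) ≤ Real.exp (q.Q t * ((Fintype.card (Pl T) + 2) * ε)) := by
  set G := gnF q T N hN0 hN l
  set A : Pl T → Fin n → ℝ := fun v i => avF q T v (X (sg (l v) i)) with hAd
  have hA : ∀ v i, 0 < A v i := fun v i => (avF q T v).pos (hX0 _)
  have hloc0 : ∀ v, 0 < G.loc A v u := fun v => loc_pos hA v u hu
  have hle : ∀ v j, avF q T v (ext u j) ≤ G.loc A v u * avF q T v (X j) := by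
    have h1 : ∀ v i, avF q T v (gact (l v) u i) ≤ G.loc A v u * A v i := fun v i => le_loc (G := G) hA v u i
    intro v j
    by_cases hj : j = l v
    · rw [hj, ext_self, AbsoluteValue.map_neg]
      refine na_sum (a := avF q T v) (fun α β => nav_add q T v α β) _ _ (mul_nonneg (hloc0 v).le ((avF q T v).nonneg _)) fun i _ => (h1 v i).trans ?_
      exact mul_le_mul_of_nonneg_left (hl v _) (hloc0 v).le
    · obtain ⟨i, hi⟩ := exists_sg (l v) j hj
      have := h1 v i
      rw [gact_ext, hi] at this
      simpa only [hAd, hi] using this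
  have hev : ∀ v j, ∀ᶠ t in UU, pabs T v (ext (f t) j / x j t) ^ pm T v ≤
      Real.exp (q.Q t * (Real.log (G.loc A v u) + ε)) := by
    intro v j
    refine av_ev q T v (α := ext u j / X j) (f := fun t => ext (f t) j / x j t) ?_ ?_
    · have h1 := Germ.coe_div (l := (hyperfilter ℕ : Filter ℕ)) (fun t => ext (f t) j) (x j)
      refine h1.trans ?_
      rw [ext_germ q u f hf, hX]; rfl
    · rw [map_div₀, div_lt_iff₀ ((avF q T v).pos (hX0 j)), Real.exp_add, Real.exp_log (hloc0 v)]
      refine (hle v j).trans_lt (mul_lt_mul_of_pos_right ?_ ((avF q T v).pos (hX0 j)))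
      exact lt_mul_of_one_lt_right (hloc0 v) (Real.one_lt_exp_iff.2 hε)
  have hC : ∀ᶠ t in UU, ∏ v, ((n : ℝ) + 1) ^ pm T v ≤ Real.exp (q.Q t * ε) :=
    (Real.tendsto_exp_atTop.comp (q.topR.atTop_mul_const hε)).eventually_ge_atTop _
  filter_upwards [eventually_all.2 fun v => eventually_all.2 (hev v), hC] with t ht htC
  have h1 : Mt T x t (f t) ≤ ∏ v, (((n : ℝ) + 1) ^ pm T v * Real.exp (q.Q t * (Real.log (G.loc A v u) + ε))) := by
    refine Finset.prod_le_prod (fun v _ => pow_nonneg (Finset.sum_nonneg fun _ _ => (pabs T v).nonneg _) _) fun v _ => ?_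
    obtain ⟨j, hj⟩ := Finite.exists_max fun j => pabs T v (ext (f t) j / x j t)
    have h2 : ∑ j, pabs T v (ext (f t) j / x j t) ≤ (n + 1) * pabs T v (ext (f t) j / x j t) := by
      refine (Finset.sum_le_sum fun k _ => hj k).trans ?_
      simp
    refine (pow_le_pow_left₀ (Finset.sum_nonneg fun _ _ => (pabs T v).nonneg _) h2 _).trans ?_
    rw [mul_pow]
    exact mul_le_mul_of_nonneg_left (ht v j) (by positivity)
  refine h1.trans ?_
  rw [Finset.prod_mul_distrib, ← Real.exp_sum, ← Finset.mul_sum, Finset.sum_add_distrib,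
    ← Real.log_prod fun v _ => (hloc0 v).ne']
  have h3 : Real.log (∏ v, G.loc A v u) ≤ ε := by
    rw [Real.log_le_iff_le_exp (Finset.prod_pos fun v _ => hloc0 v)]
    exact hH.le
  refine (mul_le_mul_of_nonneg_right htC (Real.exp_pos _).le).trans ?_
  rw [← Real.exp_add, Real.exp_le_exp, ← mul_add]
  refine mul_le_mul_of_nonneg_left ?_ (q.posR t).le
  rw [Finset.sum_const, Finset.card_univ, nsmul_eq_mul]
  linarith

end F3
end SU

open MvPolynomial
namespace SU
section F4
set_option linter.unusedSectionVars false
open NumberField Filter Topology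
variable {K : Type*} [Field K] [NumberField K] (q : GQ) (T : Finset (FinitePlace K)) {n : ℕ}
variable (N : ℕ) (hN0 : N ≠ 0) (hN : ∀ w : FinitePlace K, w ∈ T ↔ w (N : K) ≠ 1)

lemma gap [NeZero n] (x : Option (Fin n) → ℕ → K) (X : Option (Fin n) → FF K q) (hX : ∀ j, ((x j : ℕ → K) : SK K) = (X j).1)
    (hx0 : ∀ j t, x j t ≠ 0) (hxu : ∀ j t, ∀ w ∉ T, w (x j t) = 1)
    (hX0 : ∀ j, X j ≠ 0) (l : Pl T → Option (Fin n)) (hl : ∀ v j, avF q T v (X j) ≤ avF q T v (X (l v)))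
    (a : Option (Fin n) → SK K) (ha : ∀ j, a j ∈ F0 K q) (ha0 : ∀ j, a j ≠ 0) (hsum : ∑ j, a j * (X j).1 = 0)
    (hmin : ∀ b : Option (Fin n) → SK K, (∀ j, b j ∈ F0 K q) → ∑ j, b j * (X j).1 = 0 → (∃ j, b j = 0) → ∀ j, b j = 0)
    (y : Fin n → FF K q) (hy : ∀ i, (y i).1 = a (some i) * (X (some i)).1) :
    ∃ Λ : ℝ, 1 < Λ ∧ ∀ u : Fin n → FF K q, (∀ i, u i ∈ OF q T) → u ∉ Submodule.span (FF K q) {y} →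
      Λ ≤ (gnF q T N hN0 hN l).H (fun v i => avF q T v (X (sg (l v) i))) u := by
  by_contra hcon
  push Not at hcon
  let P : ℕ → (Fin n → K) → Prop := fun t u => (∀ i, u i ∈ OT T) ∧
    ∃ i k, u i * rep (y k).1 t ≠ u k * rep (y i).1 t
  have hA : ∀ ε : ℝ, 0 < ε → ∀ᶠ t in UU, ∃ u, P t u ∧ Mt T x t u ≤ Real.exp (q.Q t * ε) := by
    intro ε hε
    have hc : (0:ℝ) < Fintype.card (Pl T) + 2 := by positivity
    obtain ⟨u, huO, hus, huH⟩ := hcon (Real.exp (ε / (Fintype.card (Pl T) + 2)))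
      (Real.one_lt_exp_iff.2 (div_pos hε hc))
    choose f hf hfO using huO
    have hu0 : u ≠ 0 := fun h => hus (h ▸ Submodule.zero_mem _)
    have h1 := Mt_le q T N hN0 hN x X hX hX0 l hl u hu0 (fun t i => f i t) hf (div_pos hε hc) huH
    have h2 : ∃ i k, u i * y k ≠ u k * y i := by
      by_contra h
      push Not at h
      refine hus (Submodule.mem_span_singleton.2 ⟨u 0 / y 0, funext fun i => ?_⟩)
      have hy0 : y 0 ≠ 0 := fun h => by
        have := hy 0
        rw [h] at this
        exact mul_ne_zero (ha0 _) (fun h => hX0 _ (Subtype.ext h)) this.symm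
      rw [Pi.smul_apply, smul_eq_mul, div_mul_eq_mul_div, h 0 i, mul_div_cancel_right₀ _ hy0]
    obtain ⟨i, k, hik⟩ := h2
    have h3 : ((f i * rep (y k).1 : ℕ → K) : SK K) ≠ (f k * rep (y i).1 : ℕ → K) := by
      rw [Germ.coe_mul, Germ.coe_mul, rep_eq, rep_eq, hf, hf]
      exact fun h => hik (Subtype.ext h)
    filter_upwards [h1, germ_ne_ev h3] with t ht ht'
    refine ⟨fun i => f i t, ⟨fun i => hfO i t, i, k, ht'⟩, ht.trans_eq ?_⟩
    rw [mul_div_cancel₀ _ hc.ne']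
  have hu0 : ∀ t, ∃ u0, (∃ u, P t u) → P t u0 ∧ ∀ u, P t u → Mt T x t u0 ≤ Mt T x t u + 1 := by
    intro t
    by_cases h : ∃ u, P t u
    · obtain ⟨u0, hu0, hm⟩ := (measure fun u => ⌊Mt T x t u⌋₊).wf.has_min {u | P t u} h
      refine ⟨u0, fun _ => ⟨hu0, fun u hu => ?_⟩⟩
      have h1 : ⌊Mt T x t u0⌋₊ ≤ ⌊Mt T x t u⌋₊ := not_lt.1 (hm u hu)
      have h2 : 0 ≤ Mt T x t u := Finset.prod_nonneg fun v _ => pow_nonneg (Finset.sum_nonneg fun _ _ => (pabs T v).nonneg _) _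
      have h3 : (⌊Mt T x t u0⌋₊ : ℝ) ≤ ⌊Mt T x t u⌋₊ := by exact_mod_cast h1
      linarith [Nat.lt_floor_add_one (Mt T x t u0), Nat.floor_le h2]
    · exact ⟨0, fun h' => absurd h' h⟩
  choose u0 hu0 using hu0
  have hB : ∀ ε : ℝ, 0 < ε → ∀ᶠ t in UU, P t (u0 t) ∧ Mt T x t (u0 t) ≤ Real.exp (q.Q t * ε) + 1 := by
    intro ε hε
    filter_upwards [hA ε hε] with t ⟨u, hu, hu'⟩
    exact ⟨(hu0 t ⟨u, hu⟩).1, ((hu0 t ⟨u, hu⟩).2 u hu).trans (by linarith)⟩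
  have hP := (hB 1 one_pos).mono fun t h => h.1
  have hj : ∃ i0, ((fun t => u0 t i0 : ℕ → K) : SK K) ≠ (0 : ℕ → K) := by
    by_contra h
    push Not at h
    obtain ⟨t, h1, _, i, k, h3⟩ := ((eventually_all.2 fun i => Germ.coe_eq.1 (h i)).and hP).exists
    apply h3
    simp only [Pi.zero_apply] at h1
    rw [h1, h1, zero_mul, zero_mul]
  obtain ⟨i0, hi0⟩ := hj
  have hXn : ∀ j, (X j).1 ≠ 0 := fun j h => hX0 j (Subtype.ext h)
  let W : Option (Fin n) → SK K := fun j => ((fun t => ext (u0 t) j : ℕ → K) : SK K)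
  let z : Option (Fin n) → ℕ → K := fun j t => ext (u0 t) j / x j t
  have hz : ∀ j, ((z j : ℕ → K) : SK K) = W j / (X j).1 := fun j => by
    rw [← hX]; exact Germ.coe_div (l := (hyperfilter ℕ : Filter ℕ)) (fun t => ext (u0 t) j) (x j)
  have hW0 : W (some i0) ≠ 0 := hi0
  let b : Option (Fin n) → SK K := fun j => ((fun t => z j t / z (some i0) t : ℕ → K) : SK K)
  have hb : ∀ j, b j = (W j / (X j).1) / (W (some i0) / (X (some i0)).1) := fun j => by
    rw [← hz, ← hz]; exact Germ.coe_div (l := (hyperfilter ℕ : Filter ℕ)) (z j) (z (some i0))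
  have hxinv : ∀ j t, (x j t)⁻¹ ∈ OT T := fun j t w hw => by
    rw [map_inv₀, hxu j t w hw, inv_one]
  have hbF : ∀ j, b j ∈ F0 K q := by
    intro j
    rw [mem_F0]
    intro ε hε
    have hC : ∀ᶠ t in UU, (2:ℝ) ^ (∑ v, pm T v) * 2 ≤ Real.exp (q.Q t * (ε/2)) :=
      (Real.tendsto_exp_atTop.comp (q.topR.atTop_mul_const (half_pos hε))).eventually_ge_atTop _
    filter_upwards [hB _ (half_pos hε), germ_ne_ev hi0, hC] with t ⟨hPt, hMt⟩ hne hCt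
    have hO : ∀ j, ext (u0 t) j ∈ OT T := fun j => by
      cases j with
      | some i => exact hPt.1 i
      | none => exact (OT T).neg_mem ((OT T).sum_mem fun i _ => hPt.1 i)
    have hzO : ∀ j, z j t ∈ OT T := fun j => by
      simp only [z, div_eq_mul_inv]; exact (OT T).mul_mem (hO j) (hxinv j t)
    have hz0 : z (some i0) t ≠ 0 := div_ne_zero hne (hx0 _ _)
    refine (height_div_le T _ _ (hzO j) (hzO _) hz0).trans ?_
    rw [Real.log_le_iff_le_exp (Finset.prod_pos fun v _ => pow_pos (add_pos_of_nonneg_of_pos ((pabs T v).nonneg _) ((pabs T v).pos hz0)) _)]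
    calc _ ≤ ∏ v, (2:ℝ) ^ pm T v * (∑ j, pabs T v (z j t)) ^ pm T v := by
          refine Finset.prod_le_prod (fun v _ => pow_nonneg (add_nonneg ((pabs T v).nonneg _) ((pabs T v).nonneg _)) _) fun v _ => ?_
          rw [← mul_pow]
          have h1 : ∀ j, pabs T v (z j t) ≤ ∑ j, pabs T v (z j t) := fun j =>
            Finset.single_le_sum (f := fun j => pabs T v (z j t)) (fun _ _ => (pabs T v).nonneg _) (Finset.mem_univ j)
          refine pow_le_pow_left₀ (add_nonneg ((pabs T v).nonneg _) ((pabs T v).nonneg _)) ?_ _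
          linarith [h1 j, h1 (some i0)]
      _ = (2:ℝ) ^ (∑ v, pm T v) * Mt T x t (u0 t) := by
          rw [Finset.prod_mul_distrib, Finset.prod_pow_eq_pow_sum]; rfl
      _ ≤ (2:ℝ) ^ (∑ v, pm T v) * (2 * Real.exp (q.Q t * (ε/2))) := by
          refine mul_le_mul_of_nonneg_left (hMt.trans ?_) (by positivity)
          have := Real.one_le_exp (mul_nonneg (q.posR t).le (half_pos hε).le)
          linarith
      _ ≤ Real.exp (q.Q t * (ε/2)) * Real.exp (q.Q t * (ε/2)) := by
          rw [← mul_assoc]; exact mul_le_mul_of_nonneg_right hCt (Real.exp_pos _).le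
      _ = Real.exp (ε * q.Q t) := by rw [← Real.exp_add]; ring_nf
  have hWs : ∑ j, W j = 0 := by
    have := map_sum (Germ.coeRingHom (hyperfilter ℕ : Filter ℕ)) (fun j t => ext (u0 t) j) Finset.univ
    refine this.symm.trans ?_
    have h2 : (∑ j, fun t => ext (u0 t) j) = (0 : ℕ → K) := by
      funext t; rw [Finset.sum_apply]; exact ext_sum (u0 t)
    rw [h2]; rfl
  have hbs : ∑ j, b j * (X j).1 = 0 := by
    have : ∀ j, b j * (X j).1 = (W (some i0) / (X (some i0)).1)⁻¹ * W j := fun j => by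
      rw [hb]; field_simp [hXn j]
    simp only [this, ← Finset.mul_sum, hWs, mul_zero]
  set c := b (some i0) / a (some i0) with hc
  have hprop := hmin (fun j => b j - c * a j)
    (fun j => (F0 K q).sub_mem (hbF j) ((F0 K q).mul_mem ((F0 K q).div_mem (hbF _) (ha _)) (ha _)))
    (by simp only [sub_mul, Finset.sum_sub_distrib, hbs, mul_assoc, ← Finset.mul_sum, hsum]; simp)
    ⟨some i0, by rw [hc, div_mul_cancel₀ _ (ha0 _), sub_self]⟩
  have hWW : ∀ i k, W (some i) * (y k).1 = W (some k) * (y i).1 := by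
    intro i k
    have h1 : ∀ i, W (some i) = c * (W (some i0) / (X (some i0)).1) * (a (some i) * (X (some i)).1) := fun i => by
      have h2 : b (some i) = c * a (some i) := sub_eq_zero.1 (hprop (some i))
      have h3 := hb (some i)
      rw [h2] at h3
      have h4 := hXn (some i)
      have h5 := hXn (some i0)
      have e : W (some i) / (X (some i)).1 = c * a (some i) * (W (some i0) / (X (some i0)).1) := by
        rw [h3, div_mul_cancel₀ _ (div_ne_zero hW0 h5)]
      rw [div_eq_iff h4] at e
      rw [e]; ring
    rw [h1 i, h1 k, hy, hy]; ring
  have hev : ∀ i k, ∀ᶠ t in UU, u0 t i * rep (y k).1 t = u0 t k * rep (y i).1 t := by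
    intro i k
    have h := hWW i k
    rw [← rep_eq (y k).1, ← rep_eq (y i).1] at h
    exact Germ.coe_eq.1 h
  obtain ⟨t, h1, _, i, k, h3⟩ := ((eventually_all.2 fun i => eventually_all.2 (hev i)).and hP).exists
  exact h3 (h1 i k)

end F4
end SU

open MvPolynomial
namespace SU
section F5
set_option linter.unusedSectionVars false
open NumberField Filter Topology
variable {K : Type*} [Field K] [NumberField K] (q : GQ) (T : Finset (FinitePlace K)) {n : ℕ}

lemma gst_germ (l : Option (Fin n)) (α : Fin n → FF K q) (f : ℕ → Fin n → K)
    (hf : ∀ i, ((fun t => f t i : ℕ → K) : SK K) = (α i).1) (i : Fin n) :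
    ((fun t => gst l (f t) i : ℕ → K) : SK K) = (gst l α i).1 := by
  cases l with
  | none => exact hf i
  | some l =>
    simp only [gst]
    split_ifs
    · push_cast; rw [← hf]; rfl
    · push_cast; rw [← hf, ← hf]; rfl

lemma span_pt (M : Matrix (Fin n) (Fin n) K) (hM : M.det ≠ 0) (j0 : Fin n) (y : Fin n → K) (c : K)
    (hc : ∀ i, M i j0 = c * y i) (u : Fin n → K) (hu : ∑ i, u i * y i = 0) :
    ∃ lam : Fin n → K, ∀ i, u i = ∑ j, lam j * (if j = j0 then 0 else M.adjugate j i) := by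
  refine ⟨fun j => (Matrix.vecMul u M) j / M.det, fun i => ?_⟩
  have h1 : Matrix.vecMul (Matrix.vecMul u M) M.adjugate = M.det • u := by
    rw [Matrix.vecMul_vecMul, Matrix.mul_adjugate, Matrix.vecMul_smul, Matrix.vecMul_one]
  have h2 := congrFun h1 i
  have h3 : Matrix.vecMul u M j0 = 0 := by
    simp only [Matrix.vecMul, dotProduct, hc]
    calc _ = c * ∑ i, u i * y i := by rw [Finset.mul_sum]; exact Finset.sum_congr rfl fun _ _ => by ring
      _ = 0 := by rw [hu, mul_zero]
  rw [Pi.smul_apply, smul_eq_mul] at h2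
  rw [← mul_right_inj' hM, ← h2, Finset.mul_sum]
  simp only [Matrix.vecMul, dotProduct] at h3 ⊢
  refine Finset.sum_congr rfl fun j _ => ?_
  by_cases hj : j = j0
  · rw [if_pos hj, hj, h3]; ring
  · rw [if_neg hj]; field_simp

lemma low_bd (x0 x1 r0 r1 : ℕ → K) (hx : ∀ t, x1 t / x0 t ∈ OT T) (hr : ((fun t => r1 t / r0 t : ℕ → K) : SK K) ∈ F0 K q)
    (hr0 : (r0 : SK K) ≠ 0) (hr1 : (r1 : SK K) ≠ 0)
    (hξ : ((fun t => x1 t / x0 t : ℕ → K) : SK K) ∉ F0 K q) :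
    ∃ ε : ℝ, 0 < ε ∧ ∀ᶠ t in UU, ε * q.Q t ≤
      Real.log (∏ v, max 1 (pabs T v (-(r1 t * x1 t / (r0 t * x0 t)))) ^ pm T v) := by
  rw [mem_F0] at hξ
  push Not at hξ
  obtain ⟨ε, hε, h⟩ := hξ
  have h1 : ∀ᶠ t in UU, ε * q.Q t < Height.logHeight₁ (x1 t / x0 t) := by simpa using h
  have hr' := (F0 K q).inv_mem hr
  have hr'' : ((fun t => r0 t / r1 t : ℕ → K) : SK K) ∈ F0 K q := by
    convert hr' using 1
    refine Eq.trans ?_ (Germ.coe_inv _)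
    congr 1; funext t; simp
  have hc : (0:ℝ) < 2 * (Fintype.card (Pl T) + 1) := by positivity
  refine ⟨ε/2, half_pos hε, ?_⟩
  filter_upwards [h1, (mem_F0 q _).1 hr'' _ (div_pos hε hc), germ_ne_ev hr0, germ_ne_ev hr1] with t ht htr h0 h0'
  have e : Real.log (∏ v, max 1 (pabs T v (-(r1 t * x1 t / (r0 t * x0 t)))) ^ pm T v) =
      ∑ v, pm T v * Real.posLog (pabs T v (-(r1 t * x1 t / (r0 t * x0 t)))) := by
    rw [Real.log_prod fun v _ => (pow_pos (lt_of_lt_of_le one_pos (le_max_left _ _)) _).ne']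
    refine Finset.sum_congr rfl fun v _ => ?_
    rw [Real.log_pow, Real.posLog_eq_log_max_one ((pabs T v).nonneg _)]
  rw [logH_OT T _ (hx t)] at ht
  have h2 : ∀ v, (pm T v : ℝ) * Real.posLog (pabs T v (x1 t / x0 t)) ≤
      pm T v * Real.posLog (pabs T v (-(r1 t * x1 t / (r0 t * x0 t)))) + ε / (2 * (Fintype.card (Pl T) + 1)) * q.Q t := by
    intro v
    have h3 := logH_ge T (r0 t / r1 t) v
    have h4 : pabs T v (x1 t / x0 t) = pabs T v (-(r1 t * x1 t / (r0 t * x0 t))) * pabs T v (r0 t / r1 t) := by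
      rw [AbsoluteValue.map_neg, ← map_mul]
      congr 1
      have : r0 t ≠ 0 := h0
      have : r1 t ≠ 0 := h0'
      by_cases hx : x0 t = 0
      · simp [hx]
      · field_simp
    have h5 := Real.posLog_mul (x := pabs T v (-(r1 t * x1 t / (r0 t * x0 t)))) (y := pabs T v (r0 t / r1 t))
    rw [← h4] at h5
    have h6 := mul_le_mul_of_nonneg_left h5 (Nat.cast_nonneg (α := ℝ) (pm T v))
    linarith
  have h3 := ht.trans_le (Finset.sum_le_sum fun v _ => h2 v)
  rw [Finset.sum_add_distrib, Finset.sum_const, Finset.card_univ, nsmul_eq_mul] at h3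
  rw [e]
  have h4 : (Fintype.card (Pl T) : ℝ) * (ε / (2 * (Fintype.card (Pl T) + 1)) * q.Q t) ≤ ε / 2 * q.Q t := by
    rw [← mul_assoc]
    refine mul_le_mul_of_nonneg_right ?_ (q.posR t).le
    rw [← mul_div_assoc, div_le_div_iff₀ hc two_pos]
    nlinarith
  linarith

lemma adj_OT (M : Matrix (Fin n) (Fin n) K) (hM : ∀ i j, M i j ∈ OT T) (i j : Fin n) : M.adjugate i j ∈ OT T := by
  let M' : Matrix (Fin n) (Fin n) (OT T) := Matrix.of fun i j => ⟨M i j, hM i j⟩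
  have h : M = (OT T).subtype.mapMatrix M' := by ext i j; rfl
  rw [h, ← RingHom.map_adjugate]
  exact (M'.adjugate i j).2

lemma core_b (x : Option (Fin n) → ℕ → K) (X : Option (Fin n) → FF K q) (hX : ∀ j, ((x j : ℕ → K) : SK K) = (X j).1)
    (hx0 : ∀ j t, x j t ≠ 0) (hxu : ∀ j t, ∀ w ∉ T, w (x j t) = 1)
    (a : Option (Fin n) → SK K) (ha : ∀ j, a j ∈ F0 K q) (ha0 : ∀ j, a j ≠ 0)
    (i0 i1 : Fin n) (hi : i0 ≠ i1) (hξ : (X (some i1)).1 / (X (some i0)).1 ∉ F0 K q)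
    (r : Option (Fin n) → ℕ → K) (hr : ∀ j, ((r j : ℕ → K) : SK K) = a j)
    (l : Pl T → Option (Fin n)) (y : Fin n → FF K q) (yt : ℕ → Fin n → K) (hytd : ∀ t i, yt t i = r (some i) t * x (some i) t)
    (hyt : ∀ i, ((fun t => yt t i : ℕ → K) : SK K) = (y i).1)
    (U : Matrix (Fin n) (Fin n) (FF K q)) (j0 : Fin n) (B : Pl T → Fin n → ℝ) (hUO : ∀ i j, U i j ∈ OF q T) (hUd : U.det ≠ 0)
    (cc : FF K q) (hcc : ∀ i, U i j0 = cc * y i) (hB0 : ∀ v i, 0 < B v i) (hB1 : ∏ v, ∏ i, B v i < 1)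
    (hUB : ∀ j ≠ j0, ∀ v i, avF q T v (gst (l v) (U.adjugate j) i) ≤ B v i) : False := by
  choose f hf hfO using hUO
  let M : Matrix (Fin n) (Fin n) (ℕ → K) := Matrix.of f
  let Mt : ℕ → Matrix (Fin n) (Fin n) K := fun t => Matrix.of fun i j => f i j t
  have hM1 : (Germ.coeRingHom (hyperfilter ℕ : Filter ℕ)).mapMatrix M = (FF K q).subtype.mapMatrix U := by
    ext i j; exact hf i j
  have hM2 : ∀ t, (Pi.evalRingHom (fun _ => K) t).mapMatrix M = Mt t := fun t => rfl
  have hadj : ∀ i j, ((fun t => (Mt t).adjugate i j : ℕ → K) : SK K) = (U.adjugate i j).1 := by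
    intro i j
    have h1 := congrArg (fun A : Matrix _ _ (SK K) => A.adjugate i j) hM1
    simp only [← RingHom.map_adjugate] at h1
    refine Eq.trans ?_ h1
    refine congrArg (Germ.coeRingHom (hyperfilter ℕ : Filter ℕ)) (funext fun t => ?_)
    rw [← hM2, ← RingHom.map_adjugate]; rfl
  have hdet : ∀ᶠ t in UU, (Mt t).det ≠ 0 := by
    have h1 := congrArg (fun A : Matrix _ _ (SK K) => A.det) hM1
    simp only [← RingHom.map_det] at h1
    have h2 : ((M.det : ℕ → K) : SK K) ≠ (0 : ℕ → K) := fun h => hUd (Subtype.ext (h1.symm.trans h))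
    filter_upwards [germ_ne_ev h2] with t ht
    rw [← hM2, ← RingHom.map_det]; exact ht
  have hcol : ∀ i, ∀ᶠ t in UU, Mt t i j0 = rep cc.1 t * yt t i := by
    intro i
    have h1 := congrArg Subtype.val (hcc i)
    rw [← hf] at h1
    refine Germ.coe_eq.1 (h1.trans ?_)
    rw [Subfield.coe_mul, ← hyt]
    nth_rw 1 [← rep_eq cc.1]; rfl
  set S := ∑ v, ∑ i, Real.log (B v i) with hS
  have hS0 : S < 0 := by
    have : Real.log (∏ v, ∏ i, B v i) = S := by
      rw [Real.log_prod fun v _ => (Finset.prod_pos fun i _ => hB0 v i).ne']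
      exact Finset.sum_congr rfl fun v _ => Real.log_prod fun i _ => (hB0 v i).ne'
    rw [← this]
    exact Real.log_neg (Finset.prod_pos fun v _ => Finset.prod_pos fun i _ => hB0 v i) hB1
  have hcd : (0:ℝ) < Fintype.card (Pl T) * n + 1 := by positivity
  set δ := -S / (Fintype.card (Pl T) * n + 1) with hδ
  have hδ0 : 0 < δ := div_pos (neg_pos.2 hS0) hcd
  let c : Pl T → Fin n → ℝ := fun v i => Real.log (B v i) + δ
  have hc : ∑ v, ∑ i, c v i < 0 := by
    have h1 : δ * (Fintype.card (Pl T) * n + 1) = -S := div_mul_cancel₀ _ hcd.ne'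
    simp only [c, Finset.sum_add_distrib, Finset.sum_const, Finset.card_univ, Fintype.card_fin, nsmul_eq_mul]
    nlinarith
  have hbd : ∀ v j i, ∀ᶠ t in UU, j ≠ j0 → pabs T v (gst (l v) ((Mt t).adjugate j) i) ^ pm T v ≤ Real.exp (q.Q t * c v i) := by
    intro v j i
    by_cases hj : j = j0
    · exact Eventually.of_forall fun t h => absurd hj h
    refine (av_ev q T v (gst_germ q (l v) (U.adjugate j) (fun t => (Mt t).adjugate j) (hadj j) i) ?_).mono fun t h _ => h
    refine (hUB j hj v i).trans_lt ?_
    rw [Real.exp_add, Real.exp_log (hB0 v i)]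
    exact lt_mul_of_one_lt_right (hB0 v i) (Real.one_lt_exp_iff.2 hδ0)
  have hrne : ∀ j, ((r j : ℕ → K) : SK K) ≠ 0 := fun j => by rw [hr]; exact ha0 j
  obtain ⟨ε, hε, hlow⟩ := low_bd q T (x (some i0)) (x (some i1)) (r (some i0)) (r (some i1))
    (fun t w hw => by rw [map_div₀, hxu _ _ w hw, hxu _ _ w hw, div_one])
    (by
      have := (F0 K q).div_mem (ha (some i1)) (ha (some i0))
      rw [← hr, ← hr, ← Germ.coe_div] at this; exact this) (hrne _) (hrne _)
    (by rw [← hX, ← hX, ← Germ.coe_div] at hξ; exact hξ)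
  let D : PD K (Pl T) := { a := pabs T, m := pm T, O := OT T, pf := pf_OT T }
  obtain ⟨m, ρ, hρ, Ω, H⟩ := final_E D (pm_pos T) l c hc ε hε i0 i1 hi n
  let P : ℕ → Prop := fun t => Ω ≤ q.Q t ∧ (Mt t).det ≠ 0 ∧ (∀ i, Mt t i j0 = rep cc.1 t * yt t i) ∧
    (∀ v j i, j ≠ j0 → pabs T v (gst (l v) ((Mt t).adjugate j) i) ^ pm T v ≤ Real.exp (q.Q t * c v i)) ∧
    yt t i0 ≠ 0 ∧ ε * q.Q t ≤ Real.log (D.H (-(yt t i1 / yt t i0)))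
  have hP : ∀ᶠ t in UU, P t := by
    filter_upwards [q.topR.eventually_ge_atTop Ω, hdet, eventually_all.2 hcol,
      eventually_all.2 fun v => eventually_all.2 fun j => eventually_all.2 (hbd v j), germ_ne_ev (hrne (some i0)), hlow]
      with t h1 h2 h3 h4 h5 h6
    refine ⟨h1, h2, h3, h4, ?_, ?_⟩
    · rw [hytd]; exact mul_ne_zero h5 (hx0 _ t)
    · rw [hytd, hytd]; exact h6
  obtain ⟨s, hs, hs'⟩ := exists_seq_of_forall_finset_exists P (fun t t' => (q.Q t : ℝ) ≤ ρ * q.Q t') (by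
    intro F _
    refine (hP.and ((Finset.eventually_all F).2 fun t _ => ?_)).exists
    filter_upwards [q.topR.eventually_ge_atTop (q.Q t / ρ)] with t' ht'
    rwa [div_le_iff₀' hρ] at ht')
  refine H (fun h => q.Q (s h)) (fun h j i => if j = j0 then 0 else (Mt (s h)).adjugate j i) (fun h => yt (s h))
    (fun h => (hs h).1) (fun h h' hh => ?_) (fun h j i => ?_) (fun v h j i => ?_) (fun h => (hs h).2.2.2.2.1)
    (fun h u hu => ?_) (fun h => (hs h).2.2.2.2.2)
  · rcases lt_or_gt_of_ne (fun e => hh (Fin.ext e) : (h : ℕ) ≠ h') with e | e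
    · exact Or.inl (hs' _ _ e)
    · exact Or.inr (hs' _ _ e)
  · split_ifs
    · exact (OT T).zero_mem
    · exact adj_OT T _ (fun i j => hfO i j _) _ _
  · by_cases hj : j = j0
    · simp only [hj, if_true]
      have : gst (l v) (fun _ => (0:K)) i = 0 := by cases l v <;> simp [gst]
      rw [this, map_zero, zero_pow (pm_pos T v).ne']
      exact (Real.exp_pos _).le
    · simp only [hj, if_false]
      exact (hs h).2.2.2.1 v j i hj
  · exact span_pt (Mt (s h)) (hs h).2.1 j0 (yt (s h)) _ (hs h).2.2.1 u hu

lemma core0 (N : ℕ) (hN0 : N ≠ 0) (hN : ∀ w : FinitePlace K, w ∈ T ↔ w (N : K) ≠ 1) (hn : 2 ≤ n) (x : Option (Fin n) → ℕ → K) (X : Option (Fin n) → FF K q) (hX : ∀ j, ((x j : ℕ → K) : SK K) = (X j).1)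
    (hx0 : ∀ j t, x j t ≠ 0) (hxu : ∀ j t, ∀ w ∉ T, w (x j t) = 1)
    (a : Option (Fin n) → SK K) (ha : ∀ j, a j ∈ F0 K q) (ha0 : ∀ j, a j ≠ 0) (hsum : ∑ j, a j * (X j).1 = 0)
    (hmin : ∀ b : Option (Fin n) → SK K, (∀ j, b j ∈ F0 K q) → ∑ j, b j * (X j).1 = 0 → (∃ j, b j = 0) → ∀ j, b j = 0)
    (i0 i1 : Fin n) (hi : i0 ≠ i1) (hξ : (X (some i1)).1 / (X (some i0)).1 ∉ F0 K q)
    (r : Option (Fin n) → ℕ → K) (hr : ∀ j, ((r j : ℕ → K) : SK K) = a j) (hrO : ∀ j t, r j t ∈ OT T) : False := by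
  have : NeZero n := ⟨by omega⟩
  have hX0 : ∀ j, X j ≠ 0 := fun j h => by
    have h1 := hX j
    rw [h] at h1
    obtain ⟨t, ht⟩ := (Germ.coe_eq.1 (h1 : ((x j : ℕ → K) : SK K) = (0 : ℕ → K))).exists
    exact hx0 j t ht
  choose l hl using fun v => Finite.exists_max fun j => avF q T v (X j)
  let aF : Option (Fin n) → FF K q := fun j => ⟨a j, F0_le q (ha _)⟩
  let y : Fin n → FF K q := fun i => aF (some i) * X (some i)
  have hyd : ∀ i, (y i).1 = a (some i) * (X (some i)).1 := fun i => rfl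
  let yt : ℕ → Fin n → K := fun t i => r (some i) t * x (some i) t
  have hyt : ∀ i, ((fun t => yt t i : ℕ → K) : SK K) = (y i).1 := fun i => by
    rw [hyd, ← hX, ← hr]; rfl
  have hext : ∀ j, ext y j = aF j * X j := by
    intro j
    cases j with
    | some i => rfl
    | none =>
      apply Subtype.ext
      rw [Fintype.sum_option] at hsum
      simp only [ext]; push_cast
      simp only [hyd]
      exact (eq_neg_of_add_eq_zero_left hsum).symm
  let A : Pl T → Fin n → ℝ := fun v i => avF q T v (X (sg (l v) i))
  have hA : ∀ v i, 0 < A v i := fun v i => (avF q T v).pos (hX0 _)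
  let G := gnF q T N hN0 hN l
  have hyH : G.H A y ≤ 1 := by
    refine Finset.prod_le_one (fun v _ => loc_nonneg hA v y) fun v _ => loc_le (G := G) hA v y fun i => ?_
    change avF q T v (gact (l v) y i) ≤ 1 * avF q T v (X (sg (l v) i))
    rw [gact_ext, hext, map_mul, av_F0 q T v (aF _) (ha (sg (l v) i)) (fun h => ha0 _ (congrArg Subtype.val h))]
  obtain ⟨Λ, hΛ, hgap⟩ := gap q T N hN0 hN x X hX hx0 hxu hX0 l hl a ha ha0 hsum hmin y hyd
  have hy0 : y ≠ 0 := fun h => mul_ne_zero (ha0 (some i0)) (fun h => hX0 (some i0) (Subtype.ext h))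
    (congrArg Subtype.val (congrFun h i0))
  have hxO : ∀ j t, x j t ∈ OT T := fun j t w hw => (hxu j t w hw).le
  obtain ⟨U, j0, B, hUO, hUd, ⟨cc, hcc⟩, hB0, hB1, hUB⟩ := gn_main (G := G) hA hn
    (Sum.inl (Classical.arbitrary (InfinitePlace K))) y hy0
    (fun i => ⟨fun t => yt t i, hyt i, fun t => (OT T).mul_mem (hrO _ t) (hxO _ t)⟩) hyH hΛ hgap
  exact core_b q T x X hX hx0 hxu a ha ha0 i0 i1 hi hξ r hr l y yt (fun _ _ => rfl) hyt U j0 B hUO hUd cc hcc hB0 hB1 hUB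

theorem core (N : ℕ) (hN0 : N ≠ 0) (hN : ∀ w : FinitePlace K, w ∈ T ↔ w (N : K) ≠ 1) (hn : 2 ≤ n) (x : Option (Fin n) → ℕ → K) (hXF : ∀ j, ((x j : ℕ → K) : SK K) ∈ FF K q)
    (hx0 : ∀ j t, x j t ≠ 0) (hxu : ∀ j t, ∀ w ∉ T, w (x j t) = 1)
    (a : Option (Fin n) → SK K) (ha : ∀ j, a j ∈ F0 K q) (ha0 : ∀ j, a j ≠ 0) (hsum : ∑ j, a j * ((x j : ℕ → K) : SK K) = 0)
    (hmin : ∀ b : Option (Fin n) → SK K, (∀ j, b j ∈ F0 K q) → ∑ j, b j * ((x j : ℕ → K) : SK K) = 0 → (∃ j, b j = 0) → ∀ j, b j = 0)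
    (i0 i1 : Fin n) (hi : i0 ≠ i1) (hξ : ((x (some i1) : ℕ → K) : SK K) / ((x (some i0) : ℕ → K) : SK K) ∉ F0 K q) : False := by
  classical
  choose d hd0 hdF hdO using fun j => den_F0 q T (a j) (ha j)
  let D : SK K := ∏ j, ((fun t => (d j t : K) : ℕ → K) : SK K)
  have hDF : D ∈ F0 K q := prod_mem fun j _ => hdF j
  have hD0 : D ≠ 0 := Finset.prod_ne_zero_iff.2 fun j _ h => by
    obtain ⟨t, ht⟩ := (Germ.coe_eq.1 (h : ((fun t => (d j t : K) : ℕ → K) : SK K) = (0 : ℕ → K))).exists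
    exact hd0 j t (Nat.cast_eq_zero.1 ht)
  refine core0 q T N hN0 hN hn x (fun j => ⟨_, hXF j⟩) (fun _ => rfl) hx0 hxu (fun j => D * a j)
    (fun j => (F0 K q).mul_mem hDF (ha j)) (fun j => mul_ne_zero hD0 (ha0 j))
    (by simp only [mul_assoc, ← Finset.mul_sum, hsum, mul_zero]) hmin i0 i1 hi hξ
    (fun j t => (∏ k, (d k t : K)) * rep (a j) t) (fun j => ?_) (fun j t => ?_)
  · have h1 := map_prod (Germ.coeRingHom (hyperfilter ℕ : Filter ℕ)) (fun j t => (d j t : K)) Finset.univ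
    change _ = D at h1
    rw [← h1]
    nth_rw 2 [← rep_eq (a j)]
    refine Eq.trans ?_ (Germ.coe_mul _ _)
    congr 1; funext t; simp
  · rw [← Finset.mul_prod_erase _ _ (Finset.mem_univ j), mul_right_comm]
    refine (OT T).mul_mem (hdO j t) ((OT T).prod_mem fun k _ => natCast_mem (OT T) _)

end F5
end SU

open MvPolynomial
namespace SU
section F6
set_option linter.unusedSectionVars false
open NumberField Filter Topology
variable {K : Type*} [Field K] [NumberField K] (q : GQ) (T : Finset (FinitePlace K)) {n : ℕ}

lemma germ_unit_ne {x : ℕ → K} (hx : ∀ t, x t ≠ 0) : (x : SK K) ≠ 0 := fun h => by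
  obtain ⟨t, ht⟩ := (Germ.coe_eq.1 (h : (x : SK K) = (0 : ℕ → K))).exists
  exact hx t ht

lemma M_fin (N : ℕ) (hN0 : N ≠ 0) (hN : ∀ w : FinitePlace K, w ∈ T ↔ w (N : K) ≠ 1) : ∀ (n : ℕ) (x : Fin n → ℕ → K) (_ : ∀ j, ((x j : ℕ → K) : SK K) ∈ FF K q)
    (_ : ∀ j t, x j t ≠ 0) (_ : ∀ j t, ∀ w ∉ T, w (x j t) = 1)
    (_ : ∀ i j, i ≠ j → ((x i : ℕ → K) : SK K) / ((x j : ℕ → K) : SK K) ∉ F0 K q)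
    (a : Fin n → SK K) (_ : ∀ j, a j ∈ F0 K q) (_ : ∑ j, a j * ((x j : ℕ → K) : SK K) = 0), ∀ j, a j = 0 := by
  intro n
  induction n with
  | zero => intro _ _ _ _ _ _ _ _ j; exact j.elim0
  | succ n ih =>
    intro x hXF hx0 hxu hξ a ha hsum
    have hmin : ∀ b : Fin (n+1) → SK K, (∀ j, b j ∈ F0 K q) → ∑ j, b j * ((x j : ℕ → K) : SK K) = 0 → (∃ j, b j = 0) → ∀ j, b j = 0 := by
      rintro b hb hbs ⟨j0, hj0⟩ j
      rw [Fin.sum_univ_succAbove _ j0, hj0, zero_mul, zero_add] at hbs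
      have h1 := ih (fun i => x (j0.succAbove i)) (fun _ => hXF _) (fun _ => hx0 _) (fun _ => hxu _)
        (fun i j hij => hξ _ _ (fun h => hij (Fin.succAbove_right_injective h))) (fun i => b (j0.succAbove i)) (fun _ => hb _) hbs
      rcases Fin.eq_self_or_eq_succAbove j0 j with h | ⟨i, h⟩
      · rw [h, hj0]
      · rw [h]; exact h1 i
    by_contra hcon
    have ha0 : ∀ j, a j ≠ 0 := fun j hj => hcon (hmin a ha hsum ⟨j, hj⟩)
    have hX0 : ∀ j, ((x j : ℕ → K) : SK K) ≠ 0 := fun j => germ_unit_ne (hx0 j)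
    match n with
    | 0 =>
      rw [Fin.sum_univ_one] at hsum
      exact mul_ne_zero (ha0 0) (hX0 0) hsum
    | 1 =>
      rw [Fin.sum_univ_two] at hsum
      apply hξ 1 0 (by simp)
      have : ((x 1 : ℕ → K) : SK K) / ((x 0 : ℕ → K) : SK K) = - (a 0 / a 1) := by
        rw [div_eq_iff (hX0 0)]
        have h1 := ha0 1
        field_simp
        linear_combination hsum
      rw [this]
      exact (F0 K q).neg_mem ((F0 K q).div_mem (ha _) (ha _))
    | n+2 =>
      let e := (_root_.finSuccEquiv (n+2)).symm
      refine core q T N hN0 hN (by omega) (fun j => x (e j)) (fun _ => hXF _) (fun _ => hx0 _) (fun _ => hxu _)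
        (fun j => a (e j)) (fun _ => ha _) (fun _ => ha0 _) ((Equiv.sum_comp e (fun j => a j * ((x j : ℕ → K) : SK K))).trans hsum) ?_ 0 1 (by simp)
        (hξ _ _ (fun h => by simpa using e.injective h))
      rintro b hb hbs ⟨j, hj⟩ k
      have := hmin (fun j => b (e.symm j)) (fun _ => hb _) (by
        rw [← Equiv.sum_comp e]; simpa using hbs) ⟨e j, by simpa using hj⟩ (e k)
      simpa using this

lemma M_set (N : ℕ) (hN0 : N ≠ 0) (hN : ∀ w : FinitePlace K, w ∈ T ↔ w (N : K) ≠ 1) {ι : Type*} (s : Finset ι) (x : ι → ℕ → K) (hXF : ∀ j ∈ s, ((x j : ℕ → K) : SK K) ∈ FF K q)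
    (hx0 : ∀ j t, x j t ≠ 0) (hxu : ∀ j t, ∀ w ∉ T, w (x j t) = 1)
    (hξ : ∀ i ∈ s, ∀ j ∈ s, i ≠ j → ((x i : ℕ → K) : SK K) / ((x j : ℕ → K) : SK K) ∉ F0 K q)
    (a : ι → SK K) (ha : ∀ j, a j ∈ F0 K q) (hsum : ∑ j ∈ s, a j * ((x j : ℕ → K) : SK K) = 0) : ∀ j ∈ s, a j = 0 := by
  intro j hj
  let e := s.equivFin
  have := M_fin q T N hN0 hN s.card (fun i => x (e.symm i)) (fun _ => hXF _ (Subtype.prop _)) (fun _ => hx0 _) (fun _ => hxu _)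
    (fun i j hij => hξ _ (Subtype.prop _) _ (Subtype.prop _) fun h => hij (e.symm.injective (Subtype.ext h))) (fun i => a (e.symm i)) (fun _ => ha _)
    ((Equiv.sum_comp e.symm (fun j : s => a j * ((x j : ℕ → K) : SK K))).trans ((Finset.sum_coe_sort s _).trans hsum)) (e ⟨j, hj⟩)
  simpa using this

/-- class sums vanish -/
lemma M_class (N : ℕ) (hN0 : N ≠ 0) (hN : ∀ w : FinitePlace K, w ∈ T ↔ w (N : K) ≠ 1) {ι : Type*} [DecidableEq ι] (s : Finset ι) (x : ι → ℕ → K) (hXF : ∀ j ∈ s, ((x j : ℕ → K) : SK K) ∈ FF K q)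
    (hx0 : ∀ j t, x j t ≠ 0) (hxu : ∀ j t, ∀ w ∉ T, w (x j t) = 1)
    (a : ι → SK K) (ha : ∀ j, a j ∈ F0 K q) (hsum : ∑ j ∈ s, a j * ((x j : ℕ → K) : SK K) = 0) (j0 : ι) (hj0 : j0 ∈ s)
    (C : Finset ι) (hC : ∀ j, j ∈ C ↔ j ∈ s ∧ ((x j : ℕ → K) : SK K) / ((x j0 : ℕ → K) : SK K) ∈ F0 K q) :
    ∑ j ∈ C, a j * ((x j : ℕ → K) : SK K) = 0 := by
  let X : ι → SK K := fun j => ((x j : ℕ → K) : SK K)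
  have hX0 : ∀ j, X j ≠ 0 := fun j => germ_unit_ne (hx0 j)
  let S : Setoid ι := ⟨fun i j => X i / X j ∈ F0 K q, fun i => by rw [div_self (hX0 i)]; exact (F0 K q).one_mem,
    fun {i j} h => by rw [← inv_div]; exact (F0 K q).inv_mem h,
    fun {i j k} h h' => by have := (F0 K q).mul_mem h h'; rwa [div_mul_div_cancel₀ (hX0 j)] at this⟩
  let ρ : ι → ι := fun j => (Quotient.mk S j).out
  have hρ : ∀ j, X (ρ j) / X j ∈ F0 K q := fun j => Quotient.mk_out (s := S) j
  have hρ' : ∀ j, X j / X (ρ j) ∈ F0 K q := fun j => S.symm (hρ j)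
  let β : ι → SK K := fun k => ∑ j ∈ s with ρ j = k, a j * (X j / X k)
  have hβe : ∀ k, β k * X k = ∑ j ∈ s with ρ j = k, a j * X j := fun k => by
    simp only [β, Finset.sum_mul, mul_assoc, div_mul_cancel₀ _ (hX0 k)]
  have h1 := M_set q T N hN0 hN (s.image ρ) x (fun k hk => by
      obtain ⟨j, hj, rfl⟩ := Finset.mem_image.1 hk
      have := (FF K q).mul_mem (F0_le q (hρ j)) (hXF j hj)
      rwa [div_mul_cancel₀ _ (hX0 j)] at this) hx0 hxu (fun i hi k hk hik h => by
      obtain ⟨j, hj, rfl⟩ := Finset.mem_image.1 hi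
      obtain ⟨j', hj', rfl⟩ := Finset.mem_image.1 hk
      apply hik
      have : Quotient.mk S j = Quotient.mk S j' :=
        Quotient.sound (S.trans (hρ' j) (S.trans h (hρ j')))
      exact congrArg Quotient.out this) β (fun k => sum_mem fun j hj => by
      rw [← (Finset.mem_filter.1 hj).2]; exact (F0 K q).mul_mem (ha j) (hρ' j))
    (by
      have := Finset.sum_fiberwise_of_maps_to (s := s) (t := s.image ρ) (g := ρ) (fun j hj => Finset.mem_image_of_mem ρ hj) (fun j => a j * X j)
      rw [← hsum, ← this]
      exact Finset.sum_congr rfl fun k _ => hβe k) (ρ j0) (Finset.mem_image_of_mem ρ hj0)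
  have h2 := hβe (ρ j0)
  rw [h1, zero_mul] at h2
  rw [h2]
  refine Finset.sum_congr ?_ fun _ _ => rfl
  ext j
  rw [hC, Finset.mem_filter]
  refine and_congr_right fun _ => ⟨fun h => congrArg Quotient.out (Quotient.sound (s := S) h), fun h => ?_⟩
  have h3 := hρ' j
  rw [h] at h3
  exact S.trans h3 (hρ j0)

theorem U_thm (N : ℕ) (hN0 : N ≠ 0) (hN : ∀ w : FinitePlace K, w ∈ T ↔ w (N : K) ≠ 1) {ι : Type*} (x : ι → ℕ → K)
    (hx0 : ∀ j t, x j t ≠ 0) (hxu : ∀ j t, ∀ w ∉ T, w (x j t) = 1)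
    (hnc : ∀ i j, i ≠ j → ∀ c : K, ¬ ∀ᶠ t in UU, x i t = c * x j t) (s : Finset ι) :
    ∀ (b : ι → K), (∀ᶠ t in UU, ∑ j ∈ s, b j * x j t = 0) → ∀ j ∈ s, b j = 0 := by
  classical
  induction s using Finset.strongInduction with
  | H s ih =>
  intro b hb
  by_contra hcon
  have hb0 : ∀ j ∈ s, b j ≠ 0 := by
    intro j hj h0
    apply hcon
    intro k hk
    by_cases hkj : k = j
    · rw [hkj, h0]
    refine ih (s.erase j) (Finset.erase_ssubset hj) b ?_ k (Finset.mem_erase.2 ⟨hkj, hk⟩)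
    filter_upwards [hb] with t ht
    rw [← Finset.add_sum_erase _ _ hj, h0, zero_mul, zero_add] at ht
    exact ht
  obtain ⟨j0, hj0⟩ : s.Nonempty := by
    by_contra h
    rw [Finset.not_nonempty_iff_eq_empty] at h
    exact hcon (by simp [h])
  by_cases hs1 : ∀ j ∈ s, j = j0
  · have : s = {j0} := Finset.eq_singleton_iff_unique_mem.2 ⟨hj0, hs1⟩
    obtain ⟨t, ht⟩ := hb.exists
    rw [this, Finset.sum_singleton] at ht
    exact mul_ne_zero (hb0 j0 hj0) (hx0 j0 t) ht
  push Not at hs1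
  obtain ⟨j1, hj1, hj10⟩ := hs1
  let S : ℕ → ℝ := fun t => ∑ j ∈ s, Height.logHeight₁ (x j t / x j0 t)
  have hle : ∀ t, ∀ j ∈ s, Height.logHeight₁ (x j t / x j0 t) ≤ S t := fun t j hj =>
    Finset.single_le_sum (f := fun j => Height.logHeight₁ (x j t / x j0 t)) (fun _ _ => Height.zero_le_logHeight₁ _) hj
  have htop : Tendsto (fun t => ⌈S t⌉₊ + 1) UU atTop := by
    rw [tendsto_atTop]
    by_contra h
    push Not at h
    obtain ⟨C, hC⟩ := h
    have hC' : ∀ᶠ t in UU, ¬ C ≤ ⌈S t⌉₊ + 1 := by simpa using hC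
    have hfin := NumberField.finite_setOfPred_logHeight₁_le (K := K) (C : ℝ)
    have hmem : ∀ᶠ t in UU, ∃ c ∈ {c : K | Height.logHeight₁ c ≤ (C : ℝ)}, x j1 t / x j0 t = c := by
      filter_upwards [hC'] with t ht
      refine ⟨_, (hle t j1 hj1).trans ((Nat.le_ceil _).trans ?_), rfl⟩
      exact_mod_cast (by omega : ⌈S t⌉₊ ≤ C)
    obtain ⟨c, _, hc⟩ := (Ultrafilter.eventually_exists_mem_iff hfin).1 hmem
    refine hnc j1 j0 hj10 c ?_
    filter_upwards [hc] with t ht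
    rw [← ht, div_mul_cancel₀ _ (hx0 _ _)]
  let q : GQ := ⟨fun t => ⌈S t⌉₊ + 1, fun t => Nat.succ_pos _, htop⟩
  let y : ι → ℕ → K := fun j t => x j t / x j0 t
  have hy0 : ∀ j t, y j t ≠ 0 := fun j t => div_ne_zero (hx0 _ _) (hx0 _ _)
  have hSQ : ∀ t, S t ≤ q.Q t := fun t => (Nat.le_ceil _).trans (by simp [q])
  have hconst : ∀ c : K, ((fun _ => c : ℕ → K) : SK K) ∈ F0 K q := fun c => by
    rw [mem_F0]
    intro ε hε
    filter_upwards [q.topR.eventually_ge_atTop (Height.logHeight₁ c / ε)] with t ht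
    rwa [div_le_iff₀' hε] at ht
  have hyj0 : ((y j0 : ℕ → K) : SK K) = 1 := Germ.coe_eq.2 (Eventually.of_forall fun t => div_self (hx0 _ _))
  let C := s.filter fun j => ((y j : ℕ → K) : SK K) / ((y j0 : ℕ → K) : SK K) ∈ F0 K q
  have hcl := M_class q T N hN0 hN s y (fun j hj => (mem_FF q _).2 ⟨1, Eventually.of_forall fun t => by
      rw [one_mul]; exact (hle t j hj).trans (hSQ t)⟩) hy0
    (fun j t w hw => by simp only [y]; rw [map_div₀, hxu _ _ w hw, hxu _ _ w hw, div_one]) (fun j => ((fun _ => b j : ℕ → K) : SK K)) (fun _ => hconst _)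
    (by
      have := map_sum (Germ.coeRingHom (hyperfilter ℕ : Filter ℕ)) (fun j t => b j * y j t) s
      refine this.symm.trans (Germ.coe_eq.2 ?_)
      filter_upwards [hb] with t ht
      simp only [y, Finset.sum_apply]
      simp only [← mul_div_assoc, ← Finset.sum_div, ht, zero_div]) j0 hj0 C (fun j => Finset.mem_filter)
  have hCs : C ⊂ s := by
    refine Finset.filter_ssubset.2 ?_
    by_contra h
    push Not at h
    have h1 : ∀ j ∈ s, ∀ᶠ t in UU, Height.logHeight₁ (y j t) ≤ 1 / (2 * s.card) * q.Q t := by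
      intro j hj
      have h2 := h j hj
      rw [hyj0, div_one] at h2
      have : 0 < s.card := Finset.card_pos.2 ⟨j0, hj0⟩
      exact (mem_F0 q _).1 h2 _ (by positivity)
    obtain ⟨t, ht, ht'⟩ := (((Finset.eventually_all s).2 h1).and (q.topR.eventually_ge_atTop 5)).exists
    have h3 : S t ≤ 1/2 * q.Q t := by
      refine (Finset.sum_le_sum ht).trans_eq ?_
      have : (s.card : ℝ) ≠ 0 := by exact_mod_cast (Finset.card_pos.2 ⟨j0, hj0⟩).ne'
      rw [Finset.sum_const, nsmul_eq_mul]
      field_simp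
    have h4 : (q.Q t : ℝ) ≤ S t + 2 := by
      have := Nat.ceil_lt_add_one (a := S t) (Finset.sum_nonneg fun _ _ => Height.zero_le_logHeight₁ _)
      simp only [q]; push_cast; linarith
    linarith
  have hj0C : j0 ∈ C := Finset.mem_filter.2 ⟨hj0, by rw [hyj0, div_one]; exact (F0 K q).one_mem⟩
  refine hb0 j0 hj0 (ih C hCs b ?_ j0 hj0C)
  have := map_sum (Germ.coeRingHom (hyperfilter ℕ : Filter ℕ)) (fun j t => b j * y j t) C
  filter_upwards [Germ.coe_eq.1 (this.trans hcl : _ = ((0 : ℕ → K) : SK K))] with t ht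
  simp only [y, Finset.sum_apply, ← mul_div_assoc, ← Finset.sum_div, Pi.zero_apply] at ht
  exact (div_eq_zero_iff.1 ht).resolve_right (hx0 _ _)

end F6
end SU

open MvPolynomial
namespace SU
section G1
set_option linter.unusedSectionVars false
open NumberField Filter Topology

lemma exists_NT {K : Type*} [Field K] [NumberField K] (g : Finset Kˣ) : ∃ N : ℕ, N ≠ 0 ∧
    ∀ w : FinitePlace K, w (N : K) = 1 → ∀ u ∈ g, w (u : K) = 1 := by
  classical
  have hle : ∀ (w : FinitePlace K) (m : ℕ), w (m : K) ≤ 1 := fun w m => by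
    simpa using fin_int_le_one w (m : 𝓞 K)
  have hmul : ∀ (w : FinitePlace K) (m m' : ℕ), w ((m * m' : ℕ) : K) = 1 → w (m : K) = 1 ∧ w (m' : K) = 1 := by
    intro w m m' h
    rw [Nat.cast_mul, map_mul] at h
    have h1 := hle w m
    have h2 := hle w m'
    have h3 := apply_nonneg w (m : K)
    have h4 := apply_nonneg w (m' : K)
    constructor <;> nlinarith
  have hone : ∀ x : K, ∃ m : ℕ, m ≠ 0 ∧ ∀ w : FinitePlace K, w (m : K) = 1 → w x ≤ 1 := fun x => by
    obtain ⟨m, hm, _, hi⟩ := exists_nat_le_mulHeight₁ x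
    refine ⟨m, hm, fun w hw => ?_⟩
    have : w ((m : K) * x) ≤ 1 := fin_int_le_one w (⟨_, hi⟩ : 𝓞 K)
    rwa [map_mul, hw, one_mul] at this
  induction g using Finset.induction_on with
  | empty => exact ⟨1, one_ne_zero, by simp⟩
  | insert u g _ ih =>
    obtain ⟨N, hN, h⟩ := ih
    obtain ⟨m, hm, h1⟩ := hone u
    obtain ⟨m', hm', h2⟩ := hone (u : K)⁻¹
    refine ⟨N * (m * m'), by positivity, fun w hw u' hu' => ?_⟩
    obtain ⟨hw1, hw2⟩ := hmul w _ _ hw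
    obtain ⟨hw3, hw4⟩ := hmul w _ _ hw2
    rcases Finset.mem_insert.1 hu' with rfl | hu'
    · refine le_antisymm (h1 w hw3) ?_
      have := h2 w hw4
      rw [map_inv₀] at this
      exact (inv_le_one₀ ((FinitePlace.pos_iff).2 u'.ne_zero)).1 this
    · exact h w hw1 u' hu'

theorem U_gp {K : Type*} [Field K] [NumberField K] (g : Finset Kˣ) {ι : Type*} (x : ι → ℕ → Kˣ)
    (hx : ∀ j t, x j t ∈ Subgroup.closure (g : Set Kˣ))
    (hnc : ∀ i j, i ≠ j → ∀ c : K, ¬ ∀ᶠ t in UU, (x i t : K) = c * x j t) (s : Finset ι)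
    (b : ι → K) (hb : ∀ᶠ t in UU, ∑ j ∈ s, b j * (x j t : K) = 0) : ∀ j ∈ s, b j = 0 := by
  obtain ⟨N, hN0, hN⟩ := exists_NT g
  have hfin := FinitePlace.hasFiniteMulSupport (K := K) (x := (N : K)) (by exact_mod_cast hN0)
  refine U_thm hfin.toFinset N hN0 (fun w => hfin.mem_toFinset) (fun j t => (x j t : K)) (fun j t => (x j t).ne_zero)
    (fun j t w hw => ?_) hnc s b hb
  have hw1 : w (N : K) = 1 := by by_contra h; exact hw (hfin.mem_toFinset.2 h)
  have : ∀ u ∈ Subgroup.closure (g : Set Kˣ), w (u : K) = 1 := fun u hu => by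
    induction hu using Subgroup.closure_induction with
    | mem u hu => exact hN w hw1 u hu
    | one => simp
    | mul a b _ _ h1 h2 => rw [Units.val_mul, map_mul, h1, h2, one_mul]
    | inv a _ h1 => rw [Units.val_inv_eq_inv_val, map_inv₀, h1, inv_one]
  exact this _ (hx j t)

abbrev QB := AlgebraicClosure ℚ

theorem U_alg (g : Finset QBˣ) {ι : Type*} (x : ι → ℕ → QBˣ)
    (hx : ∀ j t, x j t ∈ Subgroup.closure (g : Set QBˣ))
    (hnc : ∀ i j, i ≠ j → ∀ c : QB, ¬ ∀ᶠ t in UU, (x i t : QB) = c * x j t) (s : Finset ι)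
    (b : ι → QB) (hb : ∀ᶠ t in UU, ∑ j ∈ s, b j * (x j t : QB) = 0) : ∀ j ∈ s, b j = 0 := by
  classical
  let S : Finset QB := g.image (fun u : QBˣ => (u : QB)) ∪ s.image b
  let K := IntermediateField.adjoin ℚ (S : Set QB)
  have hfd : FiniteDimensional ℚ K := IntermediateField.finiteDimensional_adjoin fun y _ => ((AlgebraicClosure.isAlgebraic ℚ).isAlgebraic y).isIntegral
  have : NumberField K := { to_charZero := inferInstance, to_finiteDimensional := hfd }
  have hS : ∀ y ∈ S, y ∈ K := fun y hy => IntermediateField.subset_adjoin ℚ _ hy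
  let φ : Kˣ →* QBˣ := Units.map (algebraMap K QB : K →* QB)
  have hφ : Function.Injective φ := Units.map_injective (algebraMap K QB).injective
  have hlift : ∀ u ∈ g, ∃ u' : Kˣ, φ u' = u := fun u hu =>
    ⟨Units.mk0 ⟨u, hS _ (Finset.mem_union_left _ (Finset.mem_image_of_mem _ hu))⟩
      (fun h => u.ne_zero (congrArg Subtype.val h)), Units.ext rfl⟩
  let g' : Finset Kˣ := g.preimage φ hφ.injOn
  have hmap : (Subgroup.closure (g' : Set Kˣ)).map φ = Subgroup.closure (g : Set QBˣ) := by
    rw [MonoidHom.map_closure, Finset.coe_preimage, Set.image_preimage_eq_of_subset]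
    exact fun u hu => hlift u hu
  have hx' : ∀ j t, ∃ y ∈ Subgroup.closure (g' : Set Kˣ), φ y = x j t := fun j t => by
    have := hx j t
    rw [← hmap] at this; exact this
  choose y hy hyx using hx'
  have hyv : ∀ j t, ((y j t : K) : QB) = x j t := fun j t => congrArg Units.val (hyx j t)
  let b' : ι → K := fun j => if h : j ∈ s then ⟨b j, hS _ (Finset.mem_union_right _ (Finset.mem_image_of_mem _ h))⟩ else 0
  have hb' : ∀ j ∈ s, (b' j : QB) = b j := fun j hj => by simp only [b', dif_pos hj]
  have := U_gp g' y hy (fun i j hij c h => hnc i j hij c (by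
    filter_upwards [h] with t ht
    rw [← hyv, ← hyv, ht]; rfl)) s b' (by
    filter_upwards [hb] with t ht
    apply Subtype.ext
    push_cast
    rw [← ht]
    exact Finset.sum_congr rfl fun j hj => by rw [hb' j hj, hyv])
  intro j hj
  rw [← hb' j hj, this j hj]; rfl

end G1
end SU

open MvPolynomial
namespace SU
section G2
open Filter Topology

noncomputable instance : Algebra QB (SK QB) := Algebra.ofModule
  (fun r x y => by induction x using Germ.inductionOn; induction y using Germ.inductionOn
                   exact congrArg (fun f : ℕ → QB => (f : SK QB)) (smul_mul_assoc r _ _))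
  (fun r x y => by induction x using Germ.inductionOn; induction y using Germ.inductionOn
                   exact congrArg (fun f : ℕ → QB => (f : SK QB)) (mul_smul_comm r _ _))

noncomputable def ph : (ℕ → QB) →ₐ[QB] SK QB :=
  { Germ.coeRingHom (hyperfilter ℕ : Filter ℕ) with
    commutes' := fun r => by
      rw [Algebra.algebraMap_eq_smul_one, Algebra.algebraMap_eq_smul_one]; rfl }

lemma ph_eq {f g : ℕ → QB} : ph f = ph g ↔ ∀ᶠ t in UU, f t = g t := Germ.coe_eq

variable (P : Subgroup QBˣ)

def Gs := {g : ℕ → QBˣ // ∀ t, g t ∈ P}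

def uq (g : ℕ → QBˣ) : ℕ → QB := fun t => (g t : QB)

noncomputable def gm : Submonoid (SK QB) where
  carrier := {a | ∃ g : Gs P, a = ph (uq g.1)}
  one_mem' := ⟨⟨fun _ => 1, fun _ => P.one_mem⟩, (map_one ph).symm⟩
  mul_mem' := by
    rintro _ _ ⟨g, rfl⟩ ⟨h, rfl⟩
    refine ⟨⟨fun t => g.1 t * h.1 t, fun t => P.mul_mem (g.2 t) (h.2 t)⟩, ?_⟩
    rw [← map_mul]; rfl

noncomputable def RR : Subalgebra QB (SK QB) := Algebra.adjoin QB (gm P : Set (SK QB))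

def gset : Setoid (Gs P) where
  r g h := ∃ c : QB, ∀ᶠ t in UU, (g.1 t : QB) = c * h.1 t
  iseqv := {
    refl := fun g => ⟨1, Eventually.of_forall fun t => (one_mul _).symm⟩
    symm := fun {g h} ⟨c, hc⟩ => ⟨c⁻¹, by
      filter_upwards [hc] with t ht
      have : c ≠ 0 := fun h0 => (g.1 t).ne_zero (by rw [ht, h0, zero_mul])
      rw [ht, inv_mul_cancel_left₀ this]⟩
    trans := fun {g h k} ⟨c, hc⟩ ⟨d, hd⟩ => ⟨c * d, by
      filter_upwards [hc, hd] with t h1 h2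
      rw [h1, h2, mul_assoc]⟩ }

def Br := Quotient (gset P)

noncomputable def bo (β : Br P) : ℕ → QBˣ := (Quotient.out β).1

lemma bo_mem (β : Br P) (t : ℕ) : bo P β t ∈ P := (Quotient.out β).2 t

lemma mem_RR {a : SK QB} (ha : a ∈ RR P) :
    ∃ c : Br P →₀ QB, a = c.sum fun β y => y • ph (uq (bo P β)) := by
  have h : a ∈ Submodule.span QB (Set.range fun β : Br P => ph (uq (bo P β))) := by
    have h1 : a ∈ Submodule.span QB (gm P : Set (SK QB)) := by
      have : a ∈ Subalgebra.toSubmodule (RR P) := ha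
      rwa [RR, Algebra.adjoin_eq_span, Submonoid.closure_eq] at this
    refine Submodule.span_le.2 ?_ h1
    rintro _ ⟨g, rfl⟩
    obtain ⟨c, hc⟩ := (gset P).symm (Quotient.mk_out (s := gset P) g)
    have : ph (uq g.1) = c • ph (uq (bo P (Quotient.mk (gset P) g))) := by
      rw [← map_smul, ph_eq]; exact hc
    rw [SetLike.mem_coe, this]
    exact Submodule.smul_mem _ _ (Submodule.subset_span ⟨_, rfl⟩)
  obtain ⟨c, hc⟩ := Finsupp.mem_span_range_iff_exists_finsupp.1 h
  exact ⟨c, hc.symm⟩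

lemma gp_aux {G : Type*} [CommGroup G] {a A b B c C d D : G} (h : a * A * (b * B) = c * C * (d * D)) :
    A * B * (a * b) = c * d * (C * D) := by
  rw [mul_mul_mul_comm c, ← h, mul_mul_mul_comm a, mul_comm]

theorem trans_X (g0 : Finset QBˣ) (hP : P ≤ Subgroup.closure (g0 : Set QBˣ)) (lam : QBˣ) (m : ℕ → ℤ)
    (hm : Function.Injective m) (hru : ∀ k : ℤ, k ≠ 0 → lam ^ k ≠ 1)
    (hint : ∀ x ∈ Subgroup.zpowers lam, x ∈ P → x = 1) :
    Transcendental (RR P) (ph (uq fun t => lam ^ m t)) := by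
  classical
  rw [transcendental_iff]
  intro p hp
  choose c hc using fun k => mem_RR P (p.coeff k).2
  let B : Finset (Br P) := (Finset.range (p.natDegree + 1)).biUnion fun k => (c k).support
  have hc' : ∀ k ∈ Finset.range (p.natDegree + 1), (p.coeff k : SK QB) = ∑ β ∈ B, c k β • ph (uq (bo P β)) :=
    fun k hk => by
      rw [hc k]
      exact Finsupp.sum_of_support_subset _ (Finset.subset_biUnion_of_mem (fun k => (c k).support) hk) _ (by simp)
  let x : ℕ × Br P → ℕ → QBˣ := fun i t => bo P i.2 t * lam ^ (m t * i.1)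
  have key := U_alg (insert lam g0) x (fun i t => by
      have h1 : P ≤ Subgroup.closure ((insert lam g0 : Finset QBˣ) : Set QBˣ) :=
        hP.trans (Subgroup.closure_mono (by simp))
      exact mul_mem (h1 (bo_mem P _ t)) (zpow_mem (Subgroup.subset_closure (by simp)) _))
    (by
      rintro ⟨k, β⟩ ⟨k', β'⟩ hne a ha
      by_cases hk : k = k'
      · subst hk
        refine hne (Prod.ext rfl ?_)
        have : (gset P).r β.out β'.out := ⟨a, by
          filter_upwards [ha] with t ht
          simp only [x, Units.val_mul] at ht
          rw [← mul_assoc] at ht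
          exact mul_right_cancel₀ (Units.ne_zero _) ht⟩
        exact Quotient.out_equiv_out.1 this
      · have hinf : {t | (x (k, β) t : QB) = a * x (k', β') t}.Infinite := fun hf => by
          have h2 := hf.compl_mem_hyperfilter
          obtain ⟨t, h3, h4⟩ := (ha.and h2).exists
          exact h4 h3
        obtain ⟨t, ht⟩ := hinf.nonempty
        obtain ⟨t', ht', hlt⟩ := hinf.exists_gt t
        simp only [Set.mem_setOf_eq] at ht ht'
        have h1 : x (k, β) t * x (k', β') t' = x (k, β) t' * x (k', β') t := by
          rw [Units.ext_iff, Units.val_mul (x (k, β) t), Units.val_mul (x (k, β) t'), ht, ht']; ring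
        have h2 : lam ^ ((m t - m t') * ((k : ℤ) - k')) =
            bo P β t' * bo P β' t / (bo P β t * bo P β' t') := by
          have e : (m t - m t') * ((k : ℤ) - k') = m t * k + m t' * k' - (m t' * k + m t * k') := by ring
          rw [e, _root_.zpow_sub, _root_.zpow_add, _root_.zpow_add, ← div_eq_mul_inv, div_eq_div_iff_mul_eq_mul]
          simp only [x] at h1
          exact gp_aux h1
        refine hru _ ?_ (hint (lam ^ ((m t - m t') * ((k : ℤ) - k'))) ⟨_, rfl⟩ ?_)
        · exact mul_ne_zero (sub_ne_zero.2 fun h => hlt.ne (hm h)) (sub_ne_zero.2 (by exact_mod_cast hk))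
        · rw [h2]
          exact div_mem (mul_mem (bo_mem P _ _) (bo_mem P _ _)) (mul_mem (bo_mem P _ _) (bo_mem P _ _)))
    ((Finset.range (p.natDegree + 1)) ×ˢ B) (fun i => c i.1 i.2) (by
      have h0 : ph (fun t => ∑ i ∈ (Finset.range (p.natDegree + 1)) ×ˢ B, c i.1 i.2 * (x i t : QB)) = ph 0 := by
        rw [map_zero, ← hp, Polynomial.aeval_eq_sum_range]
        have : (fun t => ∑ i ∈ (Finset.range (p.natDegree + 1)) ×ˢ B, c i.1 i.2 * (x i t : QB)) =
          ∑ k ∈ Finset.range (p.natDegree + 1), (∑ β ∈ B, c k β • uq (bo P β)) * (uq fun t => lam ^ m t) ^ k := by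
          ext t
          rw [Finset.sum_product, Finset.sum_apply]
          refine Finset.sum_congr rfl fun k _ => ?_
          rw [Pi.mul_apply, Finset.sum_apply, Finset.sum_mul]
          refine Finset.sum_congr rfl fun β _ => ?_
          simp only [x, uq, Pi.smul_apply, Pi.pow_apply, smul_eq_mul, _root_.zpow_mul, _root_.zpow_natCast]
          push_cast
          ring
        rw [this, map_sum]
        refine Finset.sum_congr rfl fun k hk => ?_
        rw [map_mul, map_pow, map_sum, Subalgebra.smul_def, smul_eq_mul, hc' k hk]
        simp only [map_smul]
      exact ph_eq.1 h0)
  refine Polynomial.ext fun k => Subtype.ext ?_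
  by_cases hk : k ∈ Finset.range (p.natDegree + 1)
  · rw [hc' k hk]
    exact Finset.sum_eq_zero fun β hβ => by rw [key (k, β) (Finset.mk_mem_product hk hβ), zero_smul]
  · rw [Polynomial.coeff_eq_zero_of_natDegree_lt (by simpa using hk)]; simp
end G2
end SU

namespace SU
section G3
open Filter Topology

variable (A : Subalgebra QB (SK QB)) {n : ℕ}

def GdM (f : ℕ → Matrix (Fin n) (Fin n) QB) : Prop := ∀ i j, ph (fun t => f t i j) ∈ A

variable {A}
lemma GdM.mul {f g : ℕ → Matrix (Fin n) (Fin n) QB} (hf : GdM A f) (hg : GdM A g) :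
    GdM A fun t => f t * g t := fun i j => by
  have : (fun t => (f t * g t) i j) = ∑ k, (fun t => f t i k) * fun t => g t k j := by
    ext t; simp [Matrix.mul_apply]
  rw [this, map_sum]
  exact sum_mem fun k _ => by rw [map_mul]; exact mul_mem (hf i k) (hg k j)

lemma ph_const (c : QB) : ph (fun _ => c) ∈ A := by
  have : (fun _ : ℕ => c) = algebraMap QB (ℕ → QB) c := rfl
  rw [this, AlgHom.commutes]; exact A.algebraMap_mem c

variable (A n)
def GdG : Subgroup (ℕ → GL (Fin n) QB) where
  carrier := {f | GdM A (fun t => (f t : Matrix (Fin n) (Fin n) QB)) ∧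
    GdM A (fun t => ((f t)⁻¹ : GL (Fin n) QB).1)}
  one_mem' := ⟨fun i j => ph_const _, fun i j => by simpa using ph_const _⟩
  mul_mem' := fun {f g} hf hg => ⟨by simpa using hf.1.mul hg.1, by simpa using hg.2.mul hf.2⟩
  inv_mem' := fun {f} hf => ⟨hf.2, by simpa using hf.1⟩
variable {A n}

lemma zpow_eig (g : GL (Fin n) QB) (u : QBˣ) (v : Fin n → QB)
    (h : g.1 *ᵥ v = (u : QB) • v) (k : ℤ) : (g ^ k).1 *ᵥ v = ((u ^ k : QBˣ) : QB) • v := by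
  induction k using Int.induction_on with
  | zero => simp
  | succ k ih =>
    rw [_root_.zpow_add_one, _root_.zpow_add_one, Units.val_mul, ← Matrix.mulVec_mulVec, h, Matrix.mulVec_smul, ih,
      smul_smul, Units.val_mul, mul_comm]
  | pred k ih =>
    have h' : (g⁻¹).1 *ᵥ v = ((u⁻¹ : QBˣ) : QB) • v := by
      have h2 := congrArg (fun w => ((u⁻¹ : QBˣ) : QB) • ((g⁻¹).1 *ᵥ w)) h
      simp only [Matrix.mulVec_mulVec, Matrix.mulVec_smul, smul_smul, Units.inv_mul] at h2
      rw [Matrix.one_mulVec, one_smul] at h2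
      exact h2.symm
    rw [_root_.zpow_sub_one, _root_.zpow_sub_one, Units.val_mul, ← Matrix.mulVec_mulVec, h', Matrix.mulVec_smul, ih,
      smul_smul, Units.val_mul, mul_comm]

lemma GdM_ss {P : Subgroup QBˣ} (hA : (gm P : Set (SK QB)) ⊆ A) (g : GL (Fin n) QB) (hg : IsSemisimpleElt g)
    (hP : eigGroup g ≤ P) (k : ℕ → ℤ) : GdM A fun t => (g ^ k t).1 := by
  let W : Submodule QB (Fin n → QB) :=
    { carrier := {v | ∀ j, ph (fun t => ((g ^ k t).1 *ᵥ v) j) ∈ A}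
      zero_mem' := fun j => by simpa using ph_const 0
      add_mem' := fun {v w} hv hw j => by
        simp only [Matrix.mulVec_add]
        have := add_mem (hv j) (hw j)
        rwa [← map_add] at this
      smul_mem' := fun c v hv j => by
        simp only [Matrix.mulVec_smul]
        have := A.smul_mem (hv j) c
        rwa [← map_smul] at this }
  have hW : W = ⊤ := by
    rw [eq_top_iff, ← Module.End.iSup_maxGenEigenspace_eq_top (g.1.mulVecLin), iSup_le_iff]
    intro μ
    rw [hg.isFinitelySemisimple.maxGenEigenspace_eq_eigenspace]
    intro v hv
    by_cases hv0 : v = 0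
    · rw [hv0]; exact W.zero_mem
    have hev : g.1 *ᵥ v = μ • v := Module.End.mem_eigenspace_iff.1 hv
    have hμ : μ ≠ 0 := fun h0 => hv0 (by
      have h2 := congrArg (fun w => (g⁻¹).1 *ᵥ w) hev
      simpa [Matrix.mulVec_mulVec, h0] using h2)
    have hroot : g.1.charpoly.IsRoot μ := by
      rw [← Matrix.charpoly_mulVecLin, ← Module.End.hasEigenvalue_iff_isRoot_charpoly]
      exact Module.End.hasEigenvalue_of_hasEigenvector ⟨hv, hv0⟩
    have hu : Units.mk0 μ hμ ∈ P := hP (Subgroup.subset_closure hroot)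
    intro j
    have : (fun t => ((g ^ k t).1 *ᵥ v) j) = (uq fun t => Units.mk0 μ hμ ^ k t) * fun _ => v j := by
      ext t
      rw [zpow_eig g (Units.mk0 μ hμ) v hev]; rfl
    rw [this, map_mul]
    exact mul_mem (hA ⟨⟨_, fun t => zpow_mem hu _⟩, rfl⟩) (ph_const _)
  intro i j
  have : Pi.single j 1 ∈ W := hW ▸ Submodule.mem_top
  simpa using this i

lemma uni_zpow (g : GL (Fin n) QB) (hg : (g.1 - 1) ^ n = 0) (k : ℤ) :
    (g ^ k).1 = ∑ i ∈ Finset.range n, ((Ring.choose k i : ℤ) : QB) • (g.1 - 1) ^ i := by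
  set N := g.1 - 1 with hN
  have hstep : ∀ k : ℤ, (∑ i ∈ Finset.range n, ((Ring.choose k i : ℤ) : QB) • N ^ i) * g.1 =
      ∑ i ∈ Finset.range n, ((Ring.choose (k + 1) i : ℤ) : QB) • N ^ i := fun k => by
    have : g.1 = 1 + N := by rw [hN]; abel
    rw [this, mul_add, mul_one, Finset.sum_mul]
    simp only [smul_mul_assoc, ← pow_succ]
    cases n with
    | zero => simp
    | succ n =>
      rw [Finset.sum_range_succ', Finset.sum_range_succ (fun i => _ • N ^ (i + 1)), hg, smul_zero, add_zero,
        Finset.sum_range_succ' (fun i => ((Ring.choose (k + 1) i : ℤ) : QB) • N ^ i)]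
      simp only [Ring.choose_succ_succ, Ring.choose_zero_right, Int.cast_add, add_smul, Finset.sum_add_distrib]
      abel
  induction k using Int.induction_on with
  | zero =>
    cases n with
    | zero => exact Subsingleton.elim _ _
    | succ n =>
      rw [Finset.sum_range_succ']
      simp [Ring.choose_zero_succ]
  | succ k ih => rw [← hstep, ← ih, _root_.zpow_add_one, Units.val_mul]
  | pred k ih =>
    have := hstep (-k - 1)
    rw [sub_add_cancel, ← ih] at this
    rw [_root_.zpow_sub_one, Units.val_mul, ← this, mul_assoc, Units.mul_inv, mul_one]

lemma GdM_uni (g : GL (Fin n) QB) (hg : (g.1 - 1) ^ n = 0) (k : ℕ → ℤ)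
    (hk : ph (fun t => (k t : QB)) ∈ A) : GdM A fun t => (g ^ k t).1 := by
  have hch : ∀ i, ph (fun t => ((Ring.choose (k t) i : ℤ) : QB)) ∈ A := fun i => by
    have h1 : Polynomial.aeval (ph fun t => (k t : QB)) (descPochhammer ℤ i) ∈ A :=
      Polynomial.aeval_mem_adjoin_singleton ℤ _ |> fun h => (Algebra.adjoin_le (S := A.restrictScalars ℤ) (by simpa using hk)) h
    have h2 : Polynomial.aeval (ph fun t => (k t : QB)) (descPochhammer ℤ i) =
        (i.factorial : QB) • ph (fun t => ((Ring.choose (k t) i : ℤ) : QB)) := by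
      rw [← map_smul]
      have := Polynomial.aeval_algHom_apply (ph.restrictScalars ℤ) (fun t => (k t : QB)) (descPochhammer ℤ i)
      rw [AlgHom.coe_restrictScalars'] at this
      rw [this]
      congr 1
      ext t
      have h3 := (Polynomial.aeval_algHom_apply (Pi.evalAlgHom ℤ (fun _ : ℕ => QB) t) (fun t => (k t : QB)) (descPochhammer ℤ i)).symm
      rw [Pi.evalAlgHom_apply] at h3
      rw [h3]
      have h4 := Ring.descPochhammer_eq_factorial_smul_choose (k t) i
      rw [← Polynomial.eval_eq_smeval] at h4
      have h5 := Polynomial.aeval_algebraMap_apply_eq_algebraMap_eval (A := QB) (k t) (descPochhammer ℤ i)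
      rw [h4] at h5
      simpa using h5
    have h3 : ph (fun t => ((Ring.choose (k t) i : ℤ) : QB)) = (i.factorial : QB)⁻¹ •
      Polynomial.aeval (ph fun t => (k t : QB)) (descPochhammer ℤ i) := by
      rw [h2, smul_smul, inv_mul_cancel₀ (by exact_mod_cast i.factorial_ne_zero), one_smul]
    rw [h3]; exact A.smul_mem h1 _
  intro a b
  have : (fun t => (g ^ k t).1 a b) = ∑ i ∈ Finset.range n, (fun t => ((Ring.choose (k t) i : ℤ) : QB)) * fun _ => ((g.1 - 1) ^ i) a b := by
    ext t
    rw [uni_zpow g hg, Matrix.sum_apply, Finset.sum_apply]; rfl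
  rw [this, map_sum]
  exact sum_mem fun i _ => by rw [map_mul]; exact mul_mem (hch i) (ph_const _)

end G3
end SU

namespace SU
section G4
open Filter Topology Matrix

/-- A unit of `R[κ]` inside a domain cannot be transcendental over `R`. -/
lemma not_trans {R S : Type*} [CommRing R] [IsDomain R] [Field S] [Algebra R S] [FaithfulSMul R S] (κ X : S)
    (hX : X ∈ (Polynomial.aeval κ : Polynomial R →ₐ[R] S).range)
    (hX' : X⁻¹ ∈ (Polynomial.aeval κ : Polynomial R →ₐ[R] S).range) (h0 : X ≠ 0) :
    ¬ Transcendental R X := by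
  intro ht
  obtain ⟨p, hp⟩ := hX
  obtain ⟨q, hq⟩ := hX'
  by_cases hκ : Transcendental R κ
  · have hpq : p * q = 1 := transcendental_iff_injective.1 hκ (by
      rw [map_mul, map_one]; exact (congrArg₂ (· * ·) hp hq).trans (mul_inv_cancel₀ h0))
    obtain ⟨r, _, hr⟩ := Polynomial.isUnit_iff.1 (IsUnit.of_mul_eq_one q hpq)
    refine ht ?_
    rw [← hp, ← hr]
    simpa using isAlgebraic_algebraMap r
  · have hκ' : IsAlgebraic R κ := not_not.1 hκ
    refine ht ?_
    have h : p.aeval κ ∈ Subalgebra.algebraicClosure R S := by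
      have h1 := Polynomial.aeval_mem_adjoin_singleton R κ (p := p)
      exact Algebra.adjoin_le (S := Subalgebra.algebraicClosure R S) (Set.singleton_subset_iff.2 hκ') h1
    rw [← hp]; exact h

theorem final {n : ℕ} (r : ℕ) (γs : Fin r → GL (Fin n) QB) (s : Fin r)
    (huni : ((γs s).1 - 1) ^ n = 0)
    (hss : ∀ i : Fin r, i ≠ s → IsSemisimpleElt (γs i))
    (γ : GL (Fin n) QB) (lam : QBˣ) (heig : γ.1.charpoly.IsRoot (lam : QB))
    (hru : ∀ k : ℤ, k ≠ 0 → lam ^ k ≠ 1)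
    (hint : ∀ x : QBˣ, x ∈ Subgroup.zpowers lam →
      (∃ v : Fin r → QBˣ, (∀ i, v i ∈ eigGroup (γs i)) ∧ x = ∏ i, v i) → x = 1) :
    Set.Finite {m : ℤ | ∃ k : Fin r → ℤ, γ ^ m = (List.ofFn fun i => γs i ^ k i).prod} := by
  classical
  by_contra hJ
  let e := Set.Infinite.natEmbedding _ hJ
  let m : ℕ → ℤ := fun t => (e t).1
  have hm : Function.Injective m := fun a b h => e.injective (Subtype.ext h)
  choose k hk using fun t => (e t).2
  let P : Subgroup QBˣ :=
    { carrier := {x | ∃ v : Fin r → QBˣ, (∀ i, v i ∈ eigGroup (γs i)) ∧ x = ∏ i, v i}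
      one_mem' := ⟨1, fun i => one_mem _, by simp⟩
      mul_mem' := by
        rintro _ _ ⟨v, hv, rfl⟩ ⟨w, hw, rfl⟩
        exact ⟨v * w, fun i => mul_mem (hv i) (hw i), by simp [Finset.prod_mul_distrib]⟩
      inv_mem' := by
        rintro _ ⟨v, hv, rfl⟩
        exact ⟨v⁻¹, fun i => inv_mem (hv i), by simp⟩ }
  have hle : ∀ i, eigGroup (γs i) ≤ P := fun i x hx =>
    ⟨Pi.mulSingle i x, fun j => by
      by_cases h : j = i
      · subst h; simpa using hx
      · simp [Pi.mulSingle_eq_of_ne h], by simp⟩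
  have hfin : ∀ i, {u : QBˣ | (γs i).1.charpoly.IsRoot (u : QB)}.Finite := fun i =>
    Set.Finite.preimage (f := fun u : QBˣ => (u : QB)) (fun a _ b _ h => Units.ext h)
      (Polynomial.finite_setOfPred_isRoot (Matrix.charpoly_monic (γs i).1).ne_zero)
  let g0 : Finset QBˣ := Finset.univ.biUnion fun i => (hfin i).toFinset
  have hP : P ≤ Subgroup.closure (g0 : Set QBˣ) := by
    rintro _ ⟨v, hv, rfl⟩
    refine prod_mem fun i _ => (Subgroup.closure_mono ?_ : eigGroup (γs i) ≤ _) (hv i)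
    intro u hu
    simp only [g0, Finset.coe_biUnion, Set.mem_iUnion]
    exact ⟨i, Finset.mem_coe.2 (Finset.mem_univ i), by simpa using hu⟩
  have htr := trans_X P g0 hP lam m hm hru (fun x hx hxP => hint x hx hxP)
  let κ : SK QB := ph fun t => (k t s : QB)
  let A : Subalgebra QB (SK QB) :=
    ((Polynomial.aeval κ : Polynomial (RR P) →ₐ[RR P] SK QB).range).restrictScalars QB
  have hA : (gm P : Set (SK QB)) ⊆ A := fun a ha =>
    ⟨Polynomial.C ⟨a, Algebra.subset_adjoin ha⟩, by simp⟩
  have hκ : κ ∈ A := ⟨Polynomial.X, by simp⟩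
  have hκ' : ph (fun t => ((-k t s : ℤ) : QB)) ∈ A := by
    have := neg_mem hκ
    simp only [κ, ← map_neg] at this
    convert this using 2
    ext t; simp
  have hgood : ∀ i, (fun t => γs i ^ k t i) ∈ GdG A n := fun i => by
    by_cases hi : i = s
    · subst hi
      refine ⟨GdM_uni _ huni _ hκ, ?_⟩
      simpa using GdM_uni _ huni _ hκ'
    · refine ⟨GdM_ss hA _ (hss i hi) (hle i) _, ?_⟩
      simpa using GdM_ss hA _ (hss i hi) (hle i) fun t => - k t i
  have hγ : (fun t => γ ^ m t) ∈ GdG A n := by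
    have : (fun t => γ ^ m t) = (List.ofFn fun i => fun t => γs i ^ k t i).prod := by
      ext1 t
      have h1 := map_list_prod (Pi.evalMonoidHom (fun _ : ℕ => GL (Fin n) QB) t) (List.ofFn fun i => fun t => γs i ^ k t i)
      rw [List.map_ofFn] at h1
      exact (hk t).trans h1.symm
    rw [this]
    exact Subgroup.list_prod_mem _ fun x hx => by
      obtain ⟨i, rfl⟩ := (List.mem_ofFn' _ _).1 hx
      exact hgood i
  obtain ⟨v, hv, hv0⟩ : ∃ v, γ.1 *ᵥ v = (lam : QB) • v ∧ v ≠ 0 := by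
    rw [← Matrix.charpoly_mulVecLin, ← Module.End.hasEigenvalue_iff_isRoot_charpoly] at heig
    obtain ⟨v, hv⟩ := heig.exists_hasEigenvector
    exact ⟨v, Module.End.mem_eigenspace_iff.1 hv.1, hv.2⟩
  obtain ⟨i, hi⟩ := Function.ne_iff.1 hv0
  have hmem : ∀ l : ℕ → ℤ, GdM A (fun t => (γ ^ l t).1) → ph (uq fun t => lam ^ l t) ∈ A := fun l hl => by
    have : (uq fun t => lam ^ l t) = ∑ j, (fun t => (γ ^ l t).1 i j) * fun _ => v j / v i := by
      ext t
      have h1 := congrFun (zpow_eig γ lam v hv (l t)) i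
      rw [Finset.sum_apply]
      simp only [Pi.mul_apply, mul_div_assoc']
      rw [← Finset.sum_div, eq_div_iff hi]
      exact h1.symm
    rw [this, map_sum]
    exact sum_mem fun j _ => by rw [map_mul]; exact mul_mem (hl i j) (ph_const _)
  have hmul : ph (uq fun t => lam ^ (-m t)) * ph (uq fun t => lam ^ m t) = 1 := by
    have h1 : (uq fun t => lam ^ (-m t)) * (uq fun t => lam ^ m t) = 1 := by
      ext t
      simp only [uq, Pi.mul_apply, ← Units.val_mul, ← _root_.zpow_add, neg_add_cancel, zpow_zero]; rfl
    rw [← map_mul, h1, map_one]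
  have hne := right_ne_zero_of_mul_eq_one hmul
  have hinv := (eq_inv_of_mul_eq_one_left hmul).symm
  refine not_trans (R := RR P) κ _ (hmem m hγ.1) ?_ hne htr
  rw [hinv]
  exact hmem _ (by simpa using hγ.2)

end G4
end SU

/-- Case of one nontrivial unipotent factor: if `γ_s ≠ 1` is unipotent, all other `γ_i` are
semi-simple, and `γ` is semi-simple with an eigenvalue `λ` that is not a root of unity and
satisfies `⟨λ⟩ ∩ Λ(γ₁)⋯Λ(γ_r) = {1}`, then `J = {m : γ^m ∈ ⟨γ₁⟩⋯⟨γ_r⟩}` is finite. -/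
theorem stmt_11 {n : ℕ} (hn : 1 ≤ n) (r : ℕ)
    (γs : Fin r → GL (Fin n) (AlgebraicClosure ℚ)) (s : Fin r)
    (huni : ((γs s : Matrix (Fin n) (Fin n) (AlgebraicClosure ℚ)) - 1) ^ n = 0)
    (hne : γs s ≠ 1)
    (hss : ∀ i : Fin r, i ≠ s → IsSemisimpleElt (γs i))
    (γ : GL (Fin n) (AlgebraicClosure ℚ)) (hγ : IsSemisimpleElt γ)
    (lam : (AlgebraicClosure ℚ)ˣ)
    (heig : ((γ : Matrix (Fin n) (Fin n) (AlgebraicClosure ℚ)).charpoly).IsRoot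
      (lam : AlgebraicClosure ℚ))
    (hru : ∀ k : ℤ, k ≠ 0 → lam ^ k ≠ 1)
    (hint : ∀ x : (AlgebraicClosure ℚ)ˣ, x ∈ Subgroup.zpowers lam →
      (∃ v : Fin r → (AlgebraicClosure ℚ)ˣ,
        (∀ i, v i ∈ eigGroup (γs i)) ∧ x = ∏ i, v i) → x = 1) :
    Set.Finite {m : ℤ | ∃ k : Fin r → ℤ, γ ^ m = (List.ofFn fun i => γs i ^ k i).prod} := by
  exact SU.final r γs s huni hss γ lam heig hru hint
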